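/- arXiv:2002.03077 — 2 statements merged into one kernel-verified Lean document; each statement's English description precedes it below -/
import Mathlib

section
/- Let 𝓡 = (R, <, +, 0, …) be an expansion of a densely linearly ordered abelian group with 𝓡 ⊨ DC and 𝓡 ⊨ LUF₂. Then every D_Σ-subset of R^n is constructible. In particular, every set definable in the open core of 𝓡 is constructible. -/
open FirstOrder Set Topology

section CommonDefs

/-- A subset of `R^n` (coded as `Fin n → R`) is definable in the structure `𝓡` (with
universe `R` and language `L`) with parameters. -/
def IsDefinable (L : FirstOrder.Language) {R : Type*} [L.Structure R] {n : ℕ}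
    (X : Set (Fin n → R)) : Prop :=
  Set.Definable (Set.univ : Set R) L X

/-- An open box in `R^n`: a product of `n` open intervals. -/
def OpenBox {R : Type*} [LT R] {n : ℕ} (B : Set (Fin n → R)) : Prop :=
  ∃ c d : Fin n → R, B = {x | ∀ i, c i < x i ∧ x i < d i}

/-- A closed box in `R^n`: a product of `n` closed intervals. -/
def ClosedBox {R : Type*} [LE R] {n : ℕ} (B : Set (Fin n → R)) : Prop :=
  ∃ c d : Fin n → R, B = {x | ∀ i, c i ≤ x i ∧ x i ≤ d i}

/-- A subset of `R` which is a finite union of points and open intervals. -/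
def FinUnionPtsIntervals {R : Type*} [Preorder R] (s : Set R) : Prop :=
  ∃ (P : Finset R) (Q : Finset (R × R)), s = ↑P ∪ ⋃ p ∈ Q, Set.Ioo p.1 p.2

/-- The fiber `X_x ⊆ R` of a set `X ⊆ R^{m+1}` over `x ∈ R^m`. -/
def fiber1 {R : Type*} {m : ℕ} (X : Set (Fin (m + 1) → R)) (x : Fin m → R) : Set R :=
  {y | Fin.snoc x y ∈ X}

/-- The fiber `X_x ⊆ R^n` of a set `X ⊆ R^{m+n}` over `x ∈ R^m`. -/
def fiberN {R : Type*} {m n : ℕ} (X : Set (Fin (m + n) → R)) (x : Fin m → R) :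
    Set (Fin n → R) :=
  {y | Fin.append x y ∈ X}

/-- The member `X_{r,s} ⊆ R^n` of a parameterized family coded by `F ⊆ R^{2+n}`. -/
def famFiber {R : Type*} {n : ℕ} (F : Set (Fin (2 + n) → R)) (r s : R) : Set (Fin n → R) :=
  {y | Fin.append ![r, s] y ∈ F}

/-- A bounded subset of `R^n`: contained in some closed box. -/
def BddSet {R : Type*} [LE R] {n : ℕ} (X : Set (Fin n → R)) : Prop :=
  ∃ c d : R, ∀ y ∈ X, ∀ i, c ≤ y i ∧ y i ≤ d

/-- A discrete subset of a topological space: each of its points is isolated. -/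
def DiscreteSet {α : Type*} [TopologicalSpace α] (S : Set α) : Prop :=
  ∀ y ∈ S, ∃ U : Set α, IsOpen U ∧ y ∈ U ∧ U ∩ S = {y}

/-- A locally finite subset: each point of the space has an open neighborhood meeting
the set in a finite set. -/
def LocFin {α : Type*} [TopologicalSpace α] (S : Set α) : Prop :=
  ∀ x : α, ∃ U : Set α, IsOpen U ∧ x ∈ U ∧ (S ∩ U).Finite

/-- `F ⊆ R^{2+n}` codes a `D_Σ`-family `{X_{r,s}}_{r>0,s>0}` of CBD subsets of `R^n`:
each fiber is closed, bounded and definable, the family is increasing in `r` and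
decreasing in `s`. -/
def IsDSigmaFamily (L : FirstOrder.Language) {R : Type*} [L.Structure R] [LinearOrder R]
    [Zero R] [TopologicalSpace R] {n : ℕ} (F : Set (Fin (2 + n) → R)) : Prop :=
  IsDefinable L F ∧
    (∀ r s : R, 0 < r → 0 < s →
      IsDefinable L (famFiber F r s) ∧ IsClosed (famFiber F r s) ∧ BddSet (famFiber F r s)) ∧
    (∀ r r' s : R, 0 < r → 0 < s → r ≤ r' → famFiber F r s ⊆ famFiber F r' s) ∧
    (∀ r s s' : R, 0 < r → 0 < s → s ≤ s' → famFiber F r s' ⊆ famFiber F r s)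

/-- A `D_Σ`-set: the union `⋃_{r>0,s>0} X_{r,s}` of a `D_Σ`-family. -/
def IsDSigma (L : FirstOrder.Language) {R : Type*} [L.Structure R] [LinearOrder R]
    [Zero R] [TopologicalSpace R] {n : ℕ} (X : Set (Fin n → R)) : Prop :=
  ∃ F : Set (Fin (2 + n) → R), IsDSigmaFamily L F ∧
    X = ⋃ (r : R) (_ : 0 < r) (s : R) (_ : 0 < s), famFiber F r s

/-- Constructible sets: finite boolean combinations of open sets. -/
inductive IsConstructibleSet {α : Type*} [TopologicalSpace α] : Set α → Prop
  | of_isOpen (s : Set α) : IsOpen s → IsConstructibleSet s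
  | compl (s : Set α) : IsConstructibleSet s → IsConstructibleSet sᶜ
  | union (s t : Set α) : IsConstructibleSet s → IsConstructibleSet t →
      IsConstructibleSet (s ∪ t)

/-- `𝓡 ⊨ DC`: every nonempty definable subset of `R` bounded above has a supremum. -/
def DCProp (L : FirstOrder.Language) (R : Type*) [L.Structure R] [Preorder R] : Prop :=
  ∀ s : Set R, IsDefinable L {v : Fin 1 → R | v 0 ∈ s} → s.Nonempty → BddAbove s →
    ∃ a : R, IsLUB s a

/-- `𝓡 ⊨ LUF₂` (locally uniform finiteness of the second kind). -/
def LUF2 (L : FirstOrder.Language) (R : Type*) [L.Structure R] [LinearOrder R]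
    [TopologicalSpace R] : Prop :=
  ∀ (m : ℕ) (X : Set (Fin (m + 1) → R)), IsDefinable L X → ∀ (a : R) (b : Fin m → R),
    ∃ N : ℕ, 0 < N ∧ ∃ p q : R, a ∈ interior (Set.Icc p q) ∧
      ∃ U : Set (Fin m → R), OpenBox U ∧ b ∈ U ∧
        ∀ x ∈ U, ∀ p' q' : R, a ∈ interior (Set.Icc p' q') → Set.Icc p' q' ⊆ Set.Icc p q →
          (fiber1 X x ∩ Set.Icc p' q').Infinite ∨ (fiber1 X x ∩ Set.Icc p' q').ncard ≤ N

/-- `𝓡 ⊨ LUF₁`: `LUF₂` with `U` always taken to be all of `R^m`. -/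
def LUF1 (L : FirstOrder.Language) (R : Type*) [L.Structure R] [LinearOrder R]
    [TopologicalSpace R] : Prop :=
  ∀ (m : ℕ) (X : Set (Fin (m + 1) → R)), IsDefinable L X → ∀ a : R,
    ∃ N : ℕ, 0 < N ∧ ∃ p q : R, a ∈ interior (Set.Icc p q) ∧
      ∀ (x : Fin m → R), ∀ p' q' : R,
        a ∈ interior (Set.Icc p' q') → Set.Icc p' q' ⊆ Set.Icc p q →
          (fiber1 X x ∩ Set.Icc p' q').Infinite ∨ (fiber1 X x ∩ Set.Icc p' q').ncard ≤ N

/-- `𝓡 ⊨ SLUF`: `LUF₁` with the interval `I` chosen independently of the definable set. -/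
def SLUF (L : FirstOrder.Language) (R : Type*) [L.Structure R] [LinearOrder R]
    [TopologicalSpace R] : Prop :=
  ∀ a : R, ∃ p q : R, a ∈ interior (Set.Icc p q) ∧
    ∀ (m : ℕ) (X : Set (Fin (m + 1) → R)), IsDefinable L X →
      ∃ N : ℕ, 0 < N ∧
        ∀ (x : Fin m → R), ∀ p' q' : R,
          a ∈ interior (Set.Icc p' q') → Set.Icc p' q' ⊆ Set.Icc p q →
            (fiber1 X x ∩ Set.Icc p' q').Infinite ∨ (fiber1 X x ∩ Set.Icc p' q').ncard ≤ N

/-- The language of the open core of `𝓡`: one `n`-ary relation symbol for each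
`𝓡`-definable open subset of `R^n`. -/
def openCoreLang (L : FirstOrder.Language) (R : Type*) [L.Structure R] [TopologicalSpace R] :
    FirstOrder.Language where
  Functions := fun _ => Empty
  Relations := fun n => { s : Set (Fin n → R) // Set.Definable (Set.univ : Set R) L s ∧ IsOpen s }

/-- The open core of `𝓡`: the structure on `R` interpreting each relation symbol by the
corresponding `𝓡`-definable open set. -/
def openCoreStructure (L : FirstOrder.Language) (R : Type*) [L.Structure R]
    [TopologicalSpace R] : (openCoreLang L R).Structure R where
  funMap := fun f _ => f.elim
  RelMap := fun s x => x ∈ s.1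

/-- A set is definable in the open core of `𝓡` if it is definable (with parameters) in the
structure generated by the `𝓡`-definable open sets. -/
def DefinableInOpenCore (L : FirstOrder.Language) (R : Type*) [L.Structure R]
    [TopologicalSpace R] {n : ℕ} (X : Set (Fin n → R)) : Prop :=
  letI := openCoreStructure L R
  Set.Definable (Set.univ : Set R) (openCoreLang L R) X

/-- The local dimension `dim_x X` of `X ⊆ R^n` at `x`, an element of `{-∞} ∪ ℕ ∪ {∞}`:
the supremum of the nonnegative integers `d` such that for every open box `B` containing
`x`, some coordinate projection of `B ∩ X` to `R^d` has nonempty interior (and `-∞` if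
some open box containing `x` misses `X`). -/
noncomputable def locDim {R : Type*} [LT R] [TopologicalSpace R] {n : ℕ}
    (X : Set (Fin n → R)) (x : Fin n → R) : WithBot ℕ∞ :=
  sSup {e : WithBot ℕ∞ | ∃ d : ℕ, e = ((d : ℕ∞) : WithBot ℕ∞) ∧
    ∀ B : Set (Fin n → R), OpenBox B → x ∈ B →
      ∃ f : Fin d → Fin n, Function.Injective f ∧
        (interior ((fun y => y ∘ f) '' (B ∩ X))).Nonempty}

/-- The dimension of `X ⊆ R^n`: the supremum of the local dimensions. -/
noncomputable def setDim {R : Type*} [LT R] [TopologicalSpace R] {n : ℕ}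
    (X : Set (Fin n → R)) : WithBot ℕ∞ :=
  ⨆ x : Fin n → R, locDim X x

/-- The projective dimension of `X ⊆ R^n`: the supremum of the nonnegative integers `d`
such that some coordinate projection of `X` to `R^d` has nonempty interior (`-∞` for the
empty set). -/
noncomputable def projDim {R : Type*} [TopologicalSpace R] {n : ℕ}
    (X : Set (Fin n → R)) : WithBot ℕ∞ :=
  sSup {e : WithBot ℕ∞ | ∃ d : ℕ, e = ((d : ℕ∞) : WithBot ℕ∞) ∧
    ∃ f : Fin d → Fin n, Function.Injective f ∧
      (interior ((fun y => y ∘ f) '' X)).Nonempty}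

/-- A subset of `R` which is a union of at most `N` open intervals. -/
def UnionAtMostOpenIntervals {R : Type*} [Preorder R] (N : ℕ) (s : Set R) : Prop :=
  ∃ Q : Finset (R × R), Q.card ≤ N ∧ s = ⋃ p ∈ Q, Set.Ioo p.1 p.2

/-- A subset of `R` which is a union of at most `N₁` points and `N₂` closed intervals. -/
def UnionAtMostPtsClosedIntervals {R : Type*} [Preorder R] (N₁ N₂ : ℕ) (s : Set R) : Prop :=
  ∃ (P : Finset R) (Q : Finset (R × R)), P.card ≤ N₁ ∧ Q.card ≤ N₂ ∧
    s = ↑P ∪ ⋃ p ∈ Q, Set.Icc p.1 p.2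

/-- A subset of `R` which is a union of at most `N₁` points and `N₂` open intervals. -/
def UnionAtMostPtsOpenIntervals {R : Type*} [Preorder R] (N₁ N₂ : ℕ) (s : Set R) : Prop :=
  ∃ (P : Finset R) (Q : Finset (R × R)), P.card ≤ N₁ ∧ Q.card ≤ N₂ ∧
    s = ↑P ∪ ⋃ p ∈ Q, Set.Ioo p.1 p.2

/-- `X ∩ B` is the graph of a continuous map defined on the coordinate-projection image
of `B` (the projection being given by the injection `f` of coordinates). -/
def IsGraphOn {R : Type*} [TopologicalSpace R] {n d : ℕ} (f : Fin d → Fin n)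
    (S : Set (Fin n → R)) (D : Set (Fin d → R)) : Prop :=
  ∃ g : (Fin d → R) → (Fin n → R), ContinuousOn g D ∧ (∀ z ∈ D, (g z) ∘ f = z) ∧ S = g '' D

end CommonDefs

namespace OC

section Defn
variable (L : FirstOrder.Language) {R : Type*} [L.Structure R]
variable {ι κ : Type}

/-- Definable predicates on tuples (with parameters). -/
structure DP (p : (ι → R) → Prop) : Prop where
  out : Set.Definable (Set.univ : Set R) L {v | p v}

/-- Definable functions on tuples (with parameters). -/
structure DF (f : (ι → R) → R) : Prop where
  out : Set.DefinableFun L (Set.univ : Set R) f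

variable {L}

theorem DP.congr {p q : (ι → R) → Prop} (h : DP L p) (e : ∀ v, q v ↔ p v) : DP L q := by
  have : q = p := funext fun v => propext (e v)
  rw [this]; exact h

theorem DP.and {p q : (ι → R) → Prop} (hp : DP L p) (hq : DP L q) :
    DP L (fun v => p v ∧ q v) := ⟨Set.Definable.inter hp.out hq.out⟩

theorem DP.or {p q : (ι → R) → Prop} (hp : DP L p) (hq : DP L q) :
    DP L (fun v => p v ∨ q v) := ⟨Set.Definable.union hp.out hq.out⟩

theorem DP.not {p : (ι → R) → Prop} (hp : DP L p) : DP L (fun v => ¬ p v) :=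
  ⟨Set.Definable.compl hp.out⟩

theorem DP.imp {p q : (ι → R) → Prop} (hp : DP L p) (hq : DP L q) :
    DP L (fun v => p v → q v) :=
  (hp.not.or hq).congr fun v => by tauto

theorem DP.const (P : Prop) : DP L (fun _ : ι → R => P) := by
  by_cases h : P
  · simp only [h]
    exact ⟨Set.definable_univ⟩
  · simp only [h]
    exact ⟨Set.definable_empty⟩

theorem DP.comp {p : (κ → R) → Prop} (hp : DP L p) (g : κ → ι) :
    DP L (fun v : ι → R => p (v ∘ g)) := ⟨Set.Definable.preimage_comp g hp.out⟩

theorem DP.subst [Finite κ] {p : (κ → R) → Prop} (hp : DP L p) {t : (ι → R) → κ → R}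
    (ht : ∀ k, DF L (fun v => t v k)) : DP L (fun v => p (t v)) :=
  ⟨Set.Definable.preimage_map (F := t) (fun k => (ht k).out) hp.out⟩

theorem DP.ex [Finite κ] {p : (ι → R) → (κ → R) → Prop}
    (h : DP L (fun w : ι ⊕ κ → R => p (w ∘ Sum.inl) (w ∘ Sum.inr))) :
    DP L (fun v => ∃ y, p v y) := by
  exact ⟨Set.Definable.exists_of_finite h.out⟩

theorem DP.all [Finite κ] {p : (ι → R) → (κ → R) → Prop}
    (h : DP L (fun w : ι ⊕ κ → R => p (w ∘ Sum.inl) (w ∘ Sum.inr))) :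
    DP L (fun v => ∀ y, p v y) := by
  exact ⟨Set.Definable.forall_of_finite h.out⟩

theorem DP.ex1 {p : (ι → R) → R → Prop}
    (h : DP L (fun w : ι ⊕ Unit → R => p (w ∘ Sum.inl) (w (Sum.inr ())))) :
    DP L (fun v => ∃ y, p v y) := by
  have := DP.ex (p := fun (v : ι → R) (y : Unit → R) => p v (y ())) h
  exact this.congr fun v => ⟨fun ⟨y, hy⟩ => ⟨fun _ => y, hy⟩, fun ⟨y, hy⟩ => ⟨_, hy⟩⟩

theorem DP.all1 {p : (ι → R) → R → Prop}
    (h : DP L (fun w : ι ⊕ Unit → R => p (w ∘ Sum.inl) (w (Sum.inr ())))) :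
    DP L (fun v => ∀ y, p v y) := by
  have := DP.all (p := fun (v : ι → R) (y : Unit → R) => p v (y ())) h
  exact this.congr fun v => ⟨fun h y => h _, fun h y => h (fun _ => y)⟩

theorem DP.allFin [Finite κ] {p : κ → (ι → R) → Prop} (h : ∀ k, DP L (p k)) :
    DP L (fun v => ∀ k, p k v) := by
  have := Set.definable_iInter_of_finite (fun k => (h k).out)
  refine ⟨Eq.mp ?_ this⟩
  congr 1
  ext v
  simp

theorem DP.exFin [Finite κ] {p : κ → (ι → R) → Prop} (h : ∀ k, DP L (p k)) :
    DP L (fun v => ∃ k, p k v) := by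
  have := (DP.allFin (fun k => (h k).not)).not
  exact this.congr fun v => by simp

theorem DF.proj (i : ι) : DF L (fun v : ι → R => v i) := ⟨Set.DefinableFun.proj (L := L)⟩

theorem DF.const (a : R) : DF L (fun _ : ι → R => a) :=
  ⟨L.definableFun_const ι (Set.mem_univ a)⟩

theorem DP.eq {f g : (ι → R) → R} (hf : DF L f) (hg : DF L g) : DP L (fun v => f v = g v) :=
  ⟨Set.DefinableFun.ofPred_eq hf.out hg.out⟩

theorem DF.of_graph {f : (ι → R) → R}
    (h : DP L (fun w : ι ⊕ Unit → R => f (w ∘ Sum.inl) = w (Sum.inr ()))) : DF L f := by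
  have := h.comp (ι := Option ι) (Sum.elim some (fun _ => none))
  exact ⟨this.out⟩

theorem DF.comp {f : (κ → R) → R} (hf : DF L f) (g : κ → ι) :
    DF L (fun v : ι → R => f (v ∘ g)) := by
  have h : DP L (fun w : Option κ → R => f (w ∘ some) = w none) := ⟨hf.out⟩
  exact ⟨(h.comp (ι := Option ι) (Option.map g)).out⟩

end Defn

/-- The standing hypotheses. -/
class Good (L : FirstOrder.Language) (R : Type*) [L.Structure R] [LinearOrder R]
    [AddCommGroup R] [TopologicalSpace R] : Prop where
  lt : DP L (fun v : Fin 2 → R => v 0 < v 1)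
  add : DP L (fun v : Fin 3 → R => v 0 + v 1 = v 2)
  dc : DCProp L R
  luf : LUF2 L R

section Arith
variable {L : FirstOrder.Language} {R : Type*} [L.Structure R] [LinearOrder R] [AddCommGroup R]
  [TopologicalSpace R] [Good L R]
variable {ι κ : Type}

theorem DP.lt {f g : (ι → R) → R} (hf : DF L f) (hg : DF L g) : DP L (fun v => f v < g v) := by
  have := (Good.lt (L := L) (R := R)).subst (t := fun v => ![f v, g v]) (by
    intro k; fin_cases k <;> assumption)
  exact this

theorem DP.le {f g : (ι → R) → R} (hf : DF L f) (hg : DF L g) : DP L (fun v => f v ≤ g v) :=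
  (DP.lt hg hf).not.congr fun v => by simp

theorem DF.add {f g : (ι → R) → R} (hf : DF L f) (hg : DF L g) : DF L (fun v => f v + g v) := by
  apply DF.of_graph
  exact (Good.add (L := L) (R := R)).subst
    (t := fun w : ι ⊕ Unit → R => ![f (w ∘ Sum.inl), g (w ∘ Sum.inl), w (Sum.inr ())]) (by
    intro k; fin_cases k
    · exact hf.comp _
    · exact hg.comp _
    · exact DF.proj _)

theorem DF.sub {f g : (ι → R) → R} (hf : DF L f) (hg : DF L g) : DF L (fun v => f v - g v) := by
  apply DF.of_graph
  refine (DP.eq (hf.comp Sum.inl) ((DF.proj (Sum.inr ())).add (hg.comp Sum.inl))).congr ?_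
  intro v
  exact sub_eq_iff_eq_add

theorem DF.neg {f : (ι → R) → R} (hf : DF L f) : DF L (fun v => - f v) := by
  have := (DF.const (L := L) (ι := ι) (0 : R)).sub hf
  simpa only [zero_sub] using this

end Arith
end OC

set_option linter.unusedSectionVars false

namespace OC

section Top
variable {R : Type*} [LinearOrder R] [DenselyOrdered R] [AddCommGroup R]
  [IsOrderedAddMonoid R] [Nontrivial R] [TopologicalSpace R] [OrderTopology R]
variable {ι κ : Type}

theorem exists_pos_R : ∃ ε : R, 0 < ε := exists_zero_lt

theorem exists_half {ε : R} (h : 0 < ε) : ∃ δ : R, 0 < δ ∧ δ < ε ∧ δ + δ < ε := by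
  obtain ⟨a, ha, ha'⟩ := exists_between h
  have : 0 < min a (ε - a) := lt_min ha (sub_pos.2 ha')
  obtain ⟨b, hb, hb'⟩ := exists_between this
  have h1 := hb'.trans_le (min_le_left _ _)
  have h2 := hb'.trans_le (min_le_right _ _)
  refine ⟨b, hb, by grind, by grind⟩

/-- The open box of radius `ε`. -/
def Bx (x : ι → R) (ε : R) : Set (ι → R) := {y | ∀ i, x i - ε < y i ∧ y i < x i + ε}

/-- The closed box of radius `ε`. -/
def CBx (x : ι → R) (ε : R) : Set (ι → R) := {y | ∀ i, x i - ε ≤ y i ∧ y i ≤ x i + ε}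

theorem mem_Bx_self (x : ι → R) {ε : R} (h : 0 < ε) : x ∈ Bx x ε := fun i => by
  constructor <;> grind

theorem Bx_subset_CBx (x : ι → R) (ε : R) : Bx x ε ⊆ CBx x ε := fun _ hy i =>
  ⟨(hy i).1.le, (hy i).2.le⟩

theorem CBx_subset_Bx (x : ι → R) {ε δ : R} (h : ε < δ) : CBx x ε ⊆ Bx x δ := fun y hy i => by
  have := hy i
  constructor <;> grind

theorem Bx_mono (x : ι → R) {ε δ : R} (h : ε ≤ δ) : Bx x ε ⊆ Bx x δ := fun y hy i => by
  have := hy i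
  constructor <;> grind

theorem CBx_eq (x : ι → R) (ε : R) :
    CBx x ε = Icc (fun i => x i - ε) (fun i => x i + ε) := by
  ext y
  simp only [CBx, mem_ofPred_eq, mem_Icc, Pi.le_def, forall_and]

theorem isOpen_Bx [Finite ι] (x : ι → R) (ε : R) : IsOpen (Bx x ε) := by
  have : Bx x ε = Set.pi univ (fun i => Ioo (x i - ε) (x i + ε)) := by
    ext y; simp [Bx]
  rw [this]
  exact isOpen_set_pi finite_univ (fun i _ => isOpen_Ioo)

theorem isClosed_CBx (x : ι → R) (ε : R) : IsClosed (CBx x ε) := by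
  rw [CBx_eq]; exact isClosed_Icc

theorem Bx_mem_nhds [Finite ι] (x : ι → R) {ε : R} (h : 0 < ε) : Bx x ε ∈ 𝓝 x :=
  (isOpen_Bx x ε).mem_nhds (mem_Bx_self x h)

theorem exists_common_pos {κ : Type*} [Finite κ] {P : κ → R → Prop} (h : ∀ k, ∃ ε > 0, P k ε)
    (mono : ∀ k ε ε', 0 < ε' → ε' ≤ ε → P k ε → P k ε') : ∃ ε > 0, ∀ k, P k ε := by
  classical
  cases nonempty_fintype κ
  choose e he hP using h
  obtain ⟨ε₀, h0⟩ := exists_pos_R (R := R)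
  have key : ∀ s : Finset κ, ∃ ε > 0, ∀ k ∈ s, ε ≤ e k := by
    intro s
    induction s using Finset.induction with
    | empty => exact ⟨ε₀, h0, by simp⟩
    | insert k s _ ih =>
      obtain ⟨ε, hε, h⟩ := ih
      refine ⟨min ε (e k), lt_min hε (he k), ?_⟩
      intro j hj
      rcases Finset.mem_insert.1 hj with rfl | hj
      · exact min_le_right _ _
      · exact (min_le_left _ _).trans (h j hj)
  obtain ⟨ε, hε, h⟩ := key Finset.univ
  exact ⟨ε, hε, fun k => mono k _ _ hε (h k (Finset.mem_univ k)) (hP k)⟩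

theorem exists_Ioo_of_nhds {a : R} {U : Set R} (h : U ∈ 𝓝 a) :
    ∃ ε > 0, Ioo (a - ε) (a + ε) ⊆ U := by
  obtain ⟨ε, hε, h'⟩ := (nhds_basis_Ioo_pos a).mem_iff.1 h
  exact ⟨ε, hε, h'⟩

theorem exists_Bx_of_nhds [Finite ι] {x : ι → R} {U : Set (ι → R)} (h : U ∈ 𝓝 x) :
    ∃ ε > 0, Bx x ε ⊆ U := by
  rw [nhds_pi, Filter.mem_pi'] at h
  obtain ⟨I, t, ht, hU⟩ := h
  obtain ⟨ε, hε, h⟩ := exists_common_pos (P := fun i ε => Ioo (x i - ε) (x i + ε) ⊆ t i)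
    (fun i => exists_Ioo_of_nhds (ht i)) (by
      intro k ε ε' _ hle hs y hy
      apply hs
      simp only [mem_Ioo] at hy ⊢
      constructor <;> grind)
  exact ⟨ε, hε, fun y hy => hU fun i _ => h i (hy i)⟩

theorem exists_CBx_of_nhds [Finite ι] {x : ι → R} {U : Set (ι → R)} (h : U ∈ 𝓝 x) :
    ∃ ε > 0, CBx x ε ⊆ U := by
  obtain ⟨ε, hε, h⟩ := exists_Bx_of_nhds h
  obtain ⟨δ, hδ, hδ', _⟩ := exists_half hε
  exact ⟨δ, hδ, (CBx_subset_Bx x hδ').trans h⟩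

theorem mem_closure_iff_Bx [Finite ι] {x : ι → R} {X : Set (ι → R)} :
    x ∈ closure X ↔ ∀ ε, 0 < ε → ∃ y, y ∈ X ∧ y ∈ Bx x ε := by
  rw [mem_closure_iff_nhds]
  constructor
  · intro h ε hε
    obtain ⟨y, hy, hy'⟩ := h _ (Bx_mem_nhds x hε)
    exact ⟨y, hy', hy⟩
  · intro h t ht
    obtain ⟨ε, hε, h'⟩ := exists_Bx_of_nhds ht
    obtain ⟨y, hy, hy'⟩ := h ε hε
    exact ⟨y, h' hy', hy⟩

theorem interior_nonempty_iff [Finite ι] {X : Set (ι → R)} :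
    (interior X).Nonempty ↔ ∃ x ε, 0 < ε ∧ ∀ y, y ∈ Bx x ε → y ∈ X := by
  constructor
  · rintro ⟨x, hx⟩
    obtain ⟨ε, hε, h⟩ := exists_Bx_of_nhds (mem_interior_iff_mem_nhds.1 hx)
    exact ⟨x, ε, hε, h⟩
  · rintro ⟨x, ε, hε, h⟩
    exact ⟨x, mem_interior.2 ⟨_, h, isOpen_Bx x ε, mem_Bx_self x hε⟩⟩

/-- No accumulation point. -/
def NA (S : Set R) : Prop := ∀ a, ∃ δ > 0, ∀ y ∈ S, a - δ < y → y < a + δ → y = a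

theorem NA.subset {S T : Set R} (h : NA T) (hs : S ⊆ T) : NA S := fun a => by
  obtain ⟨δ, hδ, h⟩ := h a
  exact ⟨δ, hδ, fun y hy => h y (hs hy)⟩

theorem NA_of_locFinite {S : Set R} (h : ∀ a, ∃ δ > 0, (S ∩ Ioo (a - δ) (a + δ)).Finite) :
    NA S := by
  intro a
  obtain ⟨δ, hδ, hf⟩ := h a
  have hc : IsClosed ((S ∩ Ioo (a - δ) (a + δ)) \ {a}) := (hf.subset sdiff_subset).isClosed
  have : ((S ∩ Ioo (a - δ) (a + δ)) \ {a})ᶜ ∈ 𝓝 a := hc.isOpen_compl.mem_nhds (by simp)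
  obtain ⟨ε, hε, h'⟩ := exists_Ioo_of_nhds this
  refine ⟨min δ ε, lt_min hδ hε, fun y hy h1 h2 => ?_⟩
  by_contra hne
  have e1 := min_le_left δ ε
  have e2 := min_le_right δ ε
  have : y ∈ Ioo (a - ε) (a + ε) := ⟨by grind, by grind⟩
  exact h' this ⟨⟨hy, by grind, by grind⟩, hne⟩

/-- Successors exist. -/
def HasSucc (S : Set R) : Prop := ∀ u, (S ∩ Ioi u).Nonempty → ∃ z, IsLeast (S ∩ Ioi u) z

theorem HasSucc.initial {S : Set R} (hS : HasSucc S) (u v : R) (k : ℕ)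
    (hk : (k : ℕ∞) < (S ∩ Ioc u v).encard) :
    ∃ v' ≤ v, u < v' ∧ (S ∩ Ioc u v').encard = k + 1 := by
  have step : ∀ (u : R), (S ∩ Ioc u v).Nonempty → ∃ z, IsLeast (S ∩ Ioi u) z ∧ z ≤ v := by
    rintro u ⟨y, hy, hy1, hy2⟩
    obtain ⟨z, hz⟩ := hS u ⟨y, hy, hy1⟩
    exact ⟨z, hz, (hz.2 ⟨hy, hy1⟩).trans hy2⟩
  induction k with
  | zero =>
    obtain ⟨z, hz, hzv⟩ := step u (by
      rw [← encard_pos]; simpa using hk)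
    refine ⟨z, hzv, hz.1.2, ?_⟩
    have : S ∩ Ioc u z = {z} := by
      ext y
      constructor
      · rintro ⟨h1, h2, h3⟩
        exact le_antisymm h3 (hz.2 ⟨h1, h2⟩)
      · rintro rfl
        exact ⟨hz.1.1, hz.1.2, le_rfl⟩
    simp [this]
  | succ k ih =>
    obtain ⟨w, hw, huw, hcard⟩ := ih (lt_of_le_of_lt (by norm_cast; omega) hk)
    have hne : (S ∩ Ioc w v).Nonempty := by
      by_contra hem
      rw [not_nonempty_iff_eq_empty] at hem
      have : S ∩ Ioc u v ⊆ S ∩ Ioc u w := by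
        rintro y ⟨h1, h2, h3⟩
        refine ⟨h1, h2, ?_⟩
        by_contra hlt
        have : y ∈ S ∩ Ioc w v := ⟨h1, not_le.1 hlt, h3⟩
        rw [hem] at this
        exact this
      have := encard_le_encard this
      rw [hcard] at this
      push_cast at hk
      exact absurd hk (not_lt.2 this)
    obtain ⟨z, hz, hzv⟩ := step w hne
    have hwz : w < z := hz.1.2
    refine ⟨z, hzv, huw.trans hwz, ?_⟩
    have : S ∩ Ioc u z = insert z (S ∩ Ioc u w) := by
      ext y
      constructor
      · rintro ⟨h1, h2, h3⟩
        rcases le_or_gt y w with h | h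
        · exact Or.inr ⟨h1, h2, h⟩
        · exact Or.inl (le_antisymm h3 (hz.2 ⟨h1, h⟩))
      · rintro (rfl | ⟨h1, h2, h3⟩)
        · exact ⟨hz.1.1, huw.trans hwz, le_rfl⟩
        · exact ⟨h1, h2, h3.trans hwz.le⟩
    rw [this, encard_insert_of_notMem, hcard]
    · push_cast; rfl
    · rintro ⟨_, _, h⟩
      exact absurd h (not_le.2 hwz)

end Top
end OC

set_option linter.unusedSectionVars false
namespace OC

section OneDim
variable {L : FirstOrder.Language} {R : Type*} [L.Structure R] [LinearOrder R] [DenselyOrdered R]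
  [AddCommGroup R] [IsOrderedAddMonoid R] [Nontrivial R] [TopologicalSpace R] [OrderTopology R]
  [Good L R]
variable {ι κ : Type}

theorem luf_raw [Fintype ι] {p : (ι → R) → R → Prop}
    (hp : DP L (fun w : ι ⊕ Unit → R => p (w ∘ Sum.inl) (w (Sum.inr ()))))
    (b : ι → R) (a : R) : ∃ N : ℕ, ∃ δ > 0, ∀ x ∈ Bx b δ,
      ({y | p x y} ∩ Icc (a - δ) (a + δ)).Infinite ∨
        ({y | p x y} ∩ Icc (a - δ) (a + δ)).encard ≤ N := by
  let m := Fintype.card ι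
  let e : ι ≃ Fin m := Fintype.equivFin ι
  let X : Set (Fin (m + 1) → R) := {v | p (fun i => v (Fin.castSucc (e i))) (v (Fin.last m))}
  have hX : IsDefinable L X :=
    (hp.comp (ι := Fin (m + 1)) (Sum.elim (Fin.castSucc ∘ e) (fun _ => Fin.last m))).out
  obtain ⟨N, -, c, d, ha, U, ⟨cU, dU, hU⟩, hbU, H⟩ :=
    Good.luf (L := L) (R := R) m X hX a (b ∘ e.symm)
  have hfib : ∀ x : ι → R, fiber1 X (x ∘ e.symm) = {y | p x y} := by
    intro x
    ext y
    simp [fiber1, X]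
  have hUo : IsOpen U := by
    have : U = Set.pi univ (fun i => Ioo (cU i) (dU i)) := by
      rw [hU]; ext y; simp
    rw [this]
    exact isOpen_set_pi finite_univ (fun i _ => isOpen_Ioo)
  have hcont : Continuous (fun x : ι → R => x ∘ e.symm) :=
    continuous_pi fun i => continuous_apply _
  obtain ⟨δ₁, h1, hB⟩ := exists_Bx_of_nhds (hcont.continuousAt.preimage_mem_nhds
    (hUo.mem_nhds hbU))
  obtain ⟨δ₂, h2, hI⟩ := exists_Ioo_of_nhds (mem_interior_iff_mem_nhds.1 ha)
  obtain ⟨δ, h0, hδ⟩ := exists_between (lt_min h1 h2)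
  have hδ1 := hδ.trans_le (min_le_left _ _)
  have hδ2 := hδ.trans_le (min_le_right _ _)
  refine ⟨N, δ, h0, fun x hx => ?_⟩
  have hxU : x ∘ e.symm ∈ U := hB (Bx_mono b hδ1.le hx)
  have := H _ hxU (a - δ) (a + δ) (by
    rw [mem_interior_iff_mem_nhds]
    exact Icc_mem_nhds (by grind) (by grind)) (by
    intro y hy
    apply hI
    exact ⟨by have := hy.1; grind, by have := hy.2; grind⟩)
  rw [hfib] at this
  rcases this with h | h
  · exact Or.inl h
  · by_cases hf : ({y | p x y} ∩ Icc (a - δ) (a + δ)).Finite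
    · right
      rw [← hf.cast_ncard_eq]
      exact_mod_cast h
    · exact Or.inl hf

theorem luf_fam [Fintype ι] {p : (ι → R) → R → Prop}
    (hp : DP L (fun w : ι ⊕ Unit → R => p (w ∘ Sum.inl) (w (Sum.inr ()))))
    (b : ι → R) (a : R) : ∃ N : ℕ, ∃ δ > 0, ∀ x ∈ Bx b δ, HasSucc {y | p x y} →
      ({y | p x y} ∩ Ioo (a - δ) (a + δ)).encard ≤ N := by
  let q : (ι ⊕ Bool → R) → R → Prop := fun v y =>
    p (v ∘ Sum.inl) y ∧ v (Sum.inr false) < y ∧ y ≤ v (Sum.inr true)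
  have hq : DP L (fun w : (ι ⊕ Bool) ⊕ Unit → R => q (w ∘ Sum.inl) (w (Sum.inr ()))) := by
    refine DP.and ?_ (DP.and (DP.lt (DF.proj _) (DF.proj _)) (DP.le (DF.proj _) (DF.proj _)))
    exact hp.comp (Sum.elim (Sum.inl ∘ Sum.inl) (fun _ => Sum.inr ()))
  obtain ⟨N, δ, hδ, H⟩ := luf_raw hq (Sum.elim b (fun _ => a)) a
  refine ⟨N, δ, hδ, fun x hx hS => ?_⟩
  by_contra hlt
  rw [not_le] at hlt
  obtain ⟨T, hT, hTc⟩ := exists_subset_encard_eq (Order.add_one_le_of_lt hlt)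
  have hTf : T.Finite := finite_of_encard_eq_coe (k := N + 1) (by rw [hTc]; push_cast; rfl)
  have hTne : T.Nonempty := by
    rw [← encard_pos, hTc]; positivity
  obtain ⟨t0, ht0, hmin⟩ := exists_min_image T id hTf hTne
  obtain ⟨t1, ht1, hmax⟩ := exists_max_image T id hTf hTne
  obtain ⟨u, hu, hu'⟩ := exists_between (hT ht0).2.1
  have hsub : T ⊆ {y | p x y} ∩ Ioc u t1 := fun y hy =>
    ⟨(hT hy).1, hu'.trans_le (hmin y hy), hmax y hy⟩
  have hcard : (N : ℕ∞) < ({y | p x y} ∩ Ioc u t1).encard := by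
    refine lt_of_lt_of_le ?_ (encard_le_encard hsub)
    rw [hTc]
    exact_mod_cast Nat.lt_succ_self N
  obtain ⟨v, hv, huv, hc⟩ := hS.initial u t1 N hcard
  have hv2 : v < a + δ := hv.trans_lt (hT ht1).2.2
  have := H (Sum.elim x (fun c => if c then v else u)) (by
    rintro (i | i)
    · exact hx i
    · have : a - δ < v := hu.trans huv
      have : u < a + δ := huv.trans hv2
      cases i <;> simp <;> constructor <;> assumption)
  have heq : {y | q (Sum.elim x (fun c => if c then v else u)) y} ∩ Icc (a - δ) (a + δ)
      = {y | p x y} ∩ Ioc u v := by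
    ext y
    constructor
    · rintro ⟨⟨h1, h2, h3⟩, -⟩
      exact ⟨h1, h2, h3⟩
    · rintro ⟨h1, h2, h3⟩
      exact ⟨⟨h1, h2, h3⟩, (hu.trans h2).le, h3.trans hv2.le⟩
  rw [heq, hc] at this
  rcases this with h | h
  · rw [← encard_eq_top_iff, hc] at h
    exact absurd h (by exact_mod_cast ENat.natCast_ne_top (N + 1))
  · exact absurd h (by rw [not_le]; exact_mod_cast Nat.lt_succ_self N)

/-- definable subsets of the line -/
def D1 (L : FirstOrder.Language) {R : Type*} [L.Structure R] (S : Set R) : Prop :=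
  DP L (fun w : Unit → R => w () ∈ S)

theorem exists_sup {S : Set R} (hS : D1 L S) (hne : S.Nonempty) (hb : BddAbove S) :
    ∃ a, IsLUB S a :=
  Good.dc (L := L) (R := R) S (hS.comp (ι := Fin 1) (fun _ => 0)).out hne hb

theorem exists_inf {S : Set R} (hS : D1 L S) (hne : S.Nonempty) (hb : BddBelow S) :
    ∃ a, IsGLB S a := by
  obtain ⟨a, ha⟩ := exists_sup (L := L) (S := lowerBounds S) (by
    unfold D1
    refine DP.congr (p := fun w => ∀ y, y ∈ S → w () ≤ y) ?_ (fun v => Iff.rfl)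
    refine DP.all1 (DP.imp ?_ (DP.le (DF.proj _) (DF.proj _)))
    exact hS.comp (fun _ => Sum.inr ())) hb
    (by obtain ⟨y, hy⟩ := hne; exact ⟨y, fun z hz => hz hy⟩)
  exact ⟨a, isLUB_lowerBounds.1 ha⟩

theorem NA.hasSucc {S : Set R} (hS : D1 L S) (h : NA S) : HasSucc S := by
  intro u hne
  obtain ⟨a, ha⟩ := exists_inf (L := L) (S := S ∩ Ioi u) (by
    exact DP.and hS (DP.lt (DF.const u) (DF.proj ()))) hne ⟨u, fun y hy => le_of_lt hy.2⟩
  obtain ⟨δ, hδ, H⟩ := h a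
  obtain ⟨y, hy, hay, hya⟩ := ha.exists_between (b := a + δ) (by grind)
  have : y = a := H y hy.1 (by grind) hya
  subst this
  exact ⟨y, hy, ha.1⟩

/-- Family with separated members. -/
theorem NA_of_sep {M : R → Set R}
    (hM : DP L (fun w : Unit ⊕ Unit → R => w (Sum.inr ()) ∈ M (w (Sum.inl ()))))
    (sep : ∀ ε > 0, ∀ y ∈ M ε, ∀ y' ∈ M ε, y < y' → y + ε ≤ y')
    (mono : ∀ ε ε', 0 < ε' → ε' ≤ ε → M ε ⊆ M ε') :
    NA {y | ∃ ε > 0, y ∈ M ε} := by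
  apply NA_of_locFinite
  intro a
  obtain ⟨N, δ, hδ, H⟩ := luf_fam (ι := Unit) (p := fun v y => y ∈ M (v ())) hM (fun _ => 0) a
  refine ⟨δ, hδ, ?_⟩
  have H' : ∀ ε, 0 < ε → ε < δ → (M ε ∩ Ioo (a - δ) (a + δ)).encard ≤ N := by
    intro ε hε hεδ
    refine H (fun _ => ε) (fun i => ⟨by grind, by grind⟩) ?_
    refine NA.hasSucc (L := L) ?_ ?_
    · exact hM.subst (t := fun (w : Unit → R) => Sum.elim (fun _ => ε) (fun _ => w ())) (by
        rintro (i | i)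
        · exact DF.const _
        · exact DF.proj _)
    · intro b
      by_cases hb : ∃ y ∈ M ε, y ≠ b ∧ b - ε < y ∧ y < b + ε
      · obtain ⟨δ', h1, h2, h3⟩ := exists_half hε
        by_cases hb : ∃ y ∈ M ε, y ≠ b ∧ b - δ' < y ∧ y < b + δ'
        · obtain ⟨y, hy, hyb, hy1, hy2⟩ := hb
          refine ⟨min δ' (max (y - b) (b - y)), by grind, fun z hz hz1 hz2 => ?_⟩
          by_contra hne
          have := sep ε hε y hy z hz
          have := sep ε hε z hz y hy
          grind
        · push Not at hb
          refine ⟨δ', h1, fun y hy h4 h5 => ?_⟩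
          by_contra hne
          exact absurd h5 (not_lt.2 (hb y hy hne h4))
      · push Not at hb
        refine ⟨ε, hε, fun y hy h1 h2 => ?_⟩
        by_contra hne
        exact absurd h2 (not_lt.2 (hb y hy hne h1))
  rw [← encard_lt_top_iff]
  refine lt_of_le_of_lt (b := (N : ℕ∞)) ?_ (ENat.natCast_lt_top N)
  by_contra hlt
  rw [not_le] at hlt
  obtain ⟨T, hT, hTc⟩ := exists_subset_encard_eq (Order.add_one_le_of_lt hlt)
  have hTf : T.Finite := finite_of_encard_eq_coe (k := N + 1) (by rw [hTc]; push_cast; rfl)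
  have : Finite T := hTf
  obtain ⟨ε, hε, hc⟩ := exists_common_pos (κ := T) (P := fun t ε => (t : R) ∈ M ε)
    (fun t => (hT t.2).1) (fun t ε ε' h1 h2 h3 => mono ε ε' h1 h2 h3)
  obtain ⟨ε', h1, h2⟩ := exists_between (lt_min hε hδ)
  have hsub : T ⊆ M ε' ∩ Ioo (a - δ) (a + δ) := fun y hy =>
    ⟨mono ε ε' h1 (h2.le.trans (min_le_left _ _)) (hc ⟨y, hy⟩), (hT hy).2⟩
  have := (encard_le_encard hsub).trans (H' ε' h1 (h2.trans_le (min_le_right _ _)))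
  rw [hTc] at this
  exact absurd this (by rw [not_le]; exact_mod_cast Nat.lt_succ_self N)

theorem NA.hasPred {S : Set R} (hS : D1 L S) (h : NA S) (u : R) (hne : (S ∩ Iio u).Nonempty) :
    ∃ z, IsGreatest (S ∩ Iio u) z := by
  obtain ⟨a, ha⟩ := exists_sup (L := L) (S := S ∩ Iio u) (by
    exact DP.and hS (DP.lt (DF.proj ()) (DF.const u))) hne ⟨u, fun y hy => le_of_lt hy.2⟩
  obtain ⟨δ, hδ, H⟩ := h a
  obtain ⟨y, hy, hay, hya⟩ := ha.exists_between (b := a - δ) (by grind)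
  have : y = a := H y hy.1 hay (by grind)
  subst this
  exact ⟨y, hy, ha.1⟩

theorem NA_of_closed {C : Set R} (hC : D1 L C) (hcl : IsClosed C)
    (hintr : ∀ u v, u < v → ¬ Icc u v ⊆ C) : NA C := by
  have key := NA_of_sep (L := L) (M := fun ε => {y | y ∈ C ∧ ∀ z, z ∈ C → y < z → y + ε ≤ z}) (by
      refine DP.and (hC.comp (fun _ => Sum.inr ())) (DP.all1 (DP.imp
        (hC.comp (fun _ => Sum.inr ())) (DP.imp (DP.lt (DF.proj _) (DF.proj _))
          (DP.le (DF.add (DF.proj _) (DF.proj _)) (DF.proj _))))))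
    (fun ε _ y hy y' hy' h => hy.2 y' hy'.1 h)
    (fun ε ε' _ h y hy => ⟨hy.1, fun z hz hyz => by have := hy.2 z hz hyz; grind⟩)
  intro a
  obtain ⟨δ, hδ, H⟩ := key a
  refine ⟨δ, hδ, fun y hy h1 h2 => ?_⟩
  by_contra hne
  obtain ⟨v, hyv, hv, hva⟩ : ∃ v, y < v ∧ v < a + δ ∧ (y < a → v < a) := by
    rcases lt_or_gt_of_ne hne with h | h
    · obtain ⟨v, hv, hv'⟩ := exists_between h
      exact ⟨v, hv, by grind, fun _ => hv'⟩
    · obtain ⟨v, hv, hv'⟩ := exists_between h2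
      exact ⟨v, hv, hv', fun h' => absurd h (not_lt.2 h'.le)⟩
  obtain ⟨z, hz, hzC⟩ := not_subset.1 (hintr y v hyv)
  obtain ⟨s, hs⟩ := exists_sup (L := L) (S := C ∩ Iic z)
    (DP.and hC (DP.le (DF.proj ()) (DF.const z))) ⟨y, hy, hz.1⟩ ⟨z, fun w hw => hw.2⟩
  have hsC : s ∈ C ∩ Iic z := hs.mem_of_isClosed ⟨y, hy, hz.1⟩ (hcl.inter isClosed_Iic)
  have hys : y ≤ s := hs.1 ⟨hy, hz.1⟩
  have hsz : s < z := lt_of_le_of_ne hsC.2 (fun h => hzC (h ▸ hsC.1))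
  have := H s ⟨z - s, sub_pos.2 hsz, hsC.1, fun w hw hsw => by
    rw [add_sub_cancel]
    by_contra hlt
    exact absurd (hs.1 ⟨hw, (not_le.1 hlt).le⟩) (not_le.2 hsw)⟩
    (by grind) (by have := hz.2; grind)
  subst this
  rcases lt_or_gt_of_ne hne with h | h
  · have := hva h
    have := hz.2
    grind
  · grind

theorem NA_chain {C : R → Set R}
    (hC : DP L (fun w : Unit ⊕ Unit → R => w (Sum.inr ()) ∈ C (w (Sum.inl ()))))
    (chain : ∀ t > 0, ∀ t' > 0, C t ⊆ C t' ∨ C t' ⊆ C t) (hNA : ∀ t > 0, NA (C t)) :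
    NA {y | ∃ t > 0, y ∈ C t} := by
  have hC1 : ∀ t, D1 L (C t) := fun t =>
    hC.subst (t := fun (w : Unit → R) => Sum.elim (fun _ => t) (fun _ => w ())) (by
        rintro (i | i)
        · exact DF.const _
        · exact DF.proj _)
  have hC' : ∀ {ι' : Type} (f g : (ι' → R) → R), DF L f → DF L g →
      DP L (fun v => g v ∈ C (f v)) := fun f g hf hg =>
    hC.subst (t := fun w => Sum.elim (fun _ => f w) (fun _ => g w)) (by
        rintro (i | i)
        · exact hf
        · exact hg)
  intro a
  have keyR := NA_of_sep (L := L) (M := fun ε => {y | a < y ∧ ∃ t, 0 < t ∧ y ∈ C t ∧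
      (∀ z, z ∈ C t → a < z → y ≤ z) ∧ ∀ z, z ∈ C t → y < z → y + ε ≤ z}) (by
    simp only [mem_ofPred_eq]
    repeat' first | exact DF.proj _ | exact DF.const _ | intro _ | apply DF.add | apply DP.and | apply DP.ex1 | apply DP.all1 | apply hC' | apply DP.imp | apply DP.lt | apply DP.le)
    (by
      rintro ε hε y ⟨h1, t, ht, h2, h3, h4⟩ y' ⟨h1', t', ht', h2', h3', h4'⟩ hlt
      rcases chain t ht t' ht' with h | h
      · exact absurd (h3' y (h h2) h1) (not_le.2 hlt)
      · exact h4 y' (h h2') hlt)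
    (by
      rintro ε ε' hε' hle y ⟨h1, t, ht, h2, h3, h4⟩
      exact ⟨h1, t, ht, h2, h3, fun z hz hyz => by have := h4 z hz hyz; grind⟩)
  have keyL := NA_of_sep (L := L) (M := fun ε => {y | y < a ∧ ∃ t, 0 < t ∧ y ∈ C t ∧
      (∀ z, z ∈ C t → z < a → z ≤ y) ∧ ∀ z, z ∈ C t → z < y → z + ε ≤ y}) (by
    simp only [mem_ofPred_eq]
    repeat' first | exact DF.proj _ | exact DF.const _ | intro _ | apply DF.add | apply DP.and | apply DP.ex1 | apply DP.all1 | apply hC' | apply DP.imp | apply DP.lt | apply DP.le)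
    (by
      rintro ε hε y ⟨h1, t, ht, h2, h3, h4⟩ y' ⟨h1', t', ht', h2', h3', h4'⟩ hlt
      rcases chain t ht t' ht' with h | h
      · exact h4' y (h h2) hlt
      · exact absurd (h3 y' (h h2') h1') (not_le.2 hlt))
    (by
      rintro ε ε' hε' hle y ⟨h1, t, ht, h2, h3, h4⟩
      exact ⟨h1, t, ht, h2, h3, fun z hz hyz => by have := h4 z hz hyz; grind⟩)
  obtain ⟨δ₁, hδ₁, H₁⟩ := keyR a
  obtain ⟨δ₂, hδ₂, H₂⟩ := keyL a
  refine ⟨min δ₁ δ₂, lt_min hδ₁ hδ₂, ?_⟩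
  rintro y ⟨t, ht, hy⟩ h1 h2
  have e1 := min_le_left δ₁ δ₂
  have e2 := min_le_right δ₁ δ₂
  by_contra hne
  rcases lt_or_gt_of_ne hne with h | h
  · obtain ⟨z, hz⟩ := (hNA t ht).hasPred (hC1 t) a ⟨y, hy, h⟩
    obtain ⟨δ', hδ', H'⟩ := hNA t ht z
    have hza : z < a := hz.1.2
    have hyz : y ≤ z := hz.2 ⟨hy, h⟩
    have := H₂ z ⟨δ', hδ', hza, t, ht, hz.1.1, fun w hw hwa => hz.2 ⟨hw, hwa⟩,
      fun w hw hwz => by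
        by_contra hlt
        have := H' w hw (by grind) (by grind)
        grind⟩ (by grind) (by grind)
    grind
  · obtain ⟨z, hz⟩ := (hNA t ht).hasSucc (hC1 t) a ⟨y, hy, h⟩
    obtain ⟨δ', hδ', H'⟩ := hNA t ht z
    have hza : a < z := hz.1.2
    have hyz : z ≤ y := hz.2 ⟨hy, h⟩
    have := H₁ z ⟨δ', hδ', hza, t, ht, hz.1.1, fun w hw hwa => hz.2 ⟨hw, hwa⟩,
      fun w hw hwz => by
        by_contra hlt
        have := H' w hw (by grind) (by grind)
        grind⟩ (by grind) (by grind)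
    grind

theorem NA_dsigma {F : R → R → Set R}
    (hF : DP L (fun w : (Unit ⊕ Unit) ⊕ Unit → R =>
      w (Sum.inr ()) ∈ F (w (Sum.inl (Sum.inl ()))) (w (Sum.inl (Sum.inr ())))))
    (hcl : ∀ r > 0, ∀ s > 0, IsClosed (F r s))
    (m1 : ∀ r > 0, ∀ r', ∀ s > 0, r ≤ r' → F r s ⊆ F r' s)
    (m2 : ∀ r > 0, ∀ s > 0, ∀ s', s ≤ s' → F r s' ⊆ F r s)
    (hintr : ∀ r > 0, ∀ s > 0, ∀ u v, u < v → ¬ Icc u v ⊆ F r s) :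
    NA {y | ∃ r > 0, ∃ s > 0, y ∈ F r s} := by
  have hF' : ∀ {ι' : Type} (f g h : (ι' → R) → R), DF L f → DF L g → DF L h →
      DP L (fun v => h v ∈ F (f v) (g v)) := fun f g h hf hg hh =>
    hF.subst (t := fun w => Sum.elim (Sum.elim (fun _ => f w) (fun _ => g w)) (fun _ => h w)) (by
        rintro ((i | i) | i)
        · exact hf
        · exact hg
        · exact hh)
  refine NA_chain (L := L) (C := fun r => {y | ∃ s > 0, y ∈ F r s}) ?_ ?_ ?_
  · exact DP.ex1 (DP.and (DP.lt (DF.const _) (DF.proj _))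
      (hF' _ _ _ (DF.proj _) (DF.proj _) (DF.proj _)))
  · intro r hr r' hr'
    rcases le_total r r' with h | h
    · left
      rintro y ⟨s, hs, hy⟩
      exact ⟨s, hs, m1 r hr r' s hs h hy⟩
    · right
      rintro y ⟨s, hs, hy⟩
      exact ⟨s, hs, m1 r' hr' r s hs h hy⟩
  · intro r hr
    refine NA_chain (L := L) (C := fun s => F r s) ?_ ?_ ?_
    · exact hF' _ _ _ (DF.const _) (DF.proj _) (DF.proj _)
    · intro s hs s' hs'
      rcases le_total s s' with h | h
      · exact Or.inr (m2 r hr s hs s' h)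
      · exact Or.inl (m2 r hr s' hs' s h)
    · intro s hs
      exact NA_of_closed (L := L) (hF' _ _ _ (DF.const _) (DF.const _) (DF.proj _))
        (hcl r hr s hs) (hintr r hr s hs)

end OneDim
end OC

set_option linter.unusedSectionVars false
namespace OC

section Clus
variable {L : FirstOrder.Language} {R : Type*} [L.Structure R] [LinearOrder R] [DenselyOrdered R]
  [AddCommGroup R] [IsOrderedAddMonoid R] [Nontrivial R] [TopologicalSpace R] [OrderTopology R]
  [Good L R]
variable {ι κ δ : Type}

theorem cluster1 {Q : R → R → Prop}
    (hQ : DP L (fun w : Bool → R => Q (w false) (w true)))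
    (mono : ∀ c d c' d', c' ≤ c → d ≤ d' → Q c d → Q c' d')
    (split : ∀ c d t, c ≤ t → t ≤ d → Q c d → Q c t ∨ Q t d)
    {c0 d0 : R} (h0 : c0 ≤ d0) (hQ0 : Q c0 d0) :
    ∃ a, c0 ≤ a ∧ a ≤ d0 ∧ ∀ c d, c < a → a < d → Q c d := by
  obtain ⟨a, ha⟩ := exists_inf (L := L) (S := {t | c0 ≤ t ∧ Q c0 t}) (by
    refine DP.and (DP.le (DF.const _) (DF.proj _)) ?_
    exact hQ.subst (t := fun (w : Unit → R) b => if b then w () else c0) (by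
      intro b; cases b
      · exact DF.const _
      · exact DF.proj _)) ⟨d0, h0, hQ0⟩ ⟨c0, fun t ht => ht.1⟩
  refine ⟨a, ha.2 (fun t ht => ht.1), ha.1 ⟨h0, hQ0⟩, fun c d hc hd => ?_⟩
  obtain ⟨t, ⟨ht0, ht⟩, hat, htd⟩ := ha.exists_between hd
  rcases le_or_gt c c0 with h | h
  · exact mono _ _ _ _ h htd.le ht
  · rcases split c0 t c h.le (hc.le.trans hat) ht with h' | h'
    · exact absurd (ha.1 ⟨h.le, h'⟩) (not_le.2 hc)
    · exact mono _ _ _ _ le_rfl htd.le h'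

theorem cluster [Fintype κ] [DecidableEq κ] {Q : (κ → R) → (κ → R) → Prop}
    (hQ : DP L (fun w : κ ⊕ κ → R => Q (w ∘ Sum.inl) (w ∘ Sum.inr)))
    (mono : ∀ c d c' d', c' ≤ c → d ≤ d' → Q c d → Q c' d')
    (split : ∀ c d j t, c j ≤ t → t ≤ d j → Q c d →
      Q c (Function.update d j t) ∨ Q (Function.update c j t) d)
    {c0 d0 : κ → R} (h0 : c0 ≤ d0) (hQ0 : Q c0 d0) :
    ∃ a, c0 ≤ a ∧ a ≤ d0 ∧ ∀ c d, (∀ i, c i < a i ∧ a i < d i) → Q c d := by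
  have hQ' : ∀ {ι' : Type} (f g : (ι' → R) → κ → R), (∀ k, DF L (fun v => f v k)) →
      (∀ k, DF L (fun v => g v k)) → DP L (fun v => Q (f v) (g v)) := fun f g hf hg =>
    hQ.subst (t := fun w => Sum.elim (f w) (g w)) (by
        rintro (i | i)
        · exact hf i
        · exact hg i)
  have key : ∀ S : Finset κ, ∃ a, c0 ≤ a ∧ a ≤ d0 ∧ ∀ c d, (∀ i ∈ S, c i < a i ∧ a i < d i) →
      (∀ i, i ∉ S → c i ≤ c0 i ∧ d0 i ≤ d i) → Q c d := by
    intro S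
    induction S using Finset.induction with
    | empty =>
      exact ⟨c0, le_rfl, h0, fun c d _ h =>
        mono _ _ _ _ (fun i => (h i (by simp)).1) (fun i => (h i (by simp)).2) hQ0⟩
    | insert j S hj ih =>
      obtain ⟨a, ha1, ha2, ha⟩ := ih
      obtain ⟨aj, h1, h2, h3⟩ := cluster1 (L := L) (Q := fun u v => ∀ c d : κ → R,
          (∀ i, i ∈ S → c i < a i ∧ a i < d i) →
          (∀ i, i ∉ S → i ≠ j → c i ≤ c0 i ∧ d0 i ≤ d i) → c j ≤ u → v ≤ d j → Q c d) (by
        repeat' first | exact DF.proj _ | exact DF.const _ | exact DP.const _ | intro _ | apply DP.and | apply DP.all | apply DP.allFin | apply hQ' | apply DP.imp | apply DP.lt | apply DP.le)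
        (fun u v u' v' hu hv H c d e1 e2 e3 e4 => H c d e1 e2 (e3.trans hu) (hv.trans e4))
        (by
          intro u v t hut htv H
          by_contra hcon
          push Not at hcon
          obtain ⟨⟨c, d, e1, e2, e3, e4, e5⟩, ⟨c', d', e1', e2', e3', e4', e5'⟩⟩ := hcon
          have := H (Function.update (c ⊔ c') j u) (Function.update (d ⊓ d') j v)
            (by
              intro i hi
              have : i ≠ j := fun h => hj (h ▸ hi)
              rw [Function.update_of_ne this, Function.update_of_ne this]
              exact ⟨max_lt (e1 i hi).1 (e1' i hi).1, lt_min (e1 i hi).2 (e1' i hi).2⟩)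
            (by
              intro i hi this
              rw [Function.update_of_ne this, Function.update_of_ne this]
              exact ⟨max_le (e2 i hi this).1 (e2' i hi this).1,
                le_min (e2 i hi this).2 (e2' i hi this).2⟩)
            (by simp) (by simp)
          rcases split _ _ j t (by simpa using hut) (by simpa using htv) this with h | h
          · refine e5 (mono _ _ _ _ ?_ ?_ h)
            · intro i
              by_cases hij : i = j
              · subst hij; simpa using e3
              · simp [Function.update_of_ne hij]
            · intro i
              by_cases hij : i = j
              · subst hij; simpa using e4
              · simp [Function.update_of_ne hij]
          · refine e5' (mono _ _ _ _ ?_ ?_ h)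
            · intro i
              by_cases hij : i = j
              · subst hij; simpa using e3'
              · simp [Function.update_of_ne hij]
            · intro i
              by_cases hij : i = j
              · subst hij; simpa using e4'
              · simp [Function.update_of_ne hij])
        (h0 j)
        (by
          intro c d e1 e2 e3 e4
          refine ha c d e1 (fun i hi => ?_)
          by_cases hij : i = j
          · subst hij; exact ⟨e3, e4⟩
          · exact e2 i hi hij)
      refine ⟨Function.update a j aj, ?_, ?_, fun c d e1 e2 => ?_⟩
      · intro i
        by_cases hij : i = j
        · subst hij; simpa using h1
        · simpa [Function.update_of_ne hij] using ha1 i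
      · intro i
        by_cases hij : i = j
        · subst hij; simpa using h2
        · simpa [Function.update_of_ne hij] using ha2 i
      · have hjj := e1 j (Finset.mem_insert_self j S)
        simp only [Function.update_self] at hjj
        refine h3 (c j) (d j) hjj.1 hjj.2 c d ?_ ?_ le_rfl le_rfl
        · intro i hi
          have := e1 i (Finset.mem_insert_of_mem hi)
          have hij : i ≠ j := fun h => hj (h ▸ hi)
          rwa [Function.update_of_ne hij] at this
        · intro i hi hij
          exact e2 i (by simp [hi, hij])
  obtain ⟨a, h1, h2, h3⟩ := key Finset.univ
  exact ⟨a, h1, h2, fun c d h => h3 c d (fun i _ => h i) (fun i hi => absurd (Finset.mem_univ i) hi)⟩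

theorem DP.mem_Bx [Finite κ] {x y : (ι → R) → κ → R} {e : (ι → R) → R}
    (hx : ∀ k, DF L (fun v => x v k)) (he : DF L e) (hy : ∀ k, DF L (fun v => y v k)) :
    DP L (fun v => y v ∈ Bx (x v) (e v)) :=
  DP.allFin fun k => DP.and (DP.lt ((hx k).sub he) (hy k)) (DP.lt (hy k) ((hx k).add he))

theorem DP.mem_CBx [Finite κ] {x y : (ι → R) → κ → R} {e : (ι → R) → R}
    (hx : ∀ k, DF L (fun v => x v k)) (he : DF L e) (hy : ∀ k, DF L (fun v => y v k)) :
    DP L (fun v => y v ∈ CBx (x v) (e v)) :=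
  DP.allFin fun k => DP.and (DP.le ((hx k).sub he) (hy k)) (DP.le (hy k) ((hx k).add he))

theorem DP.mem_Icc [Finite κ] {x y z : (ι → R) → κ → R}
    (hx : ∀ k, DF L (fun v => x v k)) (hz : ∀ k, DF L (fun v => z v k))
    (hy : ∀ k, DF L (fun v => y v k)) :
    DP L (fun v => y v ∈ Icc (x v) (z v)) :=
  DP.and (DP.allFin fun k => DP.le (hx k) (hy k)) (DP.allFin fun k => DP.le (hy k) (hz k))

theorem DP.closure [Finite κ] {X : Set (κ → R)} (hX : DP L (fun v => v ∈ X)) :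
    DP L (fun v => v ∈ closure X) := by
  refine DP.congr ?_ (fun v => mem_closure_iff_Bx)
  repeat' first | exact DF.proj _ | exact DF.const _ | intro _ | apply DP.and | apply DP.all1 | apply DP.ex | apply DP.mem_Bx | apply DP.subst hX | apply DP.imp | apply DP.lt

variable (L) in
/-- Closed, bounded, definable sets. -/
structure CBD (X : Set (ι → R)) : Prop where
  dp : DP L (fun v => v ∈ X)
  closed : IsClosed X
  bdd : ∃ c d, X ⊆ Icc c d

/-- Image of a set under a coordinate map. -/
def img (e : δ → ι) (X : Set (ι → R)) : Set (δ → R) := {x | ∃ v, v ∈ X ∧ v ∘ e = x}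

theorem img_mono (e : δ → ι) {X Y : Set (ι → R)} (h : X ⊆ Y) : img e X ⊆ img e Y :=
  fun _ ⟨v, hv, hx⟩ => ⟨v, h hv, hx⟩

theorem DP.comp_eq [Finite δ] {e : δ → κ} {x : (ι → R) → δ → R} {y : (ι → R) → κ → R}
    (hx : ∀ k, DF L (fun v => x v k)) (hy : ∀ k, DF L (fun v => y v k)) :
    DP L (fun v => y v ∘ e = x v) := by
  refine DP.congr (p := fun v => ∀ k, y v (e k) = x v k) ?_ (fun v => funext_iff)
  exact DP.allFin fun k => DP.eq (hy _) (hx k)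

theorem DP.img [Finite ι] [Finite δ] (e : δ → ι) {X : Set (ι → R)} (hX : DP L (fun v => v ∈ X)) :
    DP L (fun v => v ∈ img e X) := by
  refine DP.ex (DP.and (DP.subst hX ?_) (DP.comp_eq ?_ ?_)) <;> exact fun _ => DF.proj _

theorem CBD.img [Fintype ι] [Fintype δ] (e : δ → ι) {X : Set (ι → R)} (hX : CBD L X) :
    CBD L (img e X) := by
  classical
  refine ⟨DP.img e hX.dp, ?_, ?_⟩
  · refine isClosed_of_closure_subset fun x hx => ?_
    rw [mem_closure_iff_Bx] at hx
    obtain ⟨c0, d0, hb⟩ := hX.bdd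
    have hX' := hX.dp
    obtain ⟨a, -, -, ha⟩ := cluster (L := L)
      (Q := fun c d => ∀ ε, 0 < ε → ∃ v, v ∈ X ∧ v ∈ Icc c d ∧ v ∘ e ∈ Bx x ε)
      (c0 := c0) (d0 := d0) (by
        repeat' first | exact DF.proj _ | exact DF.const _ | intro _ | apply DP.mem_Bx | apply DP.mem_Icc | apply DP.and | apply DP.all1 | apply DP.ex | apply DP.subst hX' | apply DP.imp | apply DP.lt)
      (by
        intro c d c' d' h1 h2 H ε hε
        obtain ⟨v, hv, hv', h⟩ := H ε hε
        exact ⟨v, hv, ⟨h1.trans hv'.1, hv'.2.trans h2⟩, h⟩)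
      (by
        intro c d j t h1 h2 H
        by_contra hcon
        push Not at hcon
        obtain ⟨⟨ε, hε, H1⟩, ⟨ε', hε', H2⟩⟩ := hcon
        obtain ⟨v, hv, hv', h⟩ := H (min ε ε') (lt_min hε hε')
        rcases le_total (v j) t with hj | hj
        · refine H1 v hv ⟨hv'.1, ?_⟩ (Bx_mono _ (min_le_left _ _) h)
          intro i
          by_cases hij : i = j
          · subst hij; simpa using hj
          · simpa [Function.update_of_ne hij] using hv'.2 i
        · refine H2 v hv ⟨?_, hv'.2⟩ (Bx_mono _ (min_le_right _ _) h)
          intro i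
          by_cases hij : i = j
          · subst hij; simpa using hj
          · simpa [Function.update_of_ne hij] using hv'.1 i)
      (by
        obtain ⟨ε, hε⟩ := exists_pos_R (R := R)
        obtain ⟨_, ⟨v, hv, -⟩, -⟩ := hx ε hε
        exact (hb hv).1.trans (hb hv).2)
      (by
        intro ε hε
        obtain ⟨_, ⟨v, hv, rfl⟩, h⟩ := hx ε hε
        exact ⟨v, hv, hb hv, h⟩)
    have key : ∀ ε, 0 < ε → ∃ v ∈ X, v ∈ Bx a ε ∧ v ∘ e ∈ Bx x ε := by
      intro ε hε
      obtain ⟨η, h1, h2, -⟩ := exists_half hε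
      obtain ⟨v, hv, hv', h⟩ := ha (fun i => a i - η) (fun i => a i + η)
        (fun i => ⟨by grind, by grind⟩) ε hε
      exact ⟨v, hv, CBx_subset_Bx a h2 (by rw [CBx_eq]; exact hv'), h⟩
    refine ⟨a, ?_, ?_⟩
    · rw [← hX.closed.closure_eq, mem_closure_iff_Bx]
      intro ε hε
      obtain ⟨v, hv, hv', -⟩ := key ε hε
      exact ⟨v, hv, hv'⟩
    · funext i
      by_contra hne
      have : 0 < max (a (e i) - x i) (x i - a (e i)) := by
        rcases lt_or_gt_of_ne hne with h | h <;> simp only [Function.comp] at h <;> grind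
      obtain ⟨η, h1, h2, h3⟩ := exists_half this
      obtain ⟨v, hv, hv', h⟩ := key η h1
      have e1 := hv' (e i)
      have e2 := h i
      simp only [Function.comp] at e2
      grind
  · obtain ⟨c, d, h⟩ := hX.bdd
    refine ⟨c ∘ e, d ∘ e, ?_⟩
    rintro _ ⟨v, hv, rfl⟩
    exact ⟨fun i => (h hv).1 (e i), fun i => (h hv).2 (e i)⟩

theorem CBD.inter {X K : Set (ι → R)} (hX : CBD L X) (hK : DP L (fun v => v ∈ K))
    (hKc : IsClosed K) : CBD L (X ∩ K) :=
  ⟨hX.dp.and hK, hX.closed.inter hKc, by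
    obtain ⟨c, d, h⟩ := hX.bdd
    exact ⟨c, d, inter_subset_left.trans h⟩⟩

theorem DP_Icc [Finite ι] (c d : ι → R) : DP L (fun v => v ∈ Icc c d) :=
  DP.mem_Icc (fun _ => DF.const _) (fun _ => DF.const _) (fun _ => DF.proj _)

theorem DP_CBx [Finite ι] (c : ι → R) (ε : R) : DP L (fun v => v ∈ CBx c ε) :=
  DP.mem_CBx (fun _ => DF.const _) (DF.const _) (fun _ => DF.proj _)

theorem cluster_img [Fintype ι] [Fintype δ] (e : δ → ι) {C : Set (ι → R)} (hC : CBD L C)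
    (hintr : (interior (img e C)).Nonempty) :
    ∃ a ∈ C, ∀ η > 0, (interior (img e (C ∩ CBx a η))).Nonempty := by
  classical
  obtain ⟨c0, d0, hb⟩ := hC.bdd
  have hC' := hC.dp
  obtain ⟨a, -, -, ha⟩ := cluster (L := L)
    (Q := fun c d => (interior (OC.img e (C ∩ Icc c d))).Nonempty)
    (c0 := c0) (d0 := d0) (by
      refine DP.congr ?_ (fun v => interior_nonempty_iff)
      simp only [OC.img, mem_ofPred_eq, mem_inter_iff]
      repeat' first | exact DF.proj _ | exact DF.const _ | intro _ | apply DP.mem_Bx | apply DP.mem_Icc | apply DP.and | apply DP.all1 | apply DP.ex1 | apply DP.ex | apply DP.all | apply DP.comp_eq | apply DP.subst hC' | apply DP.imp | apply DP.lt)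
    (by
      intro c d c' d' h1 h2 H
      exact H.mono (interior_mono (img_mono e (inter_subset_inter_right _ (Icc_subset_Icc h1 h2)))))
    (by
      intro c d j t h1 h2 H
      by_contra hcon
      push Not at hcon
      have h3 : OC.img e (C ∩ Icc c d) ⊆ OC.img e (C ∩ Icc c (Function.update d j t)) ∪
          OC.img e (C ∩ Icc (Function.update c j t) d) := by
        rintro x ⟨v, ⟨hv, hv'⟩, rfl⟩
        rcases le_total (v j) t with hj | hj
        · left
          refine ⟨v, ⟨hv, hv'.1, ?_⟩, rfl⟩
          intro i
          by_cases hij : i = j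
          · subst hij; simpa using hj
          · simpa [Function.update_of_ne hij] using hv'.2 i
        · right
          refine ⟨v, ⟨hv, ?_, hv'.2⟩, rfl⟩
          intro i
          by_cases hij : i = j
          · subst hij; simpa using hj
          · simpa [Function.update_of_ne hij] using hv'.1 i
      have h4 := interior_union_isClosed_of_interior_empty
        (s := OC.img e (C ∩ Icc c (Function.update d j t)))
        ((hC.inter (DP_Icc _ _) isClosed_Icc).img e).closed hcon.2
      have := H.mono (interior_mono h3)
      rw [h4, hcon.1] at this
      exact Set.not_nonempty_empty this)
    (by
      obtain ⟨x, hx⟩ := hintr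
      obtain ⟨v, hv, -⟩ := interior_subset hx
      exact (hb hv).1.trans (hb hv).2)
    (by rwa [inter_eq_left.2 hb])
  have key : ∀ η > 0, (interior (OC.img e (C ∩ CBx a η))).Nonempty := by
    intro η hη
    rw [CBx_eq]
    exact ha _ _ (fun i => ⟨by grind, by grind⟩)
  refine ⟨a, ?_, key⟩
  rw [← hC.closed.closure_eq, mem_closure_iff_Bx]
  intro ε hε
  obtain ⟨η, h1, h2, -⟩ := exists_half hε
  obtain ⟨x, hx⟩ := key η h1
  obtain ⟨v, ⟨hv, hv'⟩, -⟩ := interior_subset hx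
  exact ⟨v, hv, CBx_subset_Bx a h2 hv'⟩

variable (L) in
/-- `D_Σ`-families. -/
structure DSF (F : R → R → Set (ι → R)) : Prop where
  dp : DP L (fun w : Bool ⊕ ι → R => w ∘ Sum.inr ∈ F (w (Sum.inl false)) (w (Sum.inl true)))
  closed : ∀ r s, 0 < r → 0 < s → IsClosed (F r s)
  bdd : ∀ r s, 0 < r → 0 < s → ∃ c d, F r s ⊆ Icc c d
  m1 : ∀ r r' s, 0 < r → 0 < s → r ≤ r' → F r s ⊆ F r' s
  m2 : ∀ r s s', 0 < r → 0 < s → s ≤ s' → F r s' ⊆ F r s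

/-- Union of a family. -/
def US (F : R → R → Set (ι → R)) : Set (ι → R) := {v | ∃ r, 0 < r ∧ ∃ s, 0 < s ∧ v ∈ F r s}

theorem DSF.mem [Finite ι] {F : R → R → Set (ι → R)} (hF : DSF L F) {f g : (κ → R) → R}
    {h : (κ → R) → ι → R} (hf : DF L f) (hg : DF L g) (hh : ∀ i, DF L (fun v => h v i)) :
    DP L (fun v => h v ∈ F (f v) (g v)) :=
  hF.dp.subst (t := fun w => Sum.elim (fun b => if b then g w else f w) (h w)) (by
    rintro (b | i)
    · cases b
      · exact hf
      · exact hg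
    · exact hh i)

theorem DSF.up {F : R → R → Set (ι → R)} (hF : DSF L F) {r r' s s' : R} (hr : 0 < r) (hs : 0 < s')
    (h1 : r ≤ r') (h2 : s' ≤ s) : F r s ⊆ F r' s' :=
  (hF.m2 r s' s hr hs h2).trans (hF.m1 r r' s' hr hs h1)

theorem DSF.dpU [Finite ι] {F : R → R → Set (ι → R)} (hF : DSF L F) :
    DP L (fun v => v ∈ US F) := by
  refine DP.ex1 (DP.and (DP.lt (DF.const _) (DF.proj _)) (DP.ex1
    (DP.and (DP.lt (DF.const _) (DF.proj _)) (hF.mem (DF.proj _) (DF.proj _)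
      (fun _ => DF.proj _)))))

theorem DSF.cbd [Finite ι] {F : R → R → Set (ι → R)} (hF : DSF L F) {r s : R} (hr : 0 < r)
    (hs : 0 < s) : CBD L (F r s) :=
  ⟨hF.mem (DF.const _) (DF.const _) (fun _ => DF.proj _), hF.closed r s hr hs, hF.bdd r s hr hs⟩

theorem DSF.interK {F : R → R → Set (ι → R)} (hF : DSF L F) {K : Set (ι → R)}
    (hK : DP L (fun v => v ∈ K)) (hKc : IsClosed K) : DSF L (fun r s => F r s ∩ K) where
  dp := hF.dp.and (hK.comp Sum.inr)
  closed := fun r s hr hs => (hF.closed r s hr hs).inter hKc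
  bdd := fun r s hr hs => by
    obtain ⟨c, d, h⟩ := hF.bdd r s hr hs
    exact ⟨c, d, inter_subset_left.trans h⟩
  m1 := fun r r' s hr hs h => inter_subset_inter_left _ (hF.m1 r r' s hr hs h)
  m2 := fun r r' s hr hs h => inter_subset_inter_left _ (hF.m2 r r' s hr hs h)

theorem US_interK (F : R → R → Set (ι → R)) (K : Set (ι → R)) :
    US (fun r s => F r s ∩ K) = US F ∩ K := by
  ext v
  constructor
  · rintro ⟨r, hr, s, hs, h1, h2⟩
    exact ⟨⟨r, hr, s, hs, h1⟩, h2⟩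
  · rintro ⟨⟨r, hr, s, hs, h1⟩, h2⟩
    exact ⟨r, hr, s, hs, h1, h2⟩

theorem DSF.img [Fintype ι] [Fintype δ] (e : δ → ι) {F : R → R → Set (ι → R)} (hF : DSF L F) :
    DSF L (fun r s => img e (F r s)) where
  dp := by
    refine DP.ex (DP.and (hF.mem ?_ ?_ ?_) (DP.comp_eq ?_ ?_)) <;> first | exact DF.proj _ | exact fun _ => DF.proj _
  closed := fun r s hr hs => ((hF.cbd hr hs).img e).closed
  bdd := fun r s hr hs => ((hF.cbd hr hs).img e).bdd
  m1 := fun r r' s hr hs h => img_mono e (hF.m1 r r' s hr hs h)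
  m2 := fun r r' s hr hs h => img_mono e (hF.m2 r r' s hr hs h)

theorem US_img (e : δ → ι) (F : R → R → Set (ι → R)) :
    US (fun r s => img e (F r s)) = img e (US F) := by
  ext v
  constructor
  · rintro ⟨r, hr, s, hs, v, h1, h2⟩
    exact ⟨v, ⟨r, hr, s, hs, h1⟩, h2⟩
  · rintro ⟨v, ⟨r, hr, s, hs, h1⟩, h2⟩
    exact ⟨r, hr, s, hs, v, h1, h2⟩

end Clus
end OC

set_option linter.unusedSectionVars false
namespace OC

section Baire
variable {L : FirstOrder.Language} {R : Type*} [L.Structure R] [LinearOrder R] [DenselyOrdered R]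
  [AddCommGroup R] [IsOrderedAddMonoid R] [Nontrivial R] [TopologicalSpace R] [OrderTopology R]
  [Good L R]
variable {ι κ δ : Type}

/-- The key Baire-type property in dimension `d`. -/
def Pd (L : FirstOrder.Language) (R : Type*) [L.Structure R] [LinearOrder R]
    [AddCommGroup R] [TopologicalSpace R] (d : ℕ) : Prop :=
  ∀ F : R → R → Set (Fin d → R), DSF L F → ∀ V : Set (Fin d → R), IsOpen V → V.Nonempty →
    ∃ V' ⊆ V, IsOpen V' ∧ V'.Nonempty ∧
      ((∀ x ∈ V', x ∉ US F) ∨ ∃ r s, 0 < r ∧ 0 < s ∧ V' ⊆ F r s)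

/-- Families of `N+1` separated points in one fiber. -/
def sepFam {d N : ℕ} (e : Fin d → ι) (F : R → R → Set (ι → R)) (r s : R) :
    Set (Fin (N + 1) × ι → R) :=
  {z | (∀ k, (fun i => z (k, i)) ∈ F r s) ∧
    (∀ k k', k ≠ k' → ∃ i, z (k, i) + s ≤ z (k', i) ∨ z (k', i) + s ≤ z (k, i)) ∧
    ∀ k j, z (k, e j) = z (0, e j)}

theorem sepFam_DSF [Fintype ι] {d N : ℕ} (e : Fin d → ι) {F : R → R → Set (ι → R)}
    (hF : DSF L F) : DSF L (sepFam (N := N) e F) where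
  dp := by
    refine DP.and ?_ (DP.and ?_ ?_)
    · exact DP.allFin fun k => hF.mem (DF.proj _) (DF.proj _) (fun _ => DF.proj _)
    · refine DP.allFin fun k => DP.allFin fun k' => DP.imp (DP.const _) (DP.exFin fun i => ?_)
      exact DP.or (DP.le (DF.add (DF.proj _) (DF.proj _)) (DF.proj _))
        (DP.le (DF.add (DF.proj _) (DF.proj _)) (DF.proj _))
    · exact DP.allFin fun k => DP.allFin fun j => DP.eq (DF.proj _) (DF.proj _)
  closed := by
    intro r s hr hs
    have h1 : IsClosed {z : Fin (N + 1) × ι → R | ∀ k, (fun i => z (k, i)) ∈ F r s} := by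
      simp only [ofPred_forall]
      exact isClosed_iInter fun k => (hF.closed r s hr hs).preimage
        (continuous_pi fun i => continuous_apply _)
    have h2 : IsClosed {z : Fin (N + 1) × ι → R | ∀ k k', k ≠ k' →
        ∃ i, z (k, i) + s ≤ z (k', i) ∨ z (k', i) + s ≤ z (k, i)} := by
      simp only [ofPred_forall, ofPred_exists]
      refine isClosed_iInter fun k => isClosed_iInter fun k' => isClosed_iInter fun _ =>
        isClosed_iUnion_of_finite fun i => ?_
      exact IsClosed.union (isClosed_le (by fun_prop) (by fun_prop))
        (isClosed_le (by fun_prop) (by fun_prop))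
    have h3 : IsClosed {z : Fin (N + 1) × ι → R | ∀ k j, z (k, e j) = z (0, e j)} := by
      simp only [ofPred_forall]
      exact isClosed_iInter fun k => isClosed_iInter fun j =>
        isClosed_eq (continuous_apply _) (continuous_apply _)
    exact h1.inter (h2.inter h3)
  bdd := by
    intro r s hr hs
    obtain ⟨c, d, h⟩ := hF.bdd r s hr hs
    exact ⟨fun q => c q.2, fun q => d q.2, fun z hz =>
      ⟨fun q => (h (hz.1 q.1)).1 q.2, fun q => (h (hz.1 q.1)).2 q.2⟩⟩
  m1 := fun r r' s hr hs h z hz => ⟨fun k => hF.m1 r r' s hr hs h (hz.1 k), hz.2⟩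
  m2 := fun r s s' hr hs h z hz => ⟨fun k => hF.m2 r s s' hr hs h (hz.1 k), fun k k' hk => by
    obtain ⟨i, hi⟩ := hz.2.1 k k' hk
    refine ⟨i, hi.imp ?_ ?_⟩ <;> intro hi <;> grind, hz.2.2⟩

theorem const_lemma [Fintype ι] {d : ℕ} (hP : Pd L R d) (e : Fin d → ι) {F : R → R → Set (ι → R)}
    (hF : DSF L F) (N : ℕ) : ∀ V : Set (Fin d → R), IsOpen V → V.Nonempty →
    (∀ x ∈ V, {v | v ∈ US F ∧ v ∘ e = x}.encard ≤ N) →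
    ∃ V' ⊆ V, IsOpen V' ∧ V'.Nonempty ∧ ∃ r s, 0 < r ∧ 0 < s ∧
      ∀ v ∈ US F, v ∘ e ∈ V' → v ∈ F r s := by
  induction N with
  | zero =>
    intro V hV hne hN
    obtain ⟨ε, hε⟩ := exists_pos_R (R := R)
    refine ⟨V, le_rfl, hV, hne, ε, ε, hε, hε, fun v hv hx => ?_⟩
    have := hN _ hx
    simp only [Nat.cast_zero, nonpos_iff_eq_zero, encard_eq_zero] at this
    exact absurd (show v ∈ {w | w ∈ US F ∧ w ∘ e = v ∘ e} from ⟨hv, rfl⟩) (by rw [this]; simp)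
  | succ N ih =>
    intro V hV hne hN
    obtain ⟨V1, hV1V, hV1o, hV1n, h⟩ := hP _ ((sepFam_DSF (N := N) e hF).img
      (fun j => ((0 : Fin (N + 1)), e j))) V hV hne
    rcases h with h | ⟨r, s, hr, hs, h⟩
    · obtain ⟨V2, hV2, h2⟩ := ih V1 hV1o hV1n (by
        intro x hx
        by_contra hcon
        rw [not_le] at hcon
        have hcon' : ((N + 1 : ℕ) : ℕ∞) ≤ {v | v ∈ US F ∧ v ∘ e = x}.encard := by
          push_cast
          exact Order.add_one_le_of_lt hcon
        obtain ⟨t, ht, htc⟩ := Set.exists_subset_encard_eq hcon'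
        have htf : t.Finite := Set.finite_of_encard_eq_coe htc
        have hcard : Nat.card t = N + 1 := by
          rw [Nat.card_coe_set_eq, Set.ncard, htc]; rfl
        have := htf.to_subtype
        let f : Fin (N + 1) ≃ t := (Finite.equivFinOfCardEq hcard).symm
        have hfA : ∀ k, (f k : ι → R) ∈ US F := fun k => (ht (f k).2).1
        have hfe : ∀ k, (f k : ι → R) ∘ e = x := fun k => (ht (f k).2).2
        choose r hr s hs hmem using hfA
        obtain ⟨r0, hr0⟩ := Finite.exists_le r
        obtain ⟨s1, hs1, hs1'⟩ := exists_common_pos (P := fun k σ => (f k : ι → R) ∈ F r0 σ)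
          (fun k => ⟨s k, hs k, hF.m1 _ _ _ (hr k) (hs k) (hr0 k) (hmem k)⟩)
          (fun k σ σ' h1 h2 h3 => hF.m2 _ _ _ ((hr k).trans_le (hr0 k)) h1 h2 h3)
        obtain ⟨s2, hs2, hs2'⟩ := exists_common_pos (κ := Fin (N + 1) × Fin (N + 1))
          (P := fun q σ => q.1 ≠ q.2 → ∃ i, (f q.1 : ι → R) i + σ ≤ (f q.2 : ι → R) i ∨
            (f q.2 : ι → R) i + σ ≤ (f q.1 : ι → R) i) (by
            rintro ⟨k, k'⟩
            by_cases hk : k = k'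
            · obtain ⟨ε, hε⟩ := exists_pos_R (R := R)
              exact ⟨ε, hε, fun h => absurd hk h⟩
            · have : (f k : ι → R) ≠ f k' := fun h => hk (f.injective (Subtype.ext h))
              obtain ⟨i, hi⟩ := Function.ne_iff.1 this
              rcases lt_or_gt_of_ne hi with hi | hi
              · exact ⟨_, sub_pos.2 hi, fun _ => ⟨i, Or.inl (by simp)⟩⟩
              · exact ⟨_, sub_pos.2 hi, fun _ => ⟨i, Or.inr (by simp)⟩⟩)
          (by
            rintro ⟨k, k'⟩ σ σ' _ hle H hk
            obtain ⟨i, hi⟩ := H hk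
            refine ⟨i, hi.imp ?_ ?_⟩ <;> intro hi <;> grind)
        have hr00 : 0 < r0 := (hr 0).trans_le (hr0 0)
        refine h x hx ⟨r0, hr00, min s1 s2, lt_min hs1 hs2, fun q => (f q.1 : ι → R) q.2,
          ⟨fun k => hF.m2 _ _ _ hr00 (lt_min hs1 hs2) (min_le_left _ _) (hs1' k), ?_, ?_⟩, ?_⟩
        · intro k k' hk
          obtain ⟨i, hi⟩ := hs2' (k, k') hk
          have := min_le_right s1 s2
          refine ⟨i, hi.imp ?_ ?_⟩ <;> intro hi <;> simp only at hi ⊢ <;> grind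
        · intro k j
          exact (congrFun (hfe k) j).trans (congrFun (hfe 0) j).symm
        · funext j
          exact congrFun (hfe 0) j)
      exact ⟨V2, hV2.trans hV1V, h2⟩
    · refine ⟨V1, hV1V, hV1o, hV1n, r, s, hr, hs, fun v hv hx => ?_⟩
      obtain ⟨z, ⟨hz1, hz2, hz3⟩, hze⟩ := h hx
      let g : Fin (N + 1) → ι → R := fun k i => z (k, i)
      have hg : Function.Injective g := by
        intro k k' hkk
        by_contra hne
        obtain ⟨i, hi⟩ := hz2 k k' hne
        have : z (k, i) = z (k', i) := congrFun hkk i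
        rcases hi with hi | hi <;> grind
      have hsub : range g ⊆ {w | w ∈ US F ∧ w ∘ e = v ∘ e} := by
        rintro _ ⟨k, rfl⟩
        refine ⟨⟨r, hr, s, hs, hz1 k⟩, ?_⟩
        rw [← hze]
        funext j
        exact hz3 k j
      have hc := hN _ (hV1V hx)
      have heq := (Set.finite_of_encard_le_coe hc).eq_of_subset_of_encard_le' hsub (by
        refine le_trans ?_ hg.encard_range
        simpa using hc)
      have hvm : v ∈ range g := by rw [heq]; exact ⟨hv, rfl⟩
      obtain ⟨k, rfl⟩ := hvm
      exact hz1 k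

theorem isOpen_cyl {d : ℕ} {V : Set (Fin d → R)} (hV : IsOpen V) (a b : R) :
    IsOpen {v : Fin (d + 1) → R | v ∘ Fin.castSucc ∈ V ∧ a < v (Fin.last d) ∧ v (Fin.last d) < b} :=
  (hV.preimage (continuous_pi fun i => continuous_apply _)).inter
    ((isOpen_lt continuous_const (continuous_apply _)).inter
      (isOpen_lt (continuous_apply _) continuous_const))

/-- `Fin.snoc` without dependent types. -/
def sn {d : ℕ} (x : Fin d → R) (t : R) : Fin (d + 1) → R := Fin.snoc (α := fun _ => R) x t

@[simp] theorem sn_last {d : ℕ} (x : Fin d → R) (t : R) : sn x t (Fin.last d) = t := by simp [sn]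
@[simp] theorem sn_castSucc {d : ℕ} (x : Fin d → R) (t : R) (i : Fin d) :
    sn x t i.castSucc = x i := by simp [sn]
@[simp] theorem sn_comp {d : ℕ} (x : Fin d → R) (t : R) : sn x t ∘ Fin.castSucc = x := by
  funext i; simp

theorem eq_sn {d : ℕ} (v : Fin (d + 1) → R) : v = sn (v ∘ Fin.castSucc) (v (Fin.last d)) := by
  funext i
  refine Fin.lastCases ?_ (fun i => ?_) i <;> simp

theorem eq_sn' {d : ℕ} {v : Fin (d + 1) → R} {x : Fin d → R} {t : R} (h : v ∘ Fin.castSucc = x)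
    (h' : v (Fin.last d) = t) : v = sn x t := by
  rw [← h, ← h']; exact eq_sn v

theorem continuous_sn {d : ℕ} {X : Type*} [TopologicalSpace X] {f : X → Fin d → R} {g : X → R}
    (hf : Continuous f) (hg : Continuous g) : Continuous (fun x => sn (f x) (g x)) := by
  refine continuous_pi fun i => ?_
  refine Fin.lastCases ?_ (fun i => ?_) i
  · simpa using hg
  · have h : Continuous fun x => f x i := (continuous_apply i).comp hf
    simpa using h

theorem DF.sn {d : ℕ} {f : (κ → R) → Fin d → R} {g : (κ → R) → R}
    (hf : ∀ i, DF L (fun v => f v i)) (hg : DF L g) (i : Fin (d + 1)) :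
    DF L (fun v => sn (f v) (g v) i) := by
  refine Fin.lastCases ?_ (fun i => ?_) i
  · simpa using hg
  · simpa using hf i

/-- Starting points of vertical intervals of length `s`. -/
def vert {d : ℕ} (F : R → R → Set (Fin (d + 1) → R)) (r s : R) : Set (Fin (d + 1) → R) :=
  {v | ∀ t, 0 ≤ t → t ≤ s → sn (v ∘ Fin.castSucc) (v (Fin.last d) + t) ∈ F r s}

theorem vert_DSF {d : ℕ} {F : R → R → Set (Fin (d + 1) → R)} (hF : DSF L F) : DSF L (vert F) where
  dp := by
    refine DP.all1 (DP.imp (DP.le (DF.const _) (DF.proj _)) (DP.imp (DP.le (DF.proj _)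
      (DF.proj _)) (hF.mem (DF.proj _) (DF.proj _) (DF.sn (fun _ => DF.proj _)
        (DF.add (DF.proj _) (DF.proj _))))))
  closed := by
    intro r s hr hs
    simp only [vert, ofPred_forall]
    refine isClosed_iInter fun t => isClosed_iInter fun _ => isClosed_iInter fun _ => ?_
    have h : Continuous fun v : Fin (d + 1) → R => sn (v ∘ Fin.castSucc) (v (Fin.last d) + t) :=
      continuous_sn (continuous_pi fun i => continuous_apply _) (by fun_prop)
    exact (hF.closed r s hr hs).preimage h
  bdd := by
    intro r s hr hs
    obtain ⟨c, d, h⟩ := hF.bdd r s hr hs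
    refine ⟨c, d, fun v hv => h ?_⟩
    have := hv 0 le_rfl hs.le
    rwa [add_zero, ← eq_sn] at this
  m1 := fun r r' s hr hs h v hv t h1 h2 => hF.m1 r r' s hr hs h (hv t h1 h2)
  m2 := fun r s s' hr hs h v hv t h1 h2 => hF.m2 r s s' hr hs h (hv t h1 (h2.trans h))

theorem fib_lemma {d : ℕ} (hP : Pd L R d) {F : R → R → Set (Fin (d + 1) → R)} (hF : DSF L F)
    {V : Set (Fin d → R)} (hV : IsOpen V) (hne : V.Nonempty) :
    ∃ V' ⊆ V, IsOpen V' ∧ V'.Nonempty ∧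
      ((∃ r s, 0 < r ∧ 0 < s ∧ (interior (F r s)).Nonempty) ∨
        ∀ x ∈ V', NA {t | sn x t ∈ US F}) := by
  obtain ⟨V', hV'V, hV'o, hV'n, h⟩ := hP _ ((vert_DSF hF).img Fin.castSucc) V hV hne
  refine ⟨V', hV'V, hV'o, hV'n, ?_⟩
  rcases h with h | ⟨r, s, hr, hs, h⟩
  · right
    intro x hx
    have hintr : ∀ r > 0, ∀ s > 0, ∀ u v, u < v → ¬ Icc u v ⊆ {t | sn x t ∈ F r s} := by
      intro r hr s hs u v huv hsub
      have hs' : 0 < min s (v - u) := lt_min hs (sub_pos.2 huv)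
      refine h x hx ⟨r, hr, min s (v - u), hs', sn x u, ?_, by simp⟩
      intro t ht0 ht
      simp only [sn_comp, sn_last]
      refine hF.m2 r _ s hr hs' (min_le_left _ _) (hsub ⟨?_, ?_⟩)
      · grind
      · have := ht.trans (min_le_right _ _); grind
    have key := NA_dsigma (L := L) (F := fun r s => {t | sn x t ∈ F r s})
      (hF.mem (DF.proj _) (DF.proj _) (DF.sn (fun _ => DF.const _) (DF.proj _)))
      (fun r hr s hs => (hF.closed r s hr hs).preimage (continuous_sn continuous_const continuous_id))
      (fun r hr r' s hs h t ht => hF.m1 r r' s hr hs h ht)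
      (fun r hr s hs s' h t ht => hF.m2 r s s' hr hs h ht) hintr
    exact key
  · left
    refine ⟨r, s, hr, hs, ?_⟩
    obtain ⟨a, ha, H⟩ := cluster_img Fin.castSucc ((vert_DSF hF).cbd hr hs)
      (hV'n.mono (interior_maximal h hV'o))
    obtain ⟨η, hη, hη1, hη2⟩ := exists_half hs
    obtain ⟨x, hx⟩ := H η hη
    have hsub : {v : Fin (d + 1) → R | v ∘ Fin.castSucc ∈ interior (img Fin.castSucc
        (vert F r s ∩ CBx a η)) ∧ a (Fin.last d) + η < v (Fin.last d) ∧
        v (Fin.last d) < a (Fin.last d) - η + s} ⊆ F r s := by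
      rintro v ⟨hv, hv1, hv2⟩
      obtain ⟨u, ⟨hu, hu'⟩, huv⟩ := interior_subset hv
      have h1 := hu' (Fin.last d)
      have := hu (v (Fin.last d) - u (Fin.last d)) (by grind) (by grind)
      rw [huv, add_sub_cancel, ← eq_sn] at this
      exact this
    obtain ⟨t, ht1, ht2⟩ := exists_between
      (show a (Fin.last d) + η < a (Fin.last d) - η + s by grind)
    refine Set.Nonempty.mono (interior_maximal hsub (isOpen_cyl isOpen_interior _ _)) ⟨sn x t, ?_⟩
    simp only [mem_ofPred_eq, sn_comp, sn_last]
    exact ⟨hx, ht1, ht2⟩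

theorem Pd_zero : Pd L R 0 := by
  intro F hF V hV hne
  refine ⟨V, le_rfl, hV, hne, ?_⟩
  by_cases h : ∃ x ∈ V, x ∈ US F
  · right
    obtain ⟨x, hx, r, hr, s, hs, h⟩ := h
    exact ⟨r, s, hr, hs, fun y _ => by rwa [Subsingleton.elim y x]⟩
  · left
    exact fun x hx hx' => h ⟨x, hx, hx'⟩

theorem Pd_succ {d : ℕ} (hP : Pd L R d) : Pd L R (d + 1) := by
  intro F hF V hV hne
  obtain ⟨x0, hx0⟩ := hne
  obtain ⟨ε, hε, hεV⟩ := exists_CBx_of_nhds (hV.mem_nhds hx0)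
  have hG := hF.interK (DP_CBx (L := L) x0 ε) (isClosed_CBx x0 ε)
  obtain ⟨V1, hV1, hV1o, hV1n, h⟩ := fib_lemma hP hG (isOpen_Bx (x0 ∘ Fin.castSucc) ε)
    ⟨_, mem_Bx_self _ hε⟩
  rcases h with ⟨r, s, hr, hs, hintr⟩ | hNA
  · exact ⟨_, (interior_subset.trans inter_subset_right).trans hεV, isOpen_interior, hintr,
      Or.inr ⟨r, s, hr, hs, interior_subset.trans inter_subset_left⟩⟩
  obtain ⟨b, hb⟩ := hV1n
  set a := x0 (Fin.last d) with ha
  obtain ⟨N, δ, hδ, hN⟩ := luf_fam (L := L)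
    (p := fun x t => sn x t ∈ US (fun r s => F r s ∩ CBx x0 ε))
    (hG.dpU.subst (DF.sn (fun _ => DF.proj _) (DF.proj _))) b a
  obtain ⟨δ', hδ', hδ'1, -⟩ := exists_half (lt_min hδ hε)
  have hδδ := hδ'1.trans_le (min_le_left _ _)
  have hδε := hδ'1.trans_le (min_le_right _ _)
  have hH := hG.interK (K := {v | a - δ' ≤ v (Fin.last d) ∧ v (Fin.last d) ≤ a + δ'})
    (DP.and (DP.le (DF.const _) (DF.proj _)) (DP.le (DF.proj _) (DF.const _)))
    ((isClosed_le continuous_const (continuous_apply _)).inter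
      (isClosed_le (continuous_apply _) continuous_const))
  obtain ⟨V2, hV2, hV2o, hV2n, r, s, hr, hs, hc⟩ := const_lemma hP Fin.castSucc hH N
    (Bx b δ ∩ V1) ((isOpen_Bx b δ).inter hV1o) ⟨b, mem_Bx_self b hδ, hb⟩ (by
      rintro x ⟨hx, hx1⟩
      have hs := hN x hx ((hNA x hx1).hasSucc (L := L)
        (hG.dpU.subst (DF.sn (fun _ => DF.const _) (DF.proj _))))
      refine le_trans (encard_le_encard_of_injOn (f := fun v => v (Fin.last d)) ?_ ?_) hs
      · rintro v ⟨hv, rfl⟩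
        rw [US_interK] at hv
        refine ⟨?_, ?_, ?_⟩
        · rw [mem_ofPred_eq, ← eq_sn]; exact hv.1
        · have := hv.2.1; grind
        · have := hv.2.2; grind
      · rintro v ⟨-, hv⟩ w ⟨-, hw⟩ hvw
        exact (eq_sn' hv hvw).trans (eq_sn' hw rfl).symm)
  set O := {v : Fin (d + 1) → R | v ∘ Fin.castSucc ∈ V2 ∧ a - δ' < v (Fin.last d) ∧
    v (Fin.last d) < a + δ'} with hO
  have hOo : IsOpen O := isOpen_cyl hV2o _ _
  have hOC : O ⊆ CBx x0 ε := by
    rintro v ⟨h1, h2, h3⟩ i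
    refine Fin.lastCases ?_ (fun i => ?_) i
    · rw [← ha]; constructor <;> grind
    · have := hV1 (hV2 h1).2 i
      exact ⟨this.1.le, this.2.le⟩
  have hOn : O.Nonempty := by
    obtain ⟨y, hy⟩ := hV2n
    refine ⟨sn y a, ?_⟩
    simp only [hO, mem_ofPred_eq, sn_comp, sn_last]
    exact ⟨hy, by grind, by grind⟩
  by_cases hsub : O ⊆ F r s
  · exact ⟨O, hOC.trans hεV, hOo, hOn, Or.inr ⟨r, s, hr, hs, hsub⟩⟩
  · refine ⟨O \ F r s, (sdiff_subset.trans hOC).trans hεV, hOo.sdiff (hF.closed r s hr hs),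
      nonempty_of_not_subset hsub, Or.inl ?_⟩
    rintro v ⟨hv, hvF⟩ hvU
    refine hvF (hc v ?_ hv.1).1.1
    rw [US_interK, US_interK]
    exact ⟨⟨hvU, hOC hv⟩, hv.2.1.le, hv.2.2.le⟩

theorem Pd_all (d : ℕ) : Pd L R d := by
  induction d with
  | zero => exact Pd_zero
  | succ d ih => exact Pd_succ ih

end Baire
end OC

set_option linter.unusedSectionVars false
namespace OC

section Main
variable {L : FirstOrder.Language} {R : Type*} [L.Structure R] [LinearOrder R] [DenselyOrdered R]
  [AddCommGroup R] [IsOrderedAddMonoid R] [Nontrivial R] [TopologicalSpace R] [OrderTopology R]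
  [Good L R]
variable {ι κ δ : Type}

theorem shrink [Fintype ι] {d : ℕ} {F : R → R → Set (ι → R)} (hF : DSF L F)
    (hd : ∀ e : Fin (d + 1) → ι, Function.Injective e → interior (img e (US F)) = ∅)
    (e : Fin d → ι) (he : Function.Injective e) {V : Set (Fin d → R)} (hV : IsOpen V)
    (hne : V.Nonempty) (S : Finset ι) :
    ∃ V' ⊆ V, IsOpen V' ∧ V'.Nonempty ∧
      ∀ j ∈ S, ∀ x ∈ V', NA {t | ∃ v, v ∈ US F ∧ v ∘ e = x ∧ v j = t} := by
  classical
  induction S using Finset.induction with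
  | empty => exact ⟨V, le_rfl, hV, hne, by simp⟩
  | insert j S hj ih =>
    obtain ⟨V1, h1, h1o, h1n, h1'⟩ := ih
    have key : ∃ V' ⊆ V1, IsOpen V' ∧ V'.Nonempty ∧
        ∀ x ∈ V', NA {t | ∃ v, v ∈ US F ∧ v ∘ e = x ∧ v j = t} := by
      by_cases hr : j ∈ range e
      · obtain ⟨k, rfl⟩ := hr
        refine ⟨V1, le_rfl, h1o, h1n, fun x _ => NA_of_locFinite fun a => ?_⟩
        obtain ⟨ε, hε⟩ := exists_pos_R (R := R)
        refine ⟨ε, hε, (finite_singleton (x k)).subset ?_⟩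
        rintro _ ⟨⟨v, -, rfl, rfl⟩, -⟩
        rfl
      · obtain ⟨V2, h2, h2o, h2n, h⟩ := fib_lemma (Pd_all d)
          (hF.img (Fin.snoc (α := fun _ => ι) e j)) h1o h1n
        refine ⟨V2, h2, h2o, h2n, ?_⟩
        rcases h with ⟨r, s, hr', hs, hintr⟩ | h
        · have h3 := hintr.mono (interior_mono (img_mono (Y := US F) (Fin.snoc (α := fun _ => ι) e j)
            (fun v hv => (⟨r, hr', s, hs, hv⟩ : v ∈ US F))))
          rw [hd _ (Fin.snoc_injective_iff.2 ⟨he, hr⟩)] at h3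
          exact absurd h3 Set.not_nonempty_empty
        · intro x hx
          refine (h x hx).subset ?_
          rintro t ⟨v, hv, hvx, hvt⟩
          rw [mem_ofPred_eq, US_img]
          refine ⟨v, hv, eq_sn' ?_ ?_⟩
          · rw [← hvx]; funext i; simp
          · simpa using hvt
    obtain ⟨V2, h2, h2o, h2n, h2'⟩ := key
    refine ⟨V2, h2.trans h1, h2o, h2n, fun i hi x hx => ?_⟩
    rcases Finset.mem_insert.1 hi with rfl | hi
    · exact h2' x hx
    · exact h1' i hi x (h2 hx)

theorem encard_pi_le [Fintype ι] (T : ι → Set R) (N : ι → ℕ) (h : ∀ i, (T i).encard ≤ N i) :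
    {v : ι → R | ∀ i, v i ∈ T i}.encard ≤ (∏ i, N i : ℕ) := by
  classical
  have hf : ∀ i, (T i).Finite := fun i => Set.finite_of_encard_le_coe (h i)
  have : {v : ι → R | ∀ i, v i ∈ T i} = ↑(Fintype.piFinset fun i => (hf i).toFinset) := by
    ext v; simp
  rw [this, Set.encard_coe_eq_coe_finsetCard, Fintype.card_piFinset]
  norm_cast
  refine Finset.prod_le_prod' fun i _ => ?_
  have h1 := h i
  rw [(hf i).encard_eq_coe_toFinset_card] at h1
  exact_mod_cast h1

theorem drop_lemma [Fintype ι] {d : ℕ} {F : R → R → Set (ι → R)} (hF : DSF L F)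
    (hd : ∀ e : Fin (d + 1) → ι, Function.Injective e → interior (img e (US F)) = ∅)
    (e : Fin d → ι) (he : Function.Injective e) :
    interior (img e (US F ∩ closure (closure (US F) \ US F))) = ∅ := by
  set A := US F with hA
  set K := closure (closure A \ A) with hK
  have hKd : DP L (fun v => v ∈ K) := DP.closure (DP.and (DP.closure hF.dpU) hF.dpU.not)
  have hF' := hF.interK hKd isClosed_closure
  by_contra hne
  rw [← Ne, ← Set.nonempty_iff_ne_empty] at hne
  obtain ⟨V1, hV1, hV1o, hV1n, h⟩ := Pd_all d _ (hF'.img e) _ isOpen_interior hne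
  rcases h with h | ⟨r, s, hr, hs, h⟩
  · obtain ⟨x, hx⟩ := hV1n
    refine h x hx ?_
    rw [US_img, US_interK]
    exact interior_subset (hV1 hx)
  obtain ⟨V2, hV2, hV2o, ⟨x1, hx1⟩, hNA⟩ := shrink hF hd e he hV1o hV1n Finset.univ
  obtain ⟨ε, hε, hεV⟩ := exists_CBx_of_nhds (hV2o.mem_nhds hx1)
  have hC := (hF'.cbd hr hs).inter (K := {v | v ∘ e ∈ CBx x1 ε})
    (DP.mem_CBx (fun _ => DF.const _) (DF.const _) (fun _ => DF.proj _))
    ((isClosed_CBx x1 ε).preimage (continuous_pi fun _ => continuous_apply _))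
  set C := F r s ∩ K ∩ {v | v ∘ e ∈ CBx x1 ε} with hCdef
  obtain ⟨a, haC, ha⟩ := cluster_img e hC (by
    refine ⟨x1, mem_interior_iff_mem_nhds.2 (Filter.mem_of_superset (Bx_mem_nhds x1 hε) ?_)⟩
    intro x hx
    obtain ⟨v, hv, rfl⟩ := h (hV2 (hεV (Bx_subset_CBx x1 ε hx)))
    exact ⟨v, ⟨hv, Bx_subset_CBx x1 ε hx⟩, rfl⟩)
  obtain ⟨δ, hδ, hN⟩ := exists_common_pos (κ := ι)
    (P := fun j δ => ∃ N : ℕ, ∀ x ∈ Bx (a ∘ e) δ,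
      HasSucc {t | ∃ v, v ∈ A ∧ v ∘ e = x ∧ v j = t} →
      ({t | ∃ v, v ∈ A ∧ v ∘ e = x ∧ v j = t} ∩ Ioo (a j - δ) (a j + δ)).encard ≤ N)
    (by
      intro j
      obtain ⟨N, δ, hδ, H⟩ := luf_fam (L := L)
        (p := fun (x : Fin d → R) t => ∃ v, v ∈ A ∧ v ∘ e = x ∧ v j = t)
        (DP.ex (DP.and (hF.dpU.subst fun _ => DF.proj _) (DP.and
          (DP.comp_eq (fun _ => DF.proj _) (fun _ => DF.proj _))
          (DP.eq (DF.proj _) (DF.proj _))))) (a ∘ e) (a j)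
      exact ⟨δ, hδ, N, H⟩)
    (by
      rintro j δ δ' hδ' hle ⟨N, H⟩
      refine ⟨N, fun x hx hs => le_trans (encard_le_encard ?_) (H x (Bx_mono _ hle hx) hs)⟩
      refine inter_subset_inter_right _ (Ioo_subset_Ioo ?_ ?_) <;> grind)
  choose N hN using hN
  obtain ⟨δ1, hδ1, hδ1', -⟩ := exists_half hδ
  obtain ⟨δ2, hδ2, hδ2', -⟩ := exists_half hδ1
  have hH := hF.interK (DP_CBx (L := L) a δ1) (isClosed_CBx a δ1)
  obtain ⟨V4, hV4, hV4o, ⟨x, hx⟩, r', s', hr', hs', hc⟩ := const_lemma (Pd_all d) e hH (∏ j, N j)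
    _ isOpen_interior (ha δ2 hδ2) (by
      intro x hx
      obtain ⟨u, ⟨huC, hua⟩, hux⟩ := interior_subset hx
      have hx2 : x ∈ V2 := hεV (hux ▸ huC.2)
      have hxB : x ∈ Bx (a ∘ e) δ := by
        rw [← hux]
        exact fun i => CBx_subset_Bx a (hδ2'.trans hδ1') hua (e i)
      refine le_trans (encard_le_encard ?_) (encard_pi_le
        (fun j => {t | ∃ v, v ∈ A ∧ v ∘ e = x ∧ v j = t} ∩ Ioo (a j - δ) (a j + δ)) N
        (fun j => hN j x hxB ((hNA j (Finset.mem_univ j) x hx2).hasSucc (L := L)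
          (DP.ex (DP.and (hF.dpU.subst fun _ => DF.proj _) (DP.and
          (DP.comp_eq (fun _ => DF.const _) (fun _ => DF.proj _))
          (DP.eq (DF.proj _) (DF.proj _))))))))
      rintro v ⟨hv, hvx⟩ j
      rw [US_interK] at hv
      exact ⟨⟨v, hv.1, hvx, rfl⟩, CBx_subset_Bx a hδ1' hv.2 j⟩)
  obtain ⟨v, ⟨hvC, hva⟩, hvx⟩ := interior_subset (hV4 hx)
  set O := {w : ι → R | w ∘ e ∈ V4} ∩ Bx a δ1 with hO
  have hOo : IsOpen O := (hV4o.preimage (continuous_pi fun _ => continuous_apply _)).inter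
    (isOpen_Bx a δ1)
  have hvO : v ∈ O := ⟨by rw [mem_ofPred_eq, hvx]; exact hx, CBx_subset_Bx a hδ2' hva⟩
  obtain ⟨w, hwO, hwA, hwA'⟩ := mem_closure_iff.1 (show v ∈ closure (closure A \ A) from hvC.1.2)
    O hOo hvO
  obtain ⟨u, ⟨huO, huF⟩, huA⟩ := mem_closure_iff.1 hwA (O \ F r' s')
    (hOo.sdiff (hF.closed r' s' hr' hs')) ⟨hwO, fun h => hwA' ⟨r', hr', s', hs', h⟩⟩
  refine huF (hc u ?_ huO.1).1
  rw [US_interK]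
  exact ⟨huA, Bx_subset_CBx _ _ huO.2⟩

/-- Finite boolean combinations of definable open sets. -/
inductive DefC (L : FirstOrder.Language) {R : Type*} [L.Structure R] [TopologicalSpace R]
    {ι : Type} : Set (ι → R) → Prop
  | op (s : Set (ι → R)) : DP L (fun v => v ∈ s) → IsOpen s → DefC L s
  | compl (s : Set (ι → R)) : DefC L s → DefC L sᶜ
  | union (s t : Set (ι → R)) : DefC L s → DefC L t → DefC L (s ∪ t)

theorem DefC.constr {X : Set (ι → R)} (h : DefC L X) : IsConstructibleSet X := by
  induction h with
  | op s _ h => exact .of_isOpen s h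
  | compl s _ ih => exact .compl s ih
  | union s t _ _ ih1 ih2 => exact .union s t ih1 ih2

theorem DefC.cl {X : Set (ι → R)} (h : DP L (fun v => v ∈ X)) (hc : IsClosed X) : DefC L X := by
  have := DefC.compl _ (DefC.op (L := L) Xᶜ h.not hc.isOpen_compl)
  rwa [compl_compl] at this

theorem DefC.sdiff {X Y : Set (ι → R)} (hX : DefC L X) (hY : DefC L Y) : DefC L (X \ Y) := by
  have := ((hX.compl).union _ _ hY).compl
  rwa [compl_union, compl_compl, ← sdiff_eq] at this

theorem DSF.defC [Fintype ι] (d : ℕ) : ∀ {F : R → R → Set (ι → R)}, DSF L F →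
    (∀ e : Fin d → ι, Function.Injective e → interior (OC.img e (US F)) = ∅) → DefC L (US F) := by
  induction d with
  | zero =>
    intro F hF h
    have : US F = ∅ := by
      rw [Set.eq_empty_iff_forall_notMem]
      intro v hv
      have h1 := h Fin.elim0 (fun i => i.elim0)
      have h2 : OC.img Fin.elim0 (US F) = univ :=
        Set.eq_univ_of_forall fun x => ⟨v, hv, Subsingleton.elim _ _⟩
      rw [h2, interior_univ] at h1
      exact Set.empty_ne_univ h1.symm
    exact DefC.op _ hF.dpU (by rw [this]; exact isOpen_empty)
  | succ d ih =>
    intro F hF h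
    have hKd : DP L (fun v => v ∈ closure (closure (US F) \ US F)) :=
      DP.closure (DP.and (DP.closure hF.dpU) hF.dpU.not)
    have h1 := ih (hF.interK hKd isClosed_closure) (by
      intro e he
      rw [US_interK]
      exact drop_lemma hF h e he)
    rw [US_interK] at h1
    have h2 := ((DefC.cl (DP.closure hF.dpU) isClosed_closure).sdiff
      (DefC.cl hKd isClosed_closure)).union _ _ h1
    convert h2 using 1
    ext v
    constructor
    · intro hv
      by_cases hk : v ∈ closure (closure (US F) \ US F)
      · exact Or.inr ⟨hv, hk⟩
      · exact Or.inl ⟨subset_closure hv, hk⟩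
    · rintro (⟨h3, h4⟩ | h3)
      · by_contra hv
        exact h4 (subset_closure ⟨h3, hv⟩)
      · exact h3.1

/-- `D_Σ`-sets. -/
def DS (L : FirstOrder.Language) {R : Type*} [L.Structure R] [LinearOrder R]
    [AddCommGroup R] [TopologicalSpace R] {ι : Type} (X : Set (ι → R)) : Prop :=
  ∃ F : R → R → Set (ι → R), DSF L F ∧ US F = X

theorem DS.defC [Fintype ι] {X : Set (ι → R)} (h : DS L X) : DefC L X := by
  obtain ⟨F, hF, rfl⟩ := h
  refine hF.defC (Fintype.card ι + 1) fun e he => ?_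
  have := Fintype.card_le_of_injective e he
  simp at this

theorem DS.img [Fintype ι] [Fintype δ] (e : δ → ι) {X : Set (ι → R)} (h : DS L X) :
    DS L (OC.img e X) := by
  obtain ⟨F, hF, rfl⟩ := h
  exact ⟨_, hF.img e, US_img e F⟩

theorem DS.union [Finite ι] {X Y : Set (ι → R)} (h : DS L X) (h' : DS L Y) : DS L (X ∪ Y) := by
  obtain ⟨F, hF, rfl⟩ := h
  obtain ⟨G, hG, rfl⟩ := h'
  refine ⟨fun r s => F r s ∪ G r s, ⟨hF.dp.or hG.dp,
    fun r s hr hs => (hF.closed r s hr hs).union (hG.closed r s hr hs), ?_,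
    fun r r' s hr hs h => union_subset_union (hF.m1 r r' s hr hs h) (hG.m1 r r' s hr hs h),
    fun r r' s hr hs h => union_subset_union (hF.m2 r r' s hr hs h) (hG.m2 r r' s hr hs h)⟩, ?_⟩
  · intro r s hr hs
    obtain ⟨c, d, h⟩ := hF.bdd r s hr hs
    obtain ⟨c', d', h'⟩ := hG.bdd r s hr hs
    exact ⟨c ⊓ c', d ⊔ d', union_subset (h.trans (Icc_subset_Icc inf_le_left le_sup_left))
      (h'.trans (Icc_subset_Icc inf_le_right le_sup_right))⟩
  · ext v
    constructor
    · rintro ⟨r, hr, s, hs, h | h⟩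
      · exact Or.inl ⟨r, hr, s, hs, h⟩
      · exact Or.inr ⟨r, hr, s, hs, h⟩
    · rintro (⟨r, hr, s, hs, h⟩ | ⟨r, hr, s, hs, h⟩)
      · exact ⟨r, hr, s, hs, Or.inl h⟩
      · exact ⟨r, hr, s, hs, Or.inr h⟩

theorem DS.inter [Finite ι] {X Y : Set (ι → R)} (h : DS L X) (h' : DS L Y) : DS L (X ∩ Y) := by
  obtain ⟨F, hF, rfl⟩ := h
  obtain ⟨G, hG, rfl⟩ := h'
  refine ⟨fun r s => F r s ∩ G r s, ⟨hF.dp.and hG.dp,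
    fun r s hr hs => (hF.closed r s hr hs).inter (hG.closed r s hr hs), ?_,
    fun r r' s hr hs h => inter_subset_inter (hF.m1 r r' s hr hs h) (hG.m1 r r' s hr hs h),
    fun r r' s hr hs h => inter_subset_inter (hF.m2 r r' s hr hs h) (hG.m2 r r' s hr hs h)⟩, ?_⟩
  · intro r s hr hs
    obtain ⟨c, d, h⟩ := hF.bdd r s hr hs
    exact ⟨c, d, inter_subset_left.trans h⟩
  · ext v
    constructor
    · rintro ⟨r, hr, s, hs, h, h'⟩
      exact ⟨⟨r, hr, s, hs, h⟩, ⟨r, hr, s, hs, h'⟩⟩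
    · rintro ⟨⟨r, hr, s, hs, h⟩, ⟨r', hr', s', hs', h'⟩⟩
      exact ⟨max r r', lt_max_of_lt_left hr, min s s', lt_min hs hs',
        hF.up hr (lt_min hs hs') (le_max_left _ _) (min_le_left _ _) h,
        hG.up hr' (lt_min hs hs') (le_max_right _ _) (min_le_right _ _) h'⟩

theorem exists_cube [Finite ι] (x : ι → R) : ∃ r > 0, x ∈ CBx 0 r := by
  obtain ⟨M, hM⟩ := Finite.exists_le (fun i => |x i|)
  obtain ⟨ε, hε⟩ := exists_pos_R (R := R)
  refine ⟨max M ε, lt_max_of_lt_right hε, fun i => ?_⟩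
  have := abs_le.1 ((hM i).trans (le_max_left M ε))
  simpa using this

theorem CBx_mono (x : ι → R) {r r' : R} (h : r ≤ r') : CBx x r ⊆ CBx x r' := fun y hy i => by
  have := hy i
  constructor <;> grind

theorem DS.cl [Finite ι] {X : Set (ι → R)} (h : DP L (fun v => v ∈ X)) (hc : IsClosed X) :
    DS L X := by
  refine ⟨fun r _ => X ∩ CBx 0 r, ⟨?_, fun r s _ _ => hc.inter (isClosed_CBx _ _), ?_, ?_, ?_⟩, ?_⟩
  · exact DP.and (h.subst fun _ => DF.proj _)
      (DP.mem_CBx (fun _ => DF.const _) (DF.proj _) (fun _ => DF.proj _))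
  · intro r s _ _
    rw [CBx_eq]
    exact ⟨_, _, inter_subset_right⟩
  · exact fun r r' s _ _ h => inter_subset_inter_right _ (CBx_mono _ h)
  · exact fun r s s' _ _ h => le_rfl
  · ext v
    constructor
    · rintro ⟨r, hr, s, hs, h1, h2⟩
      exact h1
    · intro hv
      obtain ⟨r, hr, h⟩ := exists_cube v
      exact ⟨r, hr, r, hr, hv, h⟩

theorem DS.op [Finite ι] {X : Set (ι → R)} (h : DP L (fun v => v ∈ X)) (hc : IsOpen X) :
    DS L X := by
  refine ⟨fun r s => CBx 0 r ∩ {x | ∀ y, y ∈ Bx x s → y ∈ X}, ⟨?_, ?_, ?_, ?_, ?_⟩, ?_⟩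
  · exact DP.and (DP.mem_CBx (fun _ => DF.const _) (DF.proj _) (fun _ => DF.proj _))
      (DP.all (DP.imp (DP.mem_Bx (fun _ => DF.proj _) (DF.proj _) (fun _ => DF.proj _))
        (h.subst fun _ => DF.proj _)))
  · intro r s _ _
    refine (isClosed_CBx _ _).inter ?_
    have : {x | ∀ y, y ∈ Bx x s → y ∈ X} = (⋃ y ∈ Xᶜ, Bx y s)ᶜ := by
      ext x
      simp only [mem_ofPred_eq, mem_compl_iff, mem_iUnion, not_exists]
      refine forall_congr' fun y => ?_
      have h1 : y ∈ Bx x s ↔ x ∈ Bx y s := by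
        constructor <;> intro h i <;> have := h i <;> constructor <;> grind
      rw [h1]; tauto
    rw [this]
    exact (isOpen_biUnion fun y _ => isOpen_Bx y s).isClosed_compl
  · intro r s _ _
    rw [CBx_eq]
    exact ⟨_, _, inter_subset_left⟩
  · exact fun r r' s _ _ h => inter_subset_inter_left _ (CBx_mono _ h)
  · exact fun r s s' _ _ h => inter_subset_inter_right _ fun x hx y hy => hx y (Bx_mono _ h hy)
  · ext v
    constructor
    · rintro ⟨r, hr, s, hs, h1, h2⟩
      exact h2 v (mem_Bx_self v hs)
    · intro hv
      obtain ⟨r, hr, h⟩ := exists_cube v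
      obtain ⟨s, hs, h'⟩ := exists_Bx_of_nhds (hc.mem_nhds hv)
      exact ⟨r, hr, s, hs, h, h'⟩

theorem DefC.ds [Finite ι] {X : Set (ι → R)} (h : DefC L X) : DS L X ∧ DS L Xᶜ := by
  induction h with
  | op s h1 h2 => exact ⟨DS.op h1 h2, DS.cl h1.not h2.isClosed_compl⟩
  | compl s _ ih => rw [compl_compl]; exact ih.symm
  | union s t _ _ ih1 ih2 => rw [compl_union]; exact ⟨ih1.1.union ih2.1, ih1.2.inter ih2.2⟩

theorem DS.compl [Fintype ι] {X : Set (ι → R)} (h : DS L X) : DS L Xᶜ := h.defC.ds.2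

end Main
end OC

set_option linter.unusedSectionVars false
namespace OC

section Fin
variable {L : FirstOrder.Language} {R : Type*} [L.Structure R] [LinearOrder R] [DenselyOrdered R]
  [AddCommGroup R] [IsOrderedAddMonoid R] [Nontrivial R] [TopologicalSpace R] [OrderTopology R]
  [Good L R]
variable {ι κ δ : Type}

theorem DS.of_isDSigma {n : ℕ} {X : Set (Fin n → R)} (h : IsDSigma L X) : DS L X := by
  obtain ⟨F, ⟨hd, h1, h2, h3⟩, rfl⟩ := h
  refine ⟨fun r s => famFiber F r s, ⟨?_, fun r s hr hs => (h1 r s hr hs).2.1, ?_, h2, h3⟩, ?_⟩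
  · have hF : DP L (fun v => v ∈ F) := ⟨hd⟩
    refine hF.subst (t := fun w : Bool ⊕ Fin n → R =>
      Fin.append ![w (Sum.inl false), w (Sum.inl true)] (w ∘ Sum.inr)) ?_
    intro k
    refine Fin.addCases (fun i => ?_) (fun i => ?_) k
    · simp only [Fin.append_left]
      fin_cases i
      · exact DF.proj _
      · exact DF.proj _
    · simp only [Fin.append_right]
      exact DF.proj _
  · intro r s hr hs
    obtain ⟨c, d, h⟩ := (h1 r s hr hs).2.2
    exact ⟨fun _ => c, fun _ => d, fun v hv => ⟨fun i => (h v hv i).1, fun i => (h v hv i).2⟩⟩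
  · ext v
    simp [US]

theorem term_ok (S : (openCoreLang L R).Structure R)
    (t : ((openCoreLang L R)[[(Set.univ : Set R)]]).Term ι) :
    Continuous (fun v : ι → R => t.realize v) ∧ DF L (fun v : ι → R => t.realize v) := by
  cases t with
  | var i => exact ⟨continuous_apply i, DF.proj i⟩
  | @func l f ts =>
    cases l with
    | zero =>
      have h0 : ∀ v : ι → R, (FirstOrder.Language.Term.func f ts).realize v =
          FirstOrder.Language.Structure.funMap f (Fin.elim0 : Fin 0 → R) := by
        intro v
        rw [FirstOrder.Language.Term.realize_func]
        congr 1
        exact Subsingleton.elim _ _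
      simp only [h0]
      exact ⟨continuous_const, DF.const _⟩
    | succ l =>
      rcases f with f | f
      · exact f.elim
      · exact PEmpty.elim f

theorem bf_ok [Fintype ι] {n : ℕ}
    (φ : letI := openCoreStructure L R;
      ((openCoreLang L R)[[(Set.univ : Set R)]]).BoundedFormula ι n) :
    letI := openCoreStructure L R
    DS L {w : ι ⊕ Fin n → R | φ.Realize (w ∘ Sum.inl) (w ∘ Sum.inr)} := by
  let _ := openCoreStructure L R
  induction φ with
  | falsum => exact DS.op (DP.const False) (by
      simp only [FirstOrder.Language.BoundedFormula.Realize]; exact isOpen_const)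
  | equal t1 t2 =>
    simp only [FirstOrder.Language.BoundedFormula.Realize, Sum.elim_comp_inl_inr]
    exact DS.cl (DP.eq (term_ok _ t1).2 (term_ok _ t2).2)
      (isClosed_eq (term_ok _ t1).1 (term_ok _ t2).1)
  | rel r ts =>
    simp only [FirstOrder.Language.BoundedFormula.Realize, Sum.elim_comp_inl_inr]
    rcases r with s | s
    · have h1 : DP L (fun v => v ∈ s.1) := ⟨s.2.1⟩
      exact DS.op (X := {w | (fun i => (ts i).realize w) ∈ s.1})
        (h1.subst fun i => (term_ok _ (ts i)).2)
        (s.2.2.preimage (continuous_pi fun i => (term_ok _ (ts i)).1))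
    · exact isEmptyElim s
  | imp f g ihf ihg =>
    have h := (ihf.compl).union ihg
    convert h using 1
    ext w
    simp only [FirstOrder.Language.BoundedFormula.Realize, mem_ofPred_eq, mem_union, mem_compl_iff]
    tauto
  | @all n f ih =>
    have h := (ih.compl.img (Sum.map (id : ι → ι) (Fin.castSucc (n := n)))).compl
    convert h using 1
    ext w
    simp only [FirstOrder.Language.BoundedFormula.Realize, mem_ofPred_eq, mem_compl_iff, OC.img,
      not_exists, not_and]
    constructor
    · rintro H v hv rfl
      apply hv
      have h1 := H (v (Sum.inr (Fin.last n)))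
      have e2 : (Fin.snoc (α := fun _ => R) ((v ∘ Sum.map (id : ι → ι) (Fin.castSucc (n := n))) ∘
          Sum.inr) (v (Sum.inr (Fin.last n))) : Fin (n + 1) → R) = v ∘ Sum.inr := by
        funext i
        refine Fin.lastCases ?_ (fun i => ?_) i <;> simp
      rw [e2] at h1
      exact h1
    · intro H x
      by_contra hx
      refine H (Sum.elim (w ∘ Sum.inl) (Fin.snoc (α := fun _ => R) (w ∘ Sum.inr) x)) hx ?_
      funext i
      rcases i with i | i <;> simp

theorem oc_ok {n : ℕ} {X : Set (Fin n → R)} (h : DefinableInOpenCore L R X) : DS L X := by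
  let _ := openCoreStructure L R
  obtain ⟨φ, rfl⟩ := h
  have h := (bf_ok (L := L) (R := R) φ).img (Sum.inl : Fin n → Fin n ⊕ Fin 0)
  convert h using 1
  ext v
  constructor
  · intro hv
    refine ⟨Sum.elim v default, ?_, rfl⟩
    exact hv
  · rintro ⟨w, hw, rfl⟩
    have e : (w ∘ Sum.inr) = (default : Fin 0 → R) := Subsingleton.elim _ _
    rw [mem_ofPred_eq, e] at hw
    exact hw

end Fin
end OC

/-- If `𝓡` is a definably complete expansion of a densely linearly
ordered abelian group satisfying `LUF₂`, then every `D_Σ`-subset of `R^n` is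
constructible; in particular, every set definable in the open core of `𝓡` is
constructible. -/
theorem dSigma_constructible_and_openCore_constructible
    {R : Type*} (L : FirstOrder.Language) [L.Structure R]
    [LinearOrder R] [DenselyOrdered R] [AddCommGroup R]
    [CovariantClass R R (· + ·) (· < ·)] [TopologicalSpace R] [OrderTopology R]
    (hlt : IsDefinable L {v : Fin 2 → R | v 0 < v 1})
    (hadd : IsDefinable L {v : Fin 3 → R | v 0 + v 1 = v 2})
    (hDC : DCProp L R) (hLUF2 : LUF2 L R) :
    (∀ (n : ℕ) (X : Set (Fin n → R)), IsDSigma L X → IsConstructibleSet X) ∧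
    (∀ (n : ℕ) (X : Set (Fin n → R)), DefinableInOpenCore L R X → IsConstructibleSet X) := by
  rcases subsingleton_or_nontrivial R with hR | hR
  · exact ⟨fun n X _ => .of_isOpen X (isOpen_discrete X),
      fun n X _ => .of_isOpen X (isOpen_discrete X)⟩
  have hle : ∀ a b : R, a ≤ b → ∀ c, c + a ≤ c + b := by
    intro a b hab c
    rcases hab.eq_or_lt with rfl | h
    · exact le_rfl
    · exact (CovariantClass.elim c h : c + a < c + b).le
  have : IsOrderedAddMonoid R :=
    { add_le_add_left := fun a b hab c => by rw [add_comm a c, add_comm b c]; exact hle a b hab c }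
  have : OC.Good L R := ⟨⟨hlt⟩, ⟨hadd⟩, hDC, hLUF2⟩
  exact ⟨fun n X hX => (OC.DS.of_isDSigma hX).defC.constr, fun n X hX => (OC.oc_ok hX).defC.constr⟩
end

section
/- Let 𝓡 = (R, <, +, 0, …) be an expansion of a densely linearly ordered abelian group with 𝓡 ⊨ DC and 𝓡 ⊨ LUF₂. For any definable set X ⊆ R^{m+n} and any point (b,a) ∈ R^m × R^n, there exist a positive integer N, a closed box B ⊆ R^n with a ∈ int(B), and an open box U ⊆ R^m containing b, such that for every x ∈ U, if X_x ∩ B is discrete then |X_x ∩ B| ≤ N. In addition, U can be taken to be R^m if 𝓡 ⊨ LUF₁, and B can be taken independently of X if 𝓡 ⊨ SLUF. -/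
open FirstOrder Set Topology

section DefCalc

open FirstOrder Set Filter

universe u

/-- `P` is a definable predicate of tuples indexed by `α`. -/
def DefP (L : FirstOrder.Language) {R : Type*} [L.Structure R] {α : Type}
    (P : (α → R) → Prop) : Prop :=
  Set.Definable (Set.univ : Set R) L {v | P v}

/-- `f` is a definable function of tuples indexed by `α`. -/
def DefF (L : FirstOrder.Language) {R : Type*} [L.Structure R] {α : Type}
    (f : (α → R) → R) : Prop :=
  (Set.univ : Set R).DefinableFun L f

/-- Adding one coordinate. -/
def optCons {R : Type*} {α : Type} (t : R) (z : α → R) : Option α → R := fun o => o.elim t z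

theorem optCons_none {R : Type*} {α : Type} (t : R) (z : α → R) : optCons t z none = t := rfl
theorem optCons_some {R : Type*} {α : Type} (t : R) (z : α → R) (i : α) :
    optCons t z (some i) = z i := rfl
theorem optCons_comp {R : Type*} {α : Type} (t : R) (z : α → R) :
    optCons t z ∘ some = z := rfl
theorem optCons_eta {R : Type*} {α : Type} (y : Option α → R) :
    optCons (y none) (y ∘ some) = y := by
  funext o; cases o <;> rfl

variable {L : FirstOrder.Language} {R : Type*} [L.Structure R] {α β γ : Type}

theorem DefP.congr {P Q : (α → R) → Prop} (h : DefP L P) (e : ∀ v, P v ↔ Q v) : DefP L Q := by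
  have : P = Q := funext fun v => propext (e v)
  rwa [← this]

theorem DefP.and {P Q : (α → R) → Prop} (h : DefP L P) (h' : DefP L Q) :
    DefP L (fun v => P v ∧ Q v) := Set.Definable.inter h h'

theorem DefP.or {P Q : (α → R) → Prop} (h : DefP L P) (h' : DefP L Q) :
    DefP L (fun v => P v ∨ Q v) := Set.Definable.union h h'

theorem DefP.not {P : (α → R) → Prop} (h : DefP L P) :
    DefP L (fun v => ¬ P v) := Set.Definable.compl h

theorem DefP.imp {P Q : (α → R) → Prop} (h : DefP L P) (h' : DefP L Q) :
    DefP L (fun v => P v → Q v) :=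
  (h.not.or h').congr fun v => by tauto

theorem DefP.allFin [Finite γ] {P : γ → (α → R) → Prop} (h : ∀ i, DefP L (P i)) :
    DefP L (fun v => ∀ i, P i v) := by
  have := Set.definable_iInter_of_finite (L := L) (f := fun i => {v | P i v}) h
  unfold DefP
  convert this using 1
  ext v; simp

theorem DefP.exV [Finite β] {P : (α → R) → (β → R) → Prop}
    (h : DefP L (fun w : α ⊕ β → R => P (fun i => w (Sum.inl i)) (fun i => w (Sum.inr i)))) :
    DefP L (fun v => ∃ z, P v z) := Set.Definable.exists_of_finite h

theorem DefP.allV [Finite β] {P : (α → R) → (β → R) → Prop}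
    (h : DefP L (fun w : α ⊕ β → R => P (fun i => w (Sum.inl i)) (fun i => w (Sum.inr i)))) :
    DefP L (fun v => ∀ z, P v z) := Set.Definable.forall_of_finite h

theorem DefP.ex {P : (α → R) → R → Prop}
    (h : DefP L (fun w : α ⊕ Unit → R => P (fun i => w (Sum.inl i)) (w (Sum.inr ())))) :
    DefP L (fun v => ∃ z, P v z) := by
  refine (DefP.exV (β := Unit) (P := fun v z => P v (z ())) h).congr fun v => ?_
  exact ⟨fun ⟨z, hz⟩ => ⟨z (), hz⟩, fun ⟨z, hz⟩ => ⟨fun _ => z, hz⟩⟩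

theorem DefP.all {P : (α → R) → R → Prop}
    (h : DefP L (fun w : α ⊕ Unit → R => P (fun i => w (Sum.inl i)) (w (Sum.inr ())))) :
    DefP L (fun v => ∀ z, P v z) := by
  refine (DefP.allV (β := Unit) (P := fun v z => P v (z ())) h).congr fun v => ?_
  exact ⟨fun h z => h fun _ => z, fun h z => h (z ())⟩

theorem DefP.subst [Finite β] {P : (β → R) → Prop} (h : DefP L P) {f : β → (α → R) → R}
    (hf : ∀ b, DefF L (f b)) : DefP L (fun v => P (fun b => f b v)) :=
  Set.Definable.preimage_map (F := fun v b => f b v) hf h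

theorem DefP.reindexVars {P : (β → R) → Prop} (h : DefP L P) (f : β → α) :
    DefP L (fun v : α → R => P (fun b => v (f b))) :=
  Set.Definable.preimage_comp f h

theorem DefF.var (i : α) : DefF L (fun v : α → R => v i) := Set.DefinableFun.proj L

theorem DefF.const (c : R) : DefF L (fun _ : α → R => c) :=
  L.definableFun_const α (mem_univ c)

theorem DefP.eq {f g : (α → R) → R} (hf : DefF L f) (hg : DefF L g) :
    DefP L (fun v => f v = g v) := Set.DefinableFun.ofPred_eq hf hg

theorem DefP.subst2 [Finite β] [Finite γ] {P : (β → R) → (γ → R) → Prop}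
    (h : DefP L (fun w : β ⊕ γ → R => P (fun i => w (Sum.inl i)) (fun i => w (Sum.inr i))))
    {f : β → (α → R) → R} {g : γ → (α → R) → R}
    (hf : ∀ b, DefF L (f b)) (hg : ∀ b, DefF L (g b)) :
    DefP L (fun v => P (fun b => f b v) (fun b => g b v)) :=
  h.subst (f := fun s => Sum.elim f g s) (by rintro (b | b); exacts [hf b, hg b])

theorem DefP.subst1 [Finite β] {P : (β → R) → R → Prop}
    (h : DefP L (fun w : Option β → R => P (fun i => w (some i)) (w none)))
    {f : β → (α → R) → R} {g : (α → R) → R}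
    (hf : ∀ b, DefF L (f b)) (hg : DefF L g) :
    DefP L (fun v => P (fun b => f b v) (g v)) :=
  h.subst (f := fun s => Option.elim s g f) (by rintro (_ | b); exacts [hg, hf b])

variable [LinearOrder R]

theorem DefP.lt (hlt : IsDefinable L {v : Fin 2 → R | v 0 < v 1})
    {f g : (α → R) → R} (hf : DefF L f) (hg : DefF L g) :
    DefP L (fun v => f v < g v) :=
  DefP.subst (P := fun v : Fin 2 → R => v 0 < v 1) hlt (f := ![f, g])
    (by intro b; fin_cases b; exacts [hf, hg])

theorem DefP.le (hlt : IsDefinable L {v : Fin 2 → R | v 0 < v 1})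
    {f g : (α → R) → R} (hf : DefF L f) (hg : DefF L g) :
    DefP L (fun v => f v ≤ g v) :=
  (DefP.lt hlt hg hf).not.congr fun v => not_lt

theorem DefF.add [AddCommGroup R] (hadd : IsDefinable L {v : Fin 3 → R | v 0 + v 1 = v 2})
    {f g : (α → R) → R} (hf : DefF L f) (hg : DefF L g) :
    DefF L (fun v => f v + g v) := by
  have h0 : DefF L (fun v : Fin 2 → R => v 0 + v 1) := by
    have := DefP.subst (P := fun v : Fin 3 → R => v 0 + v 1 = v 2) hadd
      (α := Option (Fin 2)) (f := ![fun v => v (some 0), fun v => v (some 1), fun v => v none])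
      (by intro b; fin_cases b <;> exact DefF.var _)
    exact this
  exact Set.DefinableFun.comp (L := L) (A := univ) (f := fun v : Fin 2 → R => v 0 + v 1)
    (g := fun v => ![f v, g v]) (by intro b; fin_cases b; exacts [hf, hg]) h0

end DefCalc

section Compactness

open FirstOrder Set Filter

/-- Two tuples differ by less than `ε` in each coordinate. -/
def Near {R : Type*} [LinearOrder R] [AddCommGroup R] {ι : Type} (ε : R) (y z : ι → R) : Prop :=
  ∀ i, y i < z i + ε ∧ z i < y i + ε

/-- `D` is `ε`-separated. -/
def SepSet {R : Type*} [LinearOrder R] [AddCommGroup R] {ι : Type} (ε : R)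
    (D : Set (ι → R)) : Prop :=
  ∀ y ∈ D, ∀ z ∈ D, Near ε y z → y = z

variable {L : FirstOrder.Language} {R : Type*} [L.Structure R] [LinearOrder R] [AddCommGroup R]
  [IsOrderedAddMonoid R]

theorem Near.trans' {ι : Type} {η ε : R} (h : η + η ≤ ε) {y z u : ι → R}
    (h1 : Near η y u) (h2 : Near η z u) : Near ε y z := by
  intro i
  obtain ⟨a, b⟩ := h1 i
  obtain ⟨c, d⟩ := h2 i
  constructor
  · calc y i < u i + η := a
      _ < z i + η + η := by gcongr
      _ = z i + (η + η) := by abel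
      _ ≤ z i + ε := by gcongr
  · calc z i < u i + η := c
      _ < y i + η + η := by gcongr
      _ = y i + (η + η) := by abel
      _ ≤ y i + ε := by gcongr

theorem exists_half [DenselyOrdered R] {ε : R} (h : 0 < ε) : ∃ η : R, 0 < η ∧ η + η ≤ ε := by
  obtain ⟨η, h1, h2⟩ := exists_between h
  refine ⟨min η (ε - η), lt_min h1 (sub_pos.2 h2), ?_⟩
  calc min η (ε - η) + min η (ε - η) ≤ η + (ε - η) := by
        gcongr
        · exact min_le_left _ _
        · exact min_le_right _ _
    _ = ε := by abel

theorem exists_lub' (hDC : DCProp L R) {P : R → Prop}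
    (hP : DefP L (fun v : Fin 1 → R => P (v 0))) (hne : ∃ t, P t) (hb : ∃ d, ∀ t, P t → t ≤ d) :
    ∃ s, IsLUB {t | P t} s :=
  hDC {t | P t} hP hne (by obtain ⟨d, hd⟩ := hb; exact ⟨d, fun t ht => hd t ht⟩)

theorem exists_glb' (hlt : IsDefinable L {v : Fin 2 → R | v 0 < v 1})
    (hDC : DCProp L R) {P : R → Prop}
    (hP : DefP L (fun v : Fin 1 → R => P (v 0))) (hne : ∃ t, P t) (hb : ∃ d, ∀ t, P t → d ≤ t) :
    ∃ s, IsGLB {t | P t} s := by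
  obtain ⟨s, hs⟩ := exists_lub' hDC (P := fun d => ∀ t, P t → d ≤ t)
    (by
      refine DefP.all (P := fun v t => P t → v 0 ≤ t) ?_
      refine DefP.imp ?_ (DefP.le hlt (DefF.var _) (DefF.var _))
      exact hP.subst (f := fun _ w => w (Sum.inr ())) fun _ => DefF.var _)
    hb (by obtain ⟨t, ht⟩ := hne; exact ⟨t, fun d hd => hd t ht⟩)
  exact ⟨s, fun t ht => hs.2 fun d hd => hd t ht, fun d hd => hs.1 fun t ht => hd ht⟩

theorem def_near (hlt : IsDefinable L {v : Fin 2 → R | v 0 < v 1})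
    (hadd : IsDefinable L {v : Fin 3 → R | v 0 + v 1 = v 2}) {α ι : Type} [Finite ι]
    {e : (α → R) → R} {f g : ι → (α → R) → R} (he : DefF L e) (hf : ∀ i, DefF L (f i))
    (hg : ∀ i, DefF L (g i)) : DefP L (fun v => Near (e v) (fun i => f i v) (fun i => g i v)) :=
  DefP.allFin fun i => (DefP.lt hlt (hf i) (DefF.add hadd (hg i) he)).and
    (DefP.lt hlt (hg i) (DefF.add hadd (hf i) he))

/-- The statement of definable compactness for tuples indexed by `ι`. -/
def CompactStmt (L : FirstOrder.Language) (R : Type*) [L.Structure R] [LinearOrder R]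
    [AddCommGroup R] (ι : Type) : Prop :=
  ∀ F : R → (ι → R) → Prop, DefP L (fun w : Option ι → R => F (w none) (fun i => w (some i))) →
    (∀ δ, 0 < δ → ∃ y, F δ y) → (∀ δ δ' y, δ ≤ δ' → F δ y → F δ' y) →
    (∃ c d : ι → R, ∀ δ y, F δ y → ∀ i, c i ≤ y i ∧ y i ≤ d i) →
    ∃ u, ∀ δ, 0 < δ → ∀ η, 0 < η → ∃ y, F δ y ∧ Near η y u

theorem compact_equiv {ι κ : Type} (e : ι ≃ κ) (h : CompactStmt L R ι) :
    CompactStmt L R κ := by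
  rintro F hF hne hmono ⟨c, d, hcd⟩
  obtain ⟨u, hu⟩ := h (fun δ y => F δ (fun k => y (e.symm k)))
    (DefP.reindexVars (P := fun w : Option κ → R => F (w none) (fun i => w (some i))) hF
      (Option.map e.symm))
    (fun δ hδ => by
      obtain ⟨y, hy⟩ := hne δ hδ
      exact ⟨fun i => y (e i), by simpa using hy⟩)
    (fun δ δ' y hle hy => hmono _ _ _ hle hy)
    ⟨fun i => c (e i), fun i => d (e i), fun δ y hy i => by simpa using hcd δ _ hy (e i)⟩
  refine ⟨fun k => u (e.symm k), fun δ hδ η hη => ?_⟩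
  obtain ⟨y, hy, hn⟩ := hu δ hδ η hη
  exact ⟨_, hy, fun k => hn (e.symm k)⟩

theorem compact_option (hlt : IsDefinable L {v : Fin 2 → R | v 0 < v 1})
    (hadd : IsDefinable L {v : Fin 3 → R | v 0 + v 1 = v 2}) (hDC : DCProp L R)
    [NoMaxOrder R]
    {ι : Type} [Finite ι] (h : CompactStmt L R ι) : CompactStmt L R (Option ι) := by
  rintro F hF hne hmono ⟨c, d, hcd⟩
  obtain ⟨o, ho⟩ := exists_gt (0 : R)
  have hF' : ∀ {α : Type} {e : (α → R) → R} {g : Option ι → (α → R) → R}, DefF L e →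
      (∀ i, DefF L (g i)) → DefP L (fun v => F (e v) (fun i => g i v)) := by
    intro α e g he hg
    exact DefP.subst (P := fun w : Option (Option ι) → R => F (w none) (fun i => w (some i))) hF
      (f := fun o => Option.elim o e g) (by rintro (_ | k); exacts [he, hg k])
  obtain ⟨s, hs⟩ := exists_lub' hDC (P := fun t => ∃ δ, 0 < δ ∧ ∀ y, F δ y → t ≤ y none)
    (by
      refine DefP.ex (P := fun v δ => 0 < δ ∧ ∀ y, F δ y → v 0 ≤ y none) ?_
      refine (DefP.lt hlt (DefF.const _) (DefF.var _)).and ?_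
      refine DefP.allV (P := fun v y => F (v (Sum.inr ())) y → v (Sum.inl 0) ≤ y none) ?_
      exact (hF' (DefF.var _) (fun i => DefF.var _)).imp (DefP.le hlt (DefF.var _) (DefF.var _)))
    ⟨c none, o, ho, fun y hy => (hcd _ _ hy none).1⟩
    (by
      refine ⟨d none, ?_⟩
      rintro t ⟨δ, hδ, ht⟩
      obtain ⟨y, hy⟩ := hne δ hδ
      exact (ht y hy).trans (hcd _ _ hy none).2)
  have key : ∀ δ, 0 < δ → ∃ y, F δ y ∧ y none < s + δ ∧ s < y none + δ := by
    intro δ hδ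
    have h1 : ∃ t, (∃ δ, 0 < δ ∧ ∀ y, F δ y → t ≤ y none) ∧ s - δ < t := by
      by_contra! hcon
      have := hs.2 (fun t ht => hcon t ht : s - δ ∈ upperBounds _)
      exact absurd this (not_le.2 (sub_lt_self s hδ))
    obtain ⟨t, ⟨δ1, hδ1, ht⟩, hst⟩ := h1
    have h2 : ∃ y, F (min δ δ1) y ∧ y none < s + δ := by
      by_contra! hcon
      have := hs.1 (⟨min δ δ1, lt_min hδ hδ1, hcon⟩ :
        s + δ ∈ {t | ∃ δ, 0 < δ ∧ ∀ y, F δ y → t ≤ y none})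
      exact absurd this (not_le.2 (lt_add_of_pos_right s hδ))
    obtain ⟨y, hy, hys⟩ := h2
    refine ⟨y, hmono _ _ _ (min_le_left _ _) hy, hys, ?_⟩
    have := ht y (hmono _ _ _ (min_le_right _ _) hy)
    exact sub_lt_iff_lt_add.1 (hst.trans_le this)
  obtain ⟨u, hu⟩ := h (fun δ z => ∃ t, F δ (optCons t z) ∧ t < s + δ ∧ s < t + δ)
    (by
      refine DefP.ex (P := fun (w : Option ι → R) t => F (w none) (optCons t (fun i => w (some i)))
        ∧ t < s + w none ∧ s < t + w none) ?_
      refine DefP.and ?_ ((DefP.lt hlt (DefF.var _) (DefF.add hadd (DefF.const _) (DefF.var _))).and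
        (DefP.lt hlt (DefF.const _) (DefF.add hadd (DefF.var _) (DefF.var _))))
      refine hF' (g := fun o w => optCons (w (Sum.inr ())) (fun i => w (Sum.inl (some i))) o)
        (DefF.var _) ?_
      rintro (_ | i)
      · exact DefF.var _
      · exact DefF.var (Sum.inl (some i)))
    (fun δ hδ => by
      obtain ⟨y, hy, h1, h2⟩ := key δ hδ
      exact ⟨y ∘ some, y none, by rwa [optCons_eta], h1, h2⟩)
    (by
      rintro δ δ' y hle ⟨t, h1, h2, h3⟩
      exact ⟨t, hmono _ _ _ hle h1, h2.trans_le (by gcongr), h3.trans_le (by gcongr)⟩)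
    ⟨fun i => c (some i), fun i => d (some i), by
      rintro δ y ⟨t, h1, -⟩ i
      exact hcd _ _ h1 (some i)⟩
  refine ⟨optCons s u, fun δ hδ η hη => ?_⟩
  obtain ⟨z, ⟨t, h1, h2, h3⟩, hz⟩ := hu (min δ η) (lt_min hδ hη) η hη
  refine ⟨optCons t z, hmono _ _ _ (min_le_left _ _) h1, ?_⟩
  rintro (_ | i)
  · exact ⟨h2.trans_le (add_le_add_right (min_le_right _ _) _),
      h3.trans_le (add_le_add_right (min_le_right _ _) _)⟩
  · exact hz i

theorem compact_all (hlt : IsDefinable L {v : Fin 2 → R | v 0 < v 1})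
    (hadd : IsDefinable L {v : Fin 3 → R | v 0 + v 1 = v 2}) (hDC : DCProp L R)
    [NoMaxOrder R] (ι : Type) [Finite ι] : CompactStmt L R ι := by
  induction ι using Finite.induction_empty_option with
  | of_equiv e h => exact compact_equiv e h
  | h_empty =>
    intro F hF hne _ _
    refine ⟨fun i => i.elim, fun δ hδ η hη => ?_⟩
    obtain ⟨y, hy⟩ := hne δ hδ
    exact ⟨y, hy, fun i => i.elim⟩
  | h_option h => exact compact_option hlt hadd hDC h

/-- A coordinate projection of a bounded definable separated set is separated. -/
theorem sep_proj (hlt : IsDefinable L {v : Fin 2 → R | v 0 < v 1})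
    (hadd : IsDefinable L {v : Fin 3 → R | v 0 + v 1 = v 2}) (hDC : DCProp L R)
    [NoMaxOrder R] [DenselyOrdered R] {κ : Type} [Finite κ] {D : (κ → R) → Prop} (hD : DefP L D)
    {c d : κ → R} (hcd : ∀ y, D y → ∀ i, c i ≤ y i ∧ y i ≤ d i) {ε : R} (hε : 0 < ε)
    (hsep : SepSet ε {y | D y}) (k : κ) :
    ∃ δ, 0 < δ ∧ ∀ y z, D y → D z → y k < z k + δ → z k < y k + δ → y k = z k := by
  by_contra! hcon
  obtain ⟨u, hu⟩ := compact_all hlt hadd hDC (κ ⊕ κ)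
    (fun δ w => (D (fun i => w (Sum.inl i)) ∧ D (fun i => w (Sum.inr i))) ∧
      (w (Sum.inl k) < w (Sum.inr k) + δ ∧ w (Sum.inr k) < w (Sum.inl k) + δ) ∧
      ¬ w (Sum.inl k) = w (Sum.inr k))
    (by
      refine ((hD.subst fun i => DefF.var _).and (hD.subst fun i => DefF.var _)).and
        (((DefP.lt hlt (DefF.var _) (DefF.add hadd (DefF.var _) (DefF.var _))).and
        (DefP.lt hlt (DefF.var _) (DefF.add hadd (DefF.var _) (DefF.var _)))).and
        (DefP.eq (DefF.var _) (DefF.var _)).not))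
    (fun δ hδ => by
      obtain ⟨y, z, h1, h2, h3, h4, h5⟩ := hcon δ hδ
      exact ⟨Sum.elim y z, ⟨h1, h2⟩, ⟨h3, h4⟩, h5⟩)
    (by
      rintro δ δ' w hle ⟨h1, ⟨h2, h3⟩, h4⟩
      exact ⟨h1, ⟨h2.trans_le (by gcongr), h3.trans_le (by gcongr)⟩, h4⟩)
    ⟨Sum.elim c c, Sum.elim d d, by
      rintro δ w ⟨⟨h1, h2⟩, -⟩ (i | i)
      · exact hcd _ h1 i
      · exact hcd _ h2 i⟩
  obtain ⟨η, hη, hηε⟩ := exists_half hε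
  obtain ⟨w, ⟨⟨h1, h2⟩, -, h3⟩, hw⟩ := hu ε hε η hη
  obtain ⟨w', ⟨⟨h1', h2'⟩, ⟨h4, h5⟩, -⟩, hw'⟩ :=
    hu |w (Sum.inl k) - w (Sum.inr k)| (abs_pos.2 (sub_ne_zero.2 h3)) η hη
  have e1 := hsep _ h1 _ h1' (Near.trans' (u := fun i => u (Sum.inl i)) hηε
    (fun i => hw (Sum.inl i)) (fun i => hw' (Sum.inl i)))
  have e2 := hsep _ h2 _ h2' (Near.trans' (u := fun i => u (Sum.inr i)) hηε
    (fun i => hw (Sum.inr i)) (fun i => hw' (Sum.inr i)))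
  have f1 := congrFun e1 k
  have f2 := congrFun e2 k
  rw [← f1, ← f2] at h4 h5
  rcases le_total (w (Sum.inl k)) (w (Sum.inr k)) with h | h
  · rw [abs_sub_comm, abs_of_nonneg (sub_nonneg.2 h)] at h5
    simp at h5
  · rw [abs_of_nonneg (sub_nonneg.2 h)] at h4
    simp at h4

/-- Counting lemma: a set in which successors exist and all of whose finite initial segments
have at most `N` elements has at most `N` elements. -/
theorem encard_le_of_initial {E : Set R} {N : ℕ} {p : R} (hp : ∀ y ∈ E, p < y)
    (hmin : ∀ t, (E ∩ Ioi t).Nonempty → ∃ s, IsLeast (E ∩ Ioi t) s)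
    (h : ∀ x ∈ E, (E ∩ Iic x).Finite → (E ∩ Iic x).encard ≤ N) : E.encard ≤ N := by
  have key : ∀ k : ℕ, E.encard ≤ k ∨ ∃ x ∈ E, (E ∩ Iic x).encard = k + 1 := by
    intro k
    induction k with
    | zero =>
      rcases E.eq_empty_or_nonempty with rfl | ⟨y, hy⟩
      · left; simp
      · right
        obtain ⟨s, hs⟩ := hmin p ⟨y, hy, hp y hy⟩
        refine ⟨s, hs.1.1, ?_⟩
        have : E ∩ Iic s = {s} := by
          ext z
          constructor
          · rintro ⟨h1, h2⟩
            exact le_antisymm h2 (hs.2 ⟨h1, hp z h1⟩)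
          · rintro rfl
            exact ⟨hs.1.1, le_refl _⟩
        rw [this]; simp
    | succ k ih =>
      rcases ih with ih | ⟨x, hx, ih⟩
      · left
        exact ih.trans (by exact_mod_cast Nat.le_succ k)
      · rcases (E ∩ Ioi x).eq_empty_or_nonempty with he | hne
        · left
          have : E = E ∩ Iic x := by
            ext z
            refine ⟨fun hz => ⟨hz, ?_⟩, fun hz => hz.1⟩
            by_contra hcon
            have : z ∈ E ∩ Ioi x := ⟨hz, not_le.1 hcon⟩
            rw [he] at this; exact this
          rw [this, ih]; norm_cast
        · right
          obtain ⟨s, hs⟩ := hmin x hne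
          refine ⟨s, hs.1.1, ?_⟩
          have : E ∩ Iic s = insert s (E ∩ Iic x) := by
            ext z
            constructor
            · rintro ⟨h1, h2⟩
              rcases le_or_gt z x with h | h
              · exact Or.inr ⟨h1, h⟩
              · exact Or.inl (le_antisymm h2 (hs.2 ⟨h1, h⟩))
            · rintro (rfl | ⟨h1, h2⟩)
              · exact ⟨hs.1.1, le_refl _⟩
              · exact ⟨h1, h2.trans hs.1.2.le⟩
          rw [this, encard_insert_of_notMem, ih]
          · norm_cast
          · rintro ⟨-, h2⟩
            exact absurd h2 (not_le.2 hs.1.2)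
  rcases key N with h1 | ⟨x, hx, h1⟩
  · exact h1
  · have := h x hx (by rw [← encard_lt_top_iff, h1]; exact_mod_cast ENat.natCast_lt_top (N + 1))
    rw [h1] at this
    exact absurd this (by norm_cast; omega)

end Compactness

section CoreSec

open FirstOrder Set Filter

/-- Abstract form of the three finiteness conditions: `A a` is the filter in which parameters
vary around `a`, and `S a` is the filter of admissible intervals around `a`. -/
structure FinSys (L : FirstOrder.Language) (R : Type*) [L.Structure R] [LinearOrder R]
    [TopologicalSpace R] (A : R → Filter R) (S : R → Filter (R × R)) : Prop where
  nhds_le : ∀ a, 𝓝 a ≤ A a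
  small : ∀ a, ∀ V ∈ A a, ∀ᶠ J in S a, Icc J.1 J.2 ⊆ V
  around : ∀ a, ∀ᶠ J in S a, J.1 < a ∧ a < J.2
  luf : ∀ (β : Type) [Finite β] (P : (β → R) → R → Prop),
    DefP L (fun w : Option β → R => P (fun i => w (some i)) (w none)) →
    ∀ (b : β → R) (a : R), ∃ N : ℕ, ∀ᶠ z in S a ×ˢ Filter.pi (fun i => A (b i)),
      ({y | P z.2 y} ∩ Icc z.1.1 z.1.2).Finite →
        ({y | P z.2 y} ∩ Icc z.1.1 z.1.2).encard ≤ N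

theorem tendsto_optCons {R : Type*} {A : R → Filter R} {X : Type*} {l : Filter X} {β : Type}
    {f : X → R} {g : X → β → R} {t : R} {b : β → R} (hf : Tendsto f l (A t))
    (hg : Tendsto g l (Filter.pi fun i => A (b i))) :
    Tendsto (fun u => optCons (f u) (g u)) l (Filter.pi fun i => A (optCons t b i)) := by
  rw [tendsto_pi] at hg ⊢
  rintro (_ | i)
  · exact hf
  · exact hg i

theorem tendsto_sumElim {R : Type*} {A : R → Filter R} {X : Type*} {l : Filter X} {β γ : Type}
    {f : X → β → R} {g : X → γ → R} {t : β → R} {b : γ → R}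
    (hf : Tendsto f l (Filter.pi fun i => A (t i)))
    (hg : Tendsto g l (Filter.pi fun i => A (b i))) :
    Tendsto (fun u => (Sum.elim (f u) (g u) : β ⊕ γ → R)) l
      (Filter.pi fun i => A (Sum.elim t b i)) := by
  rw [tendsto_pi] at hf hg ⊢
  rintro (i | i)
  · exact hf i
  · exact hg i

variable {L : FirstOrder.Language} {R : Type*} [L.Structure R] [LinearOrder R] [AddCommGroup R]
  [IsOrderedAddMonoid R] [TopologicalSpace R]
  {A : R → Filter R} {S : R → Filter (R × R)}

theorem FinSys.unif (H : FinSys L R A S) {X : Type*} {l : Filter X} {κ : Type} [Finite κ]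
    {a : κ → R} {g : X → κ → R × R} (hg : ∀ k, Tendsto (fun u => g u k) l (S (a k)))
    {s : X → (κ → R) → Prop} (hs : ∀ᶠ z in l ×ˢ Filter.pi (fun k => A (a k)), s z.1 z.2) :
    ∀ᶠ u in l, ∀ w : κ → R, (∀ k, w k ∈ Icc (g u k).1 (g u k).2) → s u w := by
  obtain ⟨U, hU, W, hW, hUW⟩ := Filter.mem_prod_iff.1 hs
  obtain ⟨I, -, t, ht, hI⟩ := Filter.mem_pi.1 hW
  have h2 : ∀ᶠ u in l, ∀ k, Icc (g u k).1 (g u k).2 ⊆ t k :=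
    eventually_all.2 fun k => (hg k).eventually (H.small (a k) (t k) (ht k))
  filter_upwards [hU, h2] with u hu h2 w hw
  exact hUW (show (u, w) ∈ U ×ˢ W from ⟨hu, hI fun k _ => h2 k (hw k)⟩)

theorem FinSys.unif1 (H : FinSys L R A S) {X : Type*} {l : Filter X}
    {a : R} {g : X → R × R} (hg : Tendsto g l (S a))
    {s : X → R → Prop} (hs : ∀ᶠ z in l ×ˢ A a, s z.1 z.2) :
    ∀ᶠ u in l, ∀ t ∈ Icc (g u).1 (g u).2, s u t := by
  obtain ⟨U, hU, W, hW, hUW⟩ := Filter.mem_prod_iff.1 hs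
  filter_upwards [hU, hg.eventually (H.small a W hW)] with u hu h2 w hw
  exact hUW (show (u, w) ∈ U ×ˢ W from ⟨hu, h2 hw⟩)

theorem core_one (hlt : IsDefinable L {v : Fin 2 → R | v 0 < v 1})
    (hDC : DCProp L R) [NoMinOrder R] (H : FinSys L R A S) (β : Type) [Finite β]
    (P : (β → R) → R → Prop)
    (hP : DefP L (fun w : Option β → R => P (fun i => w (some i)) (w none)))
    (b : β → R) (a : R) : ∃ N : ℕ, ∀ᶠ z in S a ×ˢ Filter.pi (fun i => A (b i)),
      (∃ ε, 0 < ε ∧ ∀ s t, P z.2 s → s ∈ Icc z.1.1 z.1.2 → P z.2 t → t ∈ Icc z.1.1 z.1.2 →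
        s < t + ε → t < s + ε → s = t) →
      ({y | P z.2 y} ∩ Icc z.1.1 z.1.2).encard ≤ N := by
  obtain ⟨N, hN⟩ := H.luf (Option β) (fun w y => P (fun i => w (some i)) y ∧ y ≤ w none)
    (by
      refine DefP.and ?_ (DefP.le hlt (DefF.var _) (DefF.var _))
      exact DefP.subst1 hP (fun b => DefF.var _) (DefF.var _))
    (optCons a b) a
  refine ⟨N, ?_⟩
  have T : Tendsto (fun u : ((R × R) × (β → R)) × R => (u.1.1, optCons u.2 u.1.2))
      ((S a ×ˢ Filter.pi (fun i => A (b i))) ×ˢ A a)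
      (S a ×ˢ Filter.pi (fun i => A (optCons a b i))) :=
    (tendsto_fst.comp tendsto_fst).prodMk
      (tendsto_optCons tendsto_snd (tendsto_snd.comp tendsto_fst))
  have h1 := H.unif1 (g := fun u : (R × R) × (β → R) => u.1)
    (l := S a ×ˢ Filter.pi (fun i => A (b i))) tendsto_fst
    (s := fun z t => ({y | P z.2 y ∧ y ≤ t} ∩ Icc z.1.1 z.1.2).Finite →
        ({y | P z.2 y ∧ y ≤ t} ∩ Icc z.1.1 z.1.2).encard ≤ N) (T.eventually hN)
  filter_upwards [h1] with z hz
  rintro ⟨ε, hε, hsep⟩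
  obtain ⟨p, hp⟩ := exists_lt z.1.1
  refine encard_le_of_initial (p := p) (fun y hy => hp.trans_le hy.2.1) ?_ ?_
  · intro t hne
    obtain ⟨s, hs⟩ := exists_glb' hlt hDC
      (P := fun y => (P z.2 y ∧ (z.1.1 ≤ y ∧ y ≤ z.1.2)) ∧ t < y)
      (by
        refine DefP.and (DefP.and ?_ (DefP.and ?_ ?_)) ?_
        · exact DefP.subst1 hP (f := fun b _ => z.2 b) (fun b => DefF.const _) (DefF.var _)
        · exact DefP.le hlt (DefF.const _) (DefF.var _)
        · exact DefP.le hlt (DefF.var _) (DefF.const _)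
        · exact DefP.lt hlt (DefF.const _) (DefF.var _))
      hne ⟨t, fun y hy => hy.2.le⟩
    have h3 : ∀ r, s < r → ∃ y, ((P z.2 y ∧ (z.1.1 ≤ y ∧ y ≤ z.1.2)) ∧ t < y) ∧ y < r := by
      intro r hr
      by_contra! hcon
      exact absurd (hs.2 (fun y hy => hcon y hy : r ∈ lowerBounds _)) (not_le.2 hr)
    obtain ⟨y, hy, hys⟩ := h3 (s + ε) (lt_add_of_pos_right s hε)
    refine ⟨y, hy, fun y' hy' => ?_⟩
    by_contra hlt'
    rw [not_le] at hlt'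
    have hsy' : s ≤ y' := hs.1 hy'
    have := hsep y' y hy'.1.1 hy'.1.2 hy.1.1 hy.1.2
      (hlt'.trans (lt_add_of_pos_right y hε)) (hys.trans_le (by gcongr))
    exact hlt'.ne this
  · intro x hx
    have := hz x hx.2
    have e : ({y | P z.2 y} ∩ Icc z.1.1 z.1.2) ∩ Iic x
        = {y | P z.2 y ∧ y ≤ x} ∩ Icc z.1.1 z.1.2 := by
      ext y
      simp only [mem_inter_iff, mem_Iic]
      exact ⟨fun h => ⟨⟨h.1.1, h.2⟩, h.1.2⟩, fun h => ⟨⟨h.1.1, h.2⟩, h.1.2⟩⟩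
    rw [e]
    exact this

/-- The part of the fiber of `P` over `x` in the box given by `J`. -/
def boxFib {β ι : Type} (P : (β → R) → (ι → R) → Prop) (J : ι → R × R) (x : β → R) :
    Set (ι → R) := {y | P x y ∧ ∀ i, (J i).1 ≤ y i ∧ y i ≤ (J i).2}

/-- Uniform finiteness of separated fibers. -/
def CoreStmt (L : FirstOrder.Language) {R : Type*} [L.Structure R] [LinearOrder R]
    [AddCommGroup R] (A : R → Filter R) (S : R → Filter (R × R)) (ι : Type) : Prop :=
  ∀ (β : Type) [Finite β] (P : (β → R) → (ι → R) → Prop),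
    DefP L (fun w : β ⊕ ι → R => P (fun i => w (Sum.inl i)) (fun i => w (Sum.inr i))) →
    ∀ (b : β → R) (a : ι → R), ∃ N : ℕ,
      ∀ᶠ z in Filter.pi (fun i => S (a i)) ×ˢ Filter.pi (fun i => A (b i)),
        (∃ ε, 0 < ε ∧ SepSet ε (boxFib P z.1 z.2)) → (boxFib P z.1 z.2).encard ≤ N

theorem core_equiv {ι κ : Type} (e : ι ≃ κ) (h : CoreStmt L A S ι) : CoreStmt L A S κ := by
  intro β _ P hP b a
  have hQ : DefP L (fun w : β ⊕ ι → R => P (fun i => w (Sum.inl i))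
      (fun k => w (Sum.inr (e.symm k)))) :=
    DefP.reindexVars (P := fun w : β ⊕ κ → R => P (fun i => w (Sum.inl i)) (fun i => w (Sum.inr i)))
      hP (fun s => Sum.map id e.symm s)
  obtain ⟨N, hN⟩ := h β (fun x y => P x (fun k => y (e.symm k)))
    hQ b (fun i => a (e i))
  refine ⟨N, ?_⟩
  have T : Tendsto (fun z : (κ → R × R) × (β → R) => ((fun i => z.1 (e i)), z.2))
      (Filter.pi (fun i => S (a i)) ×ˢ Filter.pi (fun i => A (b i)))
      (Filter.pi (fun i => S (a (e i))) ×ˢ Filter.pi (fun i => A (b i))) :=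
    (tendsto_pi.2 fun i => (tendsto_eval_pi (fun i => S (a i)) (e i)).comp tendsto_fst).prodMk
      tendsto_snd
  filter_upwards [T.eventually hN] with z hz
  rintro ⟨ε, hε, hsep⟩
  have him : boxFib P z.1 z.2 = (fun (y : ι → R) k => y (e.symm k)) ''
      boxFib (fun x y => P x (fun k => y (e.symm k))) (fun i => z.1 (e i)) z.2 := by
    ext y
    constructor
    · rintro ⟨h1, h2⟩
      exact ⟨fun i => y (e i), ⟨by simpa using h1, fun i => h2 (e i)⟩, by simp⟩
    · rintro ⟨y, ⟨h1, h2⟩, rfl⟩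
      exact ⟨h1, fun k => by simpa using h2 (e.symm k)⟩
  rw [him]
  refine (encard_image_le _ _).trans (hz ⟨ε, hε, ?_⟩)
  intro y hy y' hy' hn
  rw [him] at hsep
  have h3 : (fun k => y (e.symm k)) = fun k => y' (e.symm k) :=
    hsep _ ⟨y, hy, rfl⟩ _ ⟨y', hy', rfl⟩ (fun k => hn (e.symm k))
  funext i
  have h4 := congrFun h3 (e i)
  simp only [Equiv.symm_apply_apply] at h4
  exact h4

theorem encard_le_mul {X Y : Type*} (f : X → Y) {D : Set X} {N M : ℕ}
    (h1 : (f '' D).encard ≤ M) (h2 : ∀ t ∈ f '' D, (D ∩ f ⁻¹' {t}).encard ≤ N) :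
    D.encard ≤ ((N * M : ℕ) : ℕ∞) := by
  classical
  have hi := (encard_le_coe_iff_finite_ncard_le.1 h1)
  have hD : D.Finite := Set.Finite.of_finite_fibers f hi.1 fun t ht =>
    (encard_le_coe_iff_finite_ncard_le.1 (h2 t ht)).1
  obtain ⟨D, rfl⟩ := hD.exists_finset_coe
  rw [encard_coe_eq_coe_finsetCard]
  norm_cast
  refine (Finset.card_le_mul_card_image D N (f := f) ?_).trans (Nat.mul_le_mul_left _ ?_)
  · intro t ht
    have := h2 t (by simpa using ht)
    have e : (D : Set X) ∩ f ⁻¹' {t} = ((D.filter fun x => f x = t : Finset X) : Set X) := by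
      ext x; simp
    rw [e, encard_coe_eq_coe_finsetCard] at this
    exact_mod_cast this
  · rw [← Finset.coe_image, encard_coe_eq_coe_finsetCard] at h1
    exact_mod_cast h1

theorem core_option (hlt : IsDefinable L {v : Fin 2 → R | v 0 < v 1})
    (hadd : IsDefinable L {v : Fin 3 → R | v 0 + v 1 = v 2})
    (hDC : DCProp L R) [NoMinOrder R] [NoMaxOrder R] [DenselyOrdered R]
    (H : FinSys L R A S) {ι : Type} [Finite ι] (h : CoreStmt L A S ι) :
    CoreStmt L A S (Option ι) := by
  intro β _ P hP b a
  have hP' : ∀ {α : Type} {e : β → (α → R) → R} {g : Option ι → (α → R) → R},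
      (∀ i, DefF L (e i)) →
      (∀ i, DefF L (g i)) → DefP L (fun v => P (fun i => e i v) (fun i => g i v)) :=
    fun he hg => DefP.subst2 hP he hg
  obtain ⟨N1, hN1⟩ := h (Option β) (fun w z => P (fun i => w (some i)) (optCons (w none) z))
    (by
      refine hP' (g := fun o w => optCons (w (Sum.inl none)) (fun i => w (Sum.inr i)) o)
        (fun i => DefF.var _) ?_
      rintro (_ | i)
      · exact DefF.var _
      · exact DefF.var (Sum.inr i))
    (optCons (a none) b) (fun i => a (some i))
  obtain ⟨N2, hN2⟩ := core_one hlt hDC H (β ⊕ (ι ⊕ ι))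
    (fun w t => ∃ z : ι → R, P (fun i => w (Sum.inl i)) (optCons t z) ∧
      ∀ i, w (Sum.inr (Sum.inl i)) ≤ z i ∧ z i ≤ w (Sum.inr (Sum.inr i)))
    (by
      refine DefP.exV (P := fun (w : Option (β ⊕ (ι ⊕ ι)) → R) (z : ι → R) =>
        P (fun i => w (some (Sum.inl i))) (optCons (w none) z) ∧
        ∀ i, w (some (Sum.inr (Sum.inl i))) ≤ z i ∧ z i ≤ w (some (Sum.inr (Sum.inr i)))) ?_
      refine DefP.and ?_ (DefP.allFin fun i => (DefP.le hlt (DefF.var _) (DefF.var _)).and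
        (DefP.le hlt (DefF.var _) (DefF.var _)))
      refine hP' (g := fun o w => optCons (w (Sum.inl none)) (fun i => w (Sum.inr i)) o)
        (fun i => DefF.var _) ?_
      rintro (_ | i)
      · exact DefF.var _
      · exact DefF.var (Sum.inr i))
    (Sum.elim b (Sum.elim (fun i => a (some i)) (fun i => a (some i)))) (a none)
  refine ⟨N1 * N2, ?_⟩
  set l := Filter.pi (fun i => S (a i)) ×ˢ Filter.pi (fun i => A (b i)) with hl
  have hJ : ∀ o, Tendsto (fun u : (Option ι → R × R) × (β → R) => u.1 o) l (S (a o)) :=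
    fun o => (tendsto_eval_pi _ o).comp tendsto_fst
  have T1 : Tendsto (fun u : ((Option ι → R × R) × (β → R)) × R =>
      ((fun i => u.1.1 (some i)), optCons u.2 u.1.2)) (l ×ˢ A (a none))
      (Filter.pi (fun i => S (a (some i))) ×ˢ Filter.pi (fun i => A (optCons (a none) b i))) :=
    (tendsto_pi.2 fun i => (hJ (some i)).comp tendsto_fst).prodMk
      (tendsto_optCons tendsto_snd (tendsto_snd.comp tendsto_fst))
  have T2 : Tendsto (fun u : ((Option ι → R × R) × (β → R)) × (ι ⊕ ι → R) =>
      (u.1.1 none, (Sum.elim u.1.2 u.2 : β ⊕ (ι ⊕ ι) → R)))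
      (l ×ˢ Filter.pi (fun i => A (Sum.elim (fun i => a (some i)) (fun i => a (some i)) i)))
      (S (a none) ×ˢ Filter.pi (fun i => A (Sum.elim b
        (Sum.elim (fun i => a (some i)) (fun i => a (some i))) i))) :=
    ((hJ none).comp tendsto_fst).prodMk
      (tendsto_sumElim (tendsto_snd.comp tendsto_fst) tendsto_snd)
  have E1 := H.unif1 (hJ none) (s := fun u t =>
    (∃ ε, 0 < ε ∧ SepSet ε (boxFib (fun w z => P (fun i => w (some i)) (optCons (w none) z))
      (fun i => u.1 (some i)) (optCons t u.2))) →
    (boxFib (fun w z => P (fun i => w (some i)) (optCons (w none) z))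
      (fun i => u.1 (some i)) (optCons t u.2)).encard ≤ N1) (T1.eventually hN1)
  have E2 := H.unif (κ := ι ⊕ ι) (g := fun u i => u.1 (some (Sum.elim id id i)))
    (a := Sum.elim (fun i => a (some i)) (fun i => a (some i))) (l := l)
    (by rintro (i | i) <;> exact hJ (some i))
    (s := fun u w => (∃ ε, 0 < ε ∧ ∀ s t, (∃ z : ι → R, P u.2 (optCons s z) ∧
      ∀ i, w (Sum.inl i) ≤ z i ∧ z i ≤ w (Sum.inr i)) → s ∈ Icc (u.1 none).1 (u.1 none).2 →
      (∃ z : ι → R, P u.2 (optCons t z) ∧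
      ∀ i, w (Sum.inl i) ≤ z i ∧ z i ≤ w (Sum.inr i)) → t ∈ Icc (u.1 none).1 (u.1 none).2 →
      s < t + ε → t < s + ε → s = t) →
      ({t | ∃ z : ι → R, P u.2 (optCons t z) ∧
      ∀ i, w (Sum.inl i) ≤ z i ∧ z i ≤ w (Sum.inr i)} ∩
        Icc (u.1 none).1 (u.1 none).2).encard ≤ N2) (T2.eventually hN2)
  have E3 : ∀ᶠ u in l, ∀ o, (u.1 o).1 < a o ∧ a o < (u.1 o).2 :=
    eventually_all.2 fun o => (hJ o).eventually (H.around (a o))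
  filter_upwards [E1, E2, E3] with u e1 e2 e3
  rintro ⟨ε, hε, hsep⟩
  have hsep' := sep_proj hlt hadd hDC (D := fun y => y ∈ boxFib P u.1 u.2)
    (c := fun o => (u.1 o).1) (d := fun o => (u.1 o).2)
    (by
      refine DefP.and ?_ (DefP.allFin fun i => ?_)
      · exact hP' (e := fun i _ => u.2 i) (fun i => DefF.const _) (fun i => DefF.var _)
      · exact (DefP.le hlt (DefF.const _) (DefF.var _)).and
          (DefP.le hlt (DefF.var _) (DefF.const _)))
    (fun y hy => hy.2) hε hsep none
  obtain ⟨δ, hδ, hδs⟩ := hsep'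
  have mk : ∀ t (z : ι → R), P u.2 (optCons t z) →
      (∀ i, (u.1 (some i)).1 ≤ z i ∧ z i ≤ (u.1 (some i)).2) →
      t ∈ Icc (u.1 none).1 (u.1 none).2 → optCons t z ∈ boxFib P u.1 u.2 := by
    intro t z h1 h2 h3
    refine ⟨h1, ?_⟩
    rintro (_ | i)
    · exact h3
    · exact h2 i
  have c2 := e2 (Sum.elim (fun i => (u.1 (some i)).1) (fun i => (u.1 (some i)).2))
    (by
      rintro (i | i)
      · exact ⟨le_refl _, ((e3 (some i)).1.trans (e3 (some i)).2).le⟩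
      · exact ⟨((e3 (some i)).1.trans (e3 (some i)).2).le, le_refl _⟩)
    (by
      refine ⟨δ, hδ, ?_⟩
      rintro s t ⟨z, hz1, hz2⟩ hs ⟨z', hz1', hz2'⟩ ht h1 h2
      exact hδs _ _ (mk s z hz1 hz2 hs) (mk t z' hz1' hz2' ht) h1 h2)
  refine encard_le_mul (fun y => y none) (le_trans (encard_le_encard ?_) c2) ?_
  · rintro _ ⟨y, hy, rfl⟩
    refine ⟨⟨y ∘ some, ?_, fun i => hy.2 (some i)⟩, hy.2 none⟩
    rw [optCons_eta]; exact hy.1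
  · rintro _ ⟨y, hy, rfl⟩
    have c1 := e1 (y none) (hy.2 none) ⟨ε, hε, by
      intro z hz z' hz' hn
      have := hsep _ (mk (y none) z hz.1 hz.2 (hy.2 none))
        _ (mk (y none) z' hz'.1 hz'.2 (hy.2 none)) (by
          rintro (_ | i)
          · exact ⟨lt_add_of_pos_right _ hε, lt_add_of_pos_right _ hε⟩
          · exact hn i)
      funext i
      exact congrFun this (some i)⟩
    refine le_trans (le_trans (encard_le_encard ?_) (encard_image_le (optCons (y none)) _)) c1
    rintro y' ⟨hy', hyy⟩
    have hyy' : y' none = y none := hyy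
    refine ⟨y' ∘ some, ⟨?_, fun i => hy'.2 (some i)⟩, ?_⟩
    · change P u.2 (optCons (y none) (y' ∘ some))
      rw [← hyy', optCons_eta]; exact hy'.1
    · rw [← hyy', optCons_eta]

theorem core_all (hlt : IsDefinable L {v : Fin 2 → R | v 0 < v 1})
    (hadd : IsDefinable L {v : Fin 3 → R | v 0 + v 1 = v 2})
    (hDC : DCProp L R) [NoMinOrder R] [NoMaxOrder R] [DenselyOrdered R]
    (H : FinSys L R A S) (ι : Type) [Finite ι] : CoreStmt L A S ι := by
  induction ι using Finite.induction_empty_option with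
  | of_equiv e h => exact core_equiv e h
  | h_empty =>
    intro β _ P _ b a
    refine ⟨1, Eventually.of_forall fun z _ => ?_⟩
    rw [Nat.cast_one, encard_le_one_iff]
    intro y y' _ _
    funext i
    exact i.elim
  | h_option h => exact core_option hlt hadd hDC H h

end CoreSec

section FinalSec

open FirstOrder Set Filter

variable {L : FirstOrder.Language} {R : Type*} [L.Structure R] [LinearOrder R] [AddCommGroup R]
  [IsOrderedAddMonoid R] [TopologicalSpace R] [OrderTopology R]
  {A : R → Filter R} {S : R → Filter (R × R)}

theorem eventually_near [NoMinOrder R] [NoMaxOrder R] {ι : Type} [Finite ι] {y : ι → R}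
    {U : Set (ι → R)} (hU : U ∈ 𝓝 y) : ∀ᶠ ε in 𝓝[>] (0 : R), ∀ z, Near ε y z → z ∈ U := by
  rw [nhds_pi] at hU
  obtain ⟨I, -, t, ht, hI⟩ := Filter.mem_pi.1 hU
  have h : ∀ i, ∀ᶠ ε in 𝓝[>] (0 : R), ∀ r, y i < r + ε → r < y i + ε → r ∈ t i := by
    intro i
    obtain ⟨p, q, hpq, hs⟩ := mem_nhds_iff_exists_Ioo_subset.1 (ht i)
    have h1 : (0 : R) < min (y i - p) (q - y i) :=
      lt_min (sub_pos.2 hpq.1) (sub_pos.2 hpq.2)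
    filter_upwards [Ioo_mem_nhdsGT h1] with ε hε r h2 h3
    apply hs
    have h4 : ε < y i - p := hε.2.trans_le (min_le_left _ _)
    have h5 : ε < q - y i := hε.2.trans_le (min_le_right _ _)
    constructor
    · have : y i + ε < r + ε + (y i - p) := add_lt_add h2 h4
      have e : r + ε + (y i - p) = (y i + ε) + (r - p) := by abel
      rw [e] at this
      exact sub_pos.1 (pos_of_lt_add_right this)
    · have : y i + ε < q := by rw [add_comm]; exact lt_sub_iff_add_lt.1 h5
      exact h3.trans this
  filter_upwards [eventually_all.2 h] with ε hε z hz
  exact hI fun i _ => hε i (z i) (hz i).1 (hz i).2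

theorem disc_all (hlt : IsDefinable L {v : Fin 2 → R | v 0 < v 1})
    (hadd : IsDefinable L {v : Fin 3 → R | v 0 + v 1 = v 2})
    (hDC : DCProp L R) [NoMinOrder R] [NoMaxOrder R] [DenselyOrdered R]
    (H : FinSys L R A S) (β ι : Type) [Finite β] [Finite ι] (P : (β → R) → (ι → R) → Prop)
    (hP : DefP L (fun w : β ⊕ ι → R => P (fun i => w (Sum.inl i)) (fun i => w (Sum.inr i))))
    (b : β → R) (a : ι → R) : ∃ N : ℕ,
      ∀ᶠ z in Filter.pi (fun i => S (a i)) ×ˢ Filter.pi (fun i => A (b i)),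
        DiscreteSet (boxFib P z.1 z.2) → (boxFib P z.1 z.2).encard ≤ N := by
  let Q : R → (ι ⊕ ι → R) → (β → R) → (ι → R) → Prop := fun ε w x y =>
    (P x y ∧ ∀ i, w (Sum.inl i) ≤ y i ∧ y i ≤ w (Sum.inr i)) ∧
      ∀ y' : ι → R, (P x y' ∧ ∀ i, w (Sum.inl i) ≤ y' i ∧ y' i ≤ w (Sum.inr i)) →
        Near ε y y' → ∀ i, y i = y' i
  obtain ⟨N, hN⟩ := core_all hlt hadd hDC H ι (Option (β ⊕ (ι ⊕ ι)))
    (fun w y => Q (w none) (fun i => w (some (Sum.inr i))) (fun i => w (some (Sum.inl i))) y)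
    (by
      refine DefP.and (DefP.and ?_ ?_) ?_
      · exact DefP.subst2 hP (fun _ => DefF.var _) (fun _ => DefF.var _)
      · exact DefP.allFin fun i => (DefP.le hlt (DefF.var _) (DefF.var _)).and
          (DefP.le hlt (DefF.var _) (DefF.var _))
      · refine DefP.allV (P := fun (w : Option (β ⊕ (ι ⊕ ι)) ⊕ ι → R) (y' : ι → R) =>
          (P (fun i => w (Sum.inl (some (Sum.inl i)))) y' ∧
            ∀ i, w (Sum.inl (some (Sum.inr (Sum.inl i)))) ≤ y' i ∧
              y' i ≤ w (Sum.inl (some (Sum.inr (Sum.inr i))))) →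
          Near (w (Sum.inl none)) (fun i => w (Sum.inr i)) y' → ∀ i, w (Sum.inr i) = y' i) ?_
        refine DefP.imp (DefP.and ?_ ?_) (DefP.imp ?_ ?_)
        · exact DefP.subst2 hP (fun _ => DefF.var _) (fun _ => DefF.var _)
        · exact DefP.allFin fun i => (DefP.le hlt (DefF.var _) (DefF.var _)).and
            (DefP.le hlt (DefF.var _) (DefF.var _))
        · exact def_near hlt hadd (DefF.var _) (fun _ => DefF.var _) (fun _ => DefF.var _)
        · exact DefP.allFin fun i => DefP.eq (DefF.var _) (DefF.var _))
    (optCons 0 (Sum.elim b (Sum.elim a a))) a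
  refine ⟨N, ?_⟩
  set l := Filter.pi (fun i => S (a i)) ×ˢ Filter.pi (fun i => A (b i)) with hl
  have hJ : ∀ o, Tendsto (fun u : (ι → R × R) × (β → R) => u.1 o) l (S (a o)) :=
    fun o => (tendsto_eval_pi (fun i => S (a i)) o).comp tendsto_fst
  have T : Tendsto (fun u : (((ι → R × R) × (β → R)) × (ι ⊕ ι → R)) × R =>
      (u.1.1.1, optCons u.2 (Sum.elim u.1.1.2 u.1.2 : β ⊕ (ι ⊕ ι) → R)))
      ((l ×ˢ Filter.pi (fun i => A ((Sum.elim a a : ι ⊕ ι → R) i))) ×ˢ 𝓝 (0 : R))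
      (Filter.pi (fun i => S (a i)) ×ˢ
        Filter.pi (fun i => A (optCons 0 (Sum.elim b (Sum.elim a a)) i))) :=
    (tendsto_fst.comp (tendsto_fst.comp tendsto_fst)).prodMk
      (tendsto_optCons (tendsto_snd.mono_right (H.nhds_le 0))
        (tendsto_sumElim (tendsto_snd.comp (tendsto_fst.comp tendsto_fst))
          (tendsto_snd.comp tendsto_fst)))
  have E1 := (T.eventually hN).curry
  have E2 := H.unif (κ := ι ⊕ ι) (g := fun u i => u.1 (Sum.elim id id i))
    (a := Sum.elim a a) (l := l) (by rintro (i | i) <;> exact hJ i)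
    (s := fun u w => ∀ᶠ ε in 𝓝 (0 : R),
      (∃ δ, 0 < δ ∧ SepSet δ {y | Q ε w u.2 y ∧ ∀ i, (u.1 i).1 ≤ y i ∧ y i ≤ (u.1 i).2}) →
      {y | Q ε w u.2 y ∧ ∀ i, (u.1 i).1 ≤ y i ∧ y i ≤ (u.1 i).2}.encard ≤ N) E1
  have E3 : ∀ᶠ u in l, ∀ o, (u.1 o).1 < a o ∧ a o < (u.1 o).2 :=
    eventually_all.2 fun o => (hJ o).eventually (H.around (a o))
  filter_upwards [E2, E3] with u e2 e3 hdisc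
  have e := e2 (Sum.elim (fun i => (u.1 i).1) (fun i => (u.1 i).2))
    (by
      rintro (i | i)
      · exact ⟨le_refl _, ((e3 i).1.trans (e3 i).2).le⟩
      · exact ⟨((e3 i).1.trans (e3 i).2).le, le_refl _⟩)
  have e' : ∀ᶠ ε in 𝓝[>] (0 : R), {y | Q ε (Sum.elim (fun i => (u.1 i).1) (fun i => (u.1 i).2))
      u.2 y ∧ ∀ i, (u.1 i).1 ≤ y i ∧ y i ≤ (u.1 i).2}.encard ≤ N := by
    filter_upwards [nhdsWithin_le_nhds e, self_mem_nhdsWithin] with ε h1 hε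
    refine h1 ⟨ε, hε, ?_⟩
    rintro y ⟨⟨-, hy⟩, -⟩ y' ⟨⟨hy', -⟩, -⟩ hn
    exact funext (hy y' hy' hn)
  by_contra hcon
  rw [not_le] at hcon
  obtain ⟨D, hD, hDc⟩ := exists_subset_encard_eq (Order.add_one_le_of_lt hcon)
  have hDfin : D.Finite := by
    rw [← encard_lt_top_iff, hDc]; exact_mod_cast ENat.natCast_lt_top (N + 1)
  have e'' : ∀ᶠ ε in 𝓝[>] (0 : R), ∀ y ∈ D, Q ε (Sum.elim (fun i => (u.1 i).1)
      (fun i => (u.1 i).2)) u.2 y := by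
    refine (eventually_all_finite hDfin).2 fun y hy => ?_
    obtain ⟨U, hU, hyU, hUD⟩ := hdisc y (hD hy)
    filter_upwards [eventually_near (hU.mem_nhds hyU)] with ε hε
    refine ⟨hD hy, fun y' hy' hn i => ?_⟩
    have : y' ∈ U ∩ boxFib P u.1 u.2 := ⟨hε y' hn, hy'⟩
    rw [hUD] at this
    rw [mem_singleton_iff.1 this]
  obtain ⟨ε, h1, h2⟩ := (e'.and e'').exists
  have hsub : D ⊆ {y | Q ε (Sum.elim (fun i => (u.1 i).1) (fun i => (u.1 i).2)) u.2 y ∧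
      ∀ i, (u.1 i).1 ≤ y i ∧ y i ≤ (u.1 i).2} := fun y hy => ⟨h2 y hy, (hD hy).2⟩
  have := (encard_le_encard hsub).trans h1
  rw [hDc] at this
  exact absurd this (by norm_cast; omega)

theorem def_append {m n : ℕ} {X : Set (Fin (m + n) → R)} (hX : IsDefinable L X) :
    DefP L (fun w : Fin m ⊕ Fin n → R =>
      Fin.append (fun i => w (Sum.inl i)) (fun i => w (Sum.inr i)) ∈ X) := by
  refine DefP.subst (P := fun v => v ∈ X) hX
    (f := fun k w => Fin.append (fun i => w (Sum.inl i)) (fun i => w (Sum.inr i)) k) ?_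
  intro k
  induction k using Fin.addCases with
  | left i => simpa only [Fin.append_left] using DefF.var (Sum.inl i)
  | right i => simpa only [Fin.append_right] using DefF.var (Sum.inr i)

theorem def_transport {β : Type} [Finite β] {m : ℕ} (e : β ≃ Fin m) {P : (β → R) → R → Prop}
    (hP : DefP L (fun w : Option β → R => P (fun i => w (some i)) (w none))) :
    IsDefinable L {v : Fin (m + 1) → R | P (fun i => v (Fin.castSucc (e i))) (v (Fin.last m))} :=
  DefP.subst1 hP (fun _ => DefF.var _) (DefF.var _)

theorem fiber_transport {β : Type} {m : ℕ} (e : β ≃ Fin m) (P : (β → R) → R → Prop)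
    (x : β → R) :
    fiber1 {v : Fin (m + 1) → R | P (fun i => v (Fin.castSucc (e i))) (v (Fin.last m))}
      (fun i => x (e.symm i)) = {y | P x y} := by
  ext y
  simp [fiber1]

theorem fin_of_or {E : Set R} {N : ℕ} (h : E.Infinite ∨ E.ncard ≤ N) (hf : E.Finite) :
    E.encard ≤ N :=
  encard_le_coe_iff_finite_ncard_le.2 ⟨hf, h.resolve_left (fun hi => hi hf)⟩

theorem small_nhds [NoMinOrder R] [NoMaxOrder R] (a : R) (V : Set R) (hV : V ∈ 𝓝 a) :
    ∀ᶠ J in 𝓝[<] a ×ˢ 𝓝[>] a, Icc J.1 J.2 ⊆ V := by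
  obtain ⟨p, q, hpq, hs⟩ := mem_nhds_iff_exists_Ioo_subset.1 hV
  filter_upwards [prod_mem_prod (Ioo_mem_nhdsLT hpq.1) (Ioo_mem_nhdsGT hpq.2)] with J hJ
  exact (Icc_subset_Ioo hJ.1.1 hJ.2.2).trans hs

theorem around_nhds (a : R) : ∀ᶠ J in 𝓝[<] a ×ˢ 𝓝[>] a, J.1 < a ∧ a < J.2 :=
  prod_mem_prod self_mem_nhdsWithin self_mem_nhdsWithin

theorem within_nhds [NoMinOrder R] [NoMaxOrder R] {a p q : R} (h : a ∈ interior (Icc p q)) :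
    ∀ᶠ J in 𝓝[<] a ×ˢ 𝓝[>] a, a ∈ interior (Icc J.1 J.2) ∧ Icc J.1 J.2 ⊆ Icc p q := by
  filter_upwards [around_nhds a, small_nhds a _ (mem_interior_iff_mem_nhds.1 h)] with J h1 h2
  exact ⟨mem_interior_iff_mem_nhds.2 (Icc_mem_nhds h1.1 h1.2), h2⟩

theorem sys_luf2 [NoMinOrder R] [NoMaxOrder R] (h : LUF2 L R) :
    FinSys L R (fun a => 𝓝 a) (fun a => 𝓝[<] a ×ˢ 𝓝[>] a) where
  nhds_le _ := le_refl _
  small := small_nhds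
  around := around_nhds
  luf := by
    intro β _ P hP b a
    obtain ⟨m, ⟨e⟩⟩ := Finite.exists_equiv_fin β
    obtain ⟨N, -, p, q, hpq, U, ⟨c, d, rfl⟩, hbU, hN⟩ := h m _ (def_transport e hP) a
      (fun i => b (e.symm i))
    refine ⟨N, ?_⟩
    have hU : ∀ᶠ x in Filter.pi (fun i => 𝓝 (b i)),
        ∀ i, c i < x (e.symm i) ∧ x (e.symm i) < d i :=
      eventually_all.2 fun i =>
        (tendsto_eval_pi (fun i => 𝓝 (b i)) (e.symm i)).eventually (Ioo_mem_nhds (hbU i).1 (hbU i).2)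
    filter_upwards [prod_mem_prod (within_nhds hpq) hU] with z hz
    have := hN (fun i => z.2 (e.symm i)) hz.2 _ _ hz.1.1 hz.1.2
    rw [fiber_transport] at this
    exact fin_of_or this

theorem sys_luf1 [NoMinOrder R] [NoMaxOrder R] (h : LUF1 L R) :
    FinSys L R (fun _ => ⊤) (fun a => 𝓝[<] a ×ˢ 𝓝[>] a) where
  nhds_le _ := le_top
  small a V hV := by
    rw [mem_top] at hV
    exact Eventually.of_forall fun J => by rw [hV]; exact subset_univ _
  around := around_nhds
  luf := by
    intro β _ P hP b a
    obtain ⟨m, ⟨e⟩⟩ := Finite.exists_equiv_fin β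
    obtain ⟨N, -, p, q, hpq, hN⟩ := h m _ (def_transport e hP) a
    refine ⟨N, ?_⟩
    filter_upwards [prod_mem_prod (within_nhds hpq) univ_mem] with z hz
    have := hN (fun i => z.2 (e.symm i)) _ _ hz.1.1 hz.1.2
    rw [fiber_transport] at this
    exact fin_of_or this

theorem sys_sluf [NoMinOrder R] [NoMaxOrder R] {p q : R → R}
    (h : ∀ a, ∀ (m : ℕ) (X : Set (Fin (m + 1) → R)), IsDefinable L X →
      ∃ N : ℕ, 0 < N ∧
        ∀ (x : Fin m → R), ∀ p' q' : R,
          a ∈ interior (Set.Icc p' q') → Set.Icc p' q' ⊆ Set.Icc (p a) (q a) →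
            (fiber1 X x ∩ Set.Icc p' q').Infinite ∨ (fiber1 X x ∩ Set.Icc p' q').ncard ≤ N) :
    FinSys L R (fun _ => ⊤)
      (fun a => 𝓟 {J | (J.1 < a ∧ a < J.2) ∧ Icc J.1 J.2 ⊆ Icc (p a) (q a)}) where
  nhds_le _ := le_top
  small a V hV := by
    rw [mem_top] at hV
    exact Eventually.of_forall fun J => by rw [hV]; exact subset_univ _
  around a := by
    rw [eventually_principal]
    exact fun J hJ => hJ.1
  luf := by
    intro β _ P hP b a
    obtain ⟨m, ⟨e⟩⟩ := Finite.exists_equiv_fin β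
    obtain ⟨N, -, hN⟩ := h a m _ (def_transport e hP)
    refine ⟨N, ?_⟩
    filter_upwards [prod_mem_prod (mem_principal_self _) univ_mem] with z hz
    have := hN (fun i => z.2 (e.symm i)) _ _
      (mem_interior_iff_mem_nhds.2 (Icc_mem_nhds hz.1.1.1 hz.1.1.2)) hz.1.2
    rw [fiber_transport] at this
    exact fin_of_or this

/-- The closed box given by `J`. -/
def boxOf {ι : Type} (J : ι → R × R) : Set (ι → R) := {y | ∀ i, (J i).1 ≤ y i ∧ y i ≤ (J i).2}

theorem boxOf_closed {n : ℕ} (J : Fin n → R × R) : ClosedBox (boxOf J) :=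
  ⟨fun i => (J i).1, fun i => (J i).2, rfl⟩

theorem mem_boxOf {n : ℕ} {J : Fin n → R × R} {a : Fin n → R}
    (h : ∀ i, (J i).1 < a i ∧ a i < (J i).2) : a ∈ interior (boxOf J) := by
  rw [mem_interior_iff_mem_nhds]
  exact eventually_all.2 fun i => (continuous_apply i).continuousAt.eventually
    (Icc_mem_nhds (h i).1 (h i).2)

theorem concl_of {n : ℕ} {E : Set (Fin n → R)} {N : ℕ} (h : E.encard ≤ N) :
    E.Finite ∧ E.ncard ≤ N + 1 := by
  obtain ⟨h1, h2⟩ := encard_le_coe_iff_finite_ncard_le.1 h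
  exact ⟨h1, h2.trans (Nat.le_succ N)⟩

end FinalSec

/-- (Lemma on discrete fibers, with the `LUF₁` and `SLUF` refinements.)
Let `𝓡` be a definably complete expansion of a densely linearly ordered abelian group
satisfying `LUF₂`. For any definable `X ⊆ R^{m+n}` and `(b,a) ∈ R^m × R^n` there are a
positive integer `N`, a closed box `B ⊆ R^n` with `a ∈ int(B)` and an open box `U ∋ b`
such that for every `x ∈ U`, if `X_x ∩ B` is discrete then `|X_x ∩ B| ≤ N`.
Moreover `U` can be taken to be `R^m` if `𝓡 ⊨ LUF₁`, and `B` can be taken independently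
of `X` if `𝓡 ⊨ SLUF`. -/
theorem discrete_fibers_uniformly_finite
    {R : Type*} (L : FirstOrder.Language) [L.Structure R]
    [LinearOrder R] [DenselyOrdered R] [AddCommGroup R]
    [CovariantClass R R (· + ·) (· < ·)] [TopologicalSpace R] [OrderTopology R]
    (hlt : IsDefinable L {v : Fin 2 → R | v 0 < v 1})
    (hadd : IsDefinable L {v : Fin 3 → R | v 0 + v 1 = v 2})
    (hDC : DCProp L R) (hLUF2 : LUF2 L R) :
    (∀ (m n : ℕ) (X : Set (Fin (m + n) → R)), IsDefinable L X →
      ∀ (b : Fin m → R) (a : Fin n → R),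
        ∃ N : ℕ, 0 < N ∧ ∃ B : Set (Fin n → R), ClosedBox B ∧ a ∈ interior B ∧
          ∃ U : Set (Fin m → R), OpenBox U ∧ b ∈ U ∧
            ∀ x ∈ U, DiscreteSet (fiberN X x ∩ B) →
              (fiberN X x ∩ B).Finite ∧ (fiberN X x ∩ B).ncard ≤ N) ∧
    (LUF1 L R → ∀ (m n : ℕ) (X : Set (Fin (m + n) → R)), IsDefinable L X →
      ∀ a : Fin n → R,
        ∃ N : ℕ, 0 < N ∧ ∃ B : Set (Fin n → R), ClosedBox B ∧ a ∈ interior B ∧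
          ∀ x : Fin m → R, DiscreteSet (fiberN X x ∩ B) →
            (fiberN X x ∩ B).Finite ∧ (fiberN X x ∩ B).ncard ≤ N) ∧
    (SLUF L R → ∀ (n : ℕ) (a : Fin n → R),
      ∃ B : Set (Fin n → R), ClosedBox B ∧ a ∈ interior B ∧
        ∀ (m : ℕ) (X : Set (Fin (m + n) → R)), IsDefinable L X →
          ∃ N : ℕ, 0 < N ∧
            ∀ x : Fin m → R, DiscreteSet (fiberN X x ∩ B) →
              (fiberN X x ∩ B).Finite ∧ (fiberN X x ∩ B).ncard ≤ N) := by
  classical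
  haveI hmono : IsOrderedAddMonoid R :=
    { add_le_add_left := fun a b hab c => by
        rcases hab.eq_or_lt with rfl | hab
        · exact le_refl _
        · rw [add_comm a c, add_comm b c]
          exact (CovariantClass.elim (μ := fun x y : R => x + y) (r := fun x y : R => x < y)
            c hab).le }
  haveI hnt : Nontrivial R := by
    obtain ⟨N, -, p, q, -, U, ⟨c, d, rfl⟩, hU, -⟩ :=
      hLUF2 1 Set.univ Set.definable_univ 0 (fun _ => 0)
    exact ⟨⟨0, d 0, (hU 0).2.ne⟩⟩
  refine ⟨?_, ?_, ?_⟩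
  · intro m n X hX b a
    have H := sys_luf2 hLUF2
    obtain ⟨N, hN⟩ := disc_all hlt hadd hDC H (Fin m) (Fin n) (fun x y => Fin.append x y ∈ X)
      (def_append hX) b a
    obtain ⟨V, hV, W, hW, hVW⟩ := Filter.mem_prod_iff.1 hN
    have hV' : ∀ᶠ J in Filter.pi (fun i => 𝓝[<] (a i) ×ˢ 𝓝[>] (a i)),
        J ∈ V ∧ ∀ i, (J i).1 < a i ∧ a i < (J i).2 :=
      Filter.Eventually.and hV (Filter.eventually_pi fun i => H.around (a i))
    obtain ⟨J, hJV, hJ⟩ := hV'.exists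
    obtain ⟨I, -, t, ht, hI⟩ := Filter.mem_pi.1 hW
    choose c d hcd hs using fun i => mem_nhds_iff_exists_Ioo_subset.1 (ht i)
    refine ⟨N + 1, Nat.succ_pos N, boxOf J, boxOf_closed J, mem_boxOf hJ,
      {x | ∀ i, c i < x i ∧ x i < d i}, ⟨c, d, rfl⟩, hcd, fun x hx hdisc => ?_⟩
    exact concl_of (hVW (show (J, x) ∈ V ×ˢ W from ⟨hJV, hI fun i _ => hs i (hx i)⟩) hdisc)
  · intro h1 m n X hX a
    have H := sys_luf1 h1
    obtain ⟨N, hN⟩ := disc_all hlt hadd hDC H (Fin m) (Fin n) (fun x y => Fin.append x y ∈ X)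
      (def_append hX) (fun _ => 0) a
    obtain ⟨V, hV, W, hW, hVW⟩ := Filter.mem_prod_iff.1 hN
    have hV' : ∀ᶠ J in Filter.pi (fun i => 𝓝[<] (a i) ×ˢ 𝓝[>] (a i)),
        J ∈ V ∧ ∀ i, (J i).1 < a i ∧ a i < (J i).2 :=
      Filter.Eventually.and hV (Filter.eventually_pi fun i => H.around (a i))
    obtain ⟨J, hJV, hJ⟩ := hV'.exists
    obtain ⟨I, -, t, ht, hI⟩ := Filter.mem_pi.1 hW
    refine ⟨N + 1, Nat.succ_pos N, boxOf J, boxOf_closed J, mem_boxOf hJ, fun x hdisc => ?_⟩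
    exact concl_of (hVW (show (J, x) ∈ V ×ˢ W from ⟨hJV, hI fun i _ => by
      rw [Filter.mem_top.1 (ht i)]; exact mem_univ _⟩) hdisc)
  · intro h1 n a
    choose p q hpq h2 using h1
    have H := sys_sluf h2
    have hJ : ∀ i, p (a i) < a i ∧ a i < q (a i) := by
      intro i
      have := hpq (a i)
      rwa [interior_Icc] at this
    refine ⟨boxOf fun i => (p (a i), q (a i)), boxOf_closed _, mem_boxOf hJ, fun m X hX => ?_⟩
    obtain ⟨N, hN⟩ := disc_all hlt hadd hDC H (Fin m) (Fin n) (fun x y => Fin.append x y ∈ X)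
      (def_append hX) (fun _ => 0) a
    obtain ⟨V, hV, W, hW, hVW⟩ := Filter.mem_prod_iff.1 hN
    obtain ⟨I, -, t, ht, hI⟩ := Filter.mem_pi.1 hW
    obtain ⟨I', -, t', ht', hI'⟩ := Filter.mem_pi.1 hV
    refine ⟨N + 1, Nat.succ_pos N, fun x hdisc => ?_⟩
    exact concl_of (hVW (show ((fun i => (p (a i), q (a i))), x) ∈ V ×ˢ W from
      ⟨hI' fun i _ => Filter.mem_principal.1 (ht' i) ⟨hJ i, subset_rfl⟩, hI fun i _ => by
      rw [Filter.mem_top.1 (ht i)]; exact mem_univ _⟩) hdisc)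
end
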